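/- Let (s,u) be a global-in-time solution of problem (P) with initial data (s₀,φ) ∈ W satisfying lim_{t→∞} s(t) < ∞ and ‖u(t)‖_{L^∞} = O(e^{−αt}) as t → ∞ for some α > 0. Then there exists η > 0 such that for every (σ₀,ψ) ∈ W with |σ₀ − s₀| + ‖ψ − φ‖_{L^∞} < η (functions extended by zero), problem (P) with initial data (σ₀,ψ) admits a global-in-time solution (σ,v) satisfying lim_{t→∞} σ(t) < ∞ and ‖v(t)‖_{L^∞} = O(e^{−ᾱt}) as t → ∞ for some ᾱ > 0. -/

import Mathlib

open Set MeasureTheory Filter Topology Real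
open scoped ENNReal

noncomputable section

/-- `(s₀, φ)` belongs to the class `W`: `s₀ ∈ (0,∞)`, `φ` is Lipschitz on `[0,s₀]`,
not identically zero, nonnegative there, and vanishes at `s₀`. -/
def memW (s₀ : ℝ) (φ : ℝ → ℝ) : Prop :=
  0 < s₀ ∧ (∃ K : NNReal, LipschitzOnWith K φ (Icc 0 s₀)) ∧
    (∃ x ∈ Icc 0 s₀, φ x ≠ 0) ∧ (∀ x ∈ Icc 0 s₀, 0 ≤ φ x) ∧ φ s₀ = 0

/-- `(s,u)` is a solution of the one-phase Stefan problem (P) on `(0,T]` (finite `T`)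
with exponent `p` and initial data `(s₀,φ)`. -/
structure IsSolOn (p s₀ : ℝ) (φ : ℝ → ℝ) (T : ℝ) (s : ℝ → ℝ) (u : ℝ → ℝ → ℝ) : Prop where
  T_pos : 0 < T
  s_cont : ContinuousOn s (Icc 0 T)
  s_diff : ∀ t ∈ Ioc 0 T, DifferentiableAt ℝ s t
  s_deriv_cont : ContinuousOn (deriv s) (Ioc 0 T)
  s_pos : ∀ t ∈ Icc 0 T, 0 < s t
  ut_diff : ∀ t ∈ Ioc 0 T, ∀ x ∈ Ioo 0 (s t), DifferentiableAt ℝ (fun τ => u τ x) t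
  ux_diff : ∀ t ∈ Ioc 0 T, ∀ x ∈ Ioo 0 (s t), DifferentiableAt ℝ (u t) x
  uxx_diff : ∀ t ∈ Ioc 0 T, ∀ x ∈ Ioo 0 (s t), DifferentiableAt ℝ (deriv (u t)) x
  ut_cont : ContinuousOn (fun q : ℝ × ℝ => deriv (fun τ => u τ q.2) q.1)
      {q : ℝ × ℝ | q.1 ∈ Ioc 0 T ∧ q.2 ∈ Ioo 0 (s q.1)}
  uxx_cont : ContinuousOn (fun q : ℝ × ℝ => deriv (deriv (u q.1)) q.2)
      {q : ℝ × ℝ | q.1 ∈ Ioc 0 T ∧ q.2 ∈ Ioo 0 (s q.1)}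
  ux_cont : ContinuousOn (fun q : ℝ × ℝ => deriv (u q.1) q.2)
      {q : ℝ × ℝ | q.1 ∈ Ioc 0 T ∧ q.2 ∈ Icc 0 (s q.1)}
  u_cont : ContinuousOn (fun q : ℝ × ℝ => u q.1 q.2)
      {q : ℝ × ℝ | q.1 ∈ Icc 0 T ∧ q.2 ∈ Icc 0 (s q.1)}
  u_nonneg : ∀ t ∈ Icc 0 T, ∀ x ∈ Icc 0 (s t), 0 ≤ u t x
  heat : ∀ t ∈ Ioc 0 T, ∀ x ∈ Ioo 0 (s t),
      deriv (fun τ => u τ x) t = deriv (deriv (u t)) x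
  bc_zero : ∀ t ∈ Ioc 0 T, -deriv (u t) 0 = u t 0 ^ p
  bc_free : ∀ t ∈ Ioc 0 T, u t (s t) = 0
  stefan : ∀ t ∈ Ioc 0 T, deriv s t = -deriv (u t) (s t)
  init : ∀ x ∈ Icc 0 s₀, u 0 x = φ x
  init_s : s 0 = s₀

/-- `(s,u)` is a global-in-time solution of problem (P). -/
def IsGlobalSol (p s₀ : ℝ) (φ : ℝ → ℝ) (s : ℝ → ℝ) (u : ℝ → ℝ → ℝ) : Prop :=
  ∀ T : ℝ, 0 < T → IsSolOn p s₀ φ T s u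

/-- `Tm ∈ (0,∞]` is the maximal existence time of the solution `(s,u)` of (P) with
initial data `(s₀,φ)`: the solution exists on `(0,T]` for every `T < Tm`, and for
`T > Tm` problem (P) admits no solution on `(0,T]`. -/
def IsMaxSol (p s₀ : ℝ) (φ : ℝ → ℝ) (Tm : ℝ≥0∞) (s : ℝ → ℝ) (u : ℝ → ℝ → ℝ) : Prop :=
  0 < Tm ∧
    (∀ T : ℝ, 0 < T → ENNReal.ofReal T < Tm → IsSolOn p s₀ φ T s u) ∧
    (∀ T : ℝ, Tm < ENNReal.ofReal T → ¬∃ σ v, IsSolOn p s₀ φ T σ v)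

/-- The sup norm `‖u(t)‖_{L^∞(0,s(t))}`. -/
def supNorm (s : ℝ → ℝ) (u : ℝ → ℝ → ℝ) (t : ℝ) : ℝ :=
  sSup (u t '' Ioo 0 (s t))

/-- The `L¹` norm `‖u(t)‖_{L¹(0,s(t))}` of the nonnegative function `u(t,·)`. -/
def L1Norm (s : ℝ → ℝ) (u : ℝ → ℝ → ℝ) (t : ℝ) : ℝ :=
  ∫ x in (0:ℝ)..(s t), u t x

/-- The energy `E(s(t),u(t))`. -/
def energy (p : ℝ) (s : ℝ → ℝ) (u : ℝ → ℝ → ℝ) (t : ℝ) : ℝ :=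
  1 / 2 * (∫ x in (0:ℝ)..(s t), (deriv (u t) x) ^ 2) - u t 0 ^ (p + 1) / (p + 1)

/-- The extension of a function on `[0,a]` by zero outside `[0,a]`. -/
def extZero (a : ℝ) (f : ℝ → ℝ) : ℝ → ℝ := fun x => if x ∈ Icc 0 a then f x else 0

def D12 (w : ℝ → ℝ → ℝ) (t x a b : ℝ) : Prop :=
  HasDerivAt (fun τ => w τ x) a t ∧
    ∃ wx : ℝ → ℝ, (∀ᶠ y in 𝓝 x, HasDerivAt (w t) (wx y) y) ∧ HasDerivAt wx b x

theorem D12.sub {v w : ℝ → ℝ → ℝ} {t x a b c d : ℝ} (h : D12 v t x a b) (k : D12 w t x c d) :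
    D12 (fun t x => v t x - w t x) t x (a - c) (b - d) := by
  obtain ⟨h1, vx, h2, h3⟩ := h
  obtain ⟨k1, wx, k2, k3⟩ := k
  refine ⟨h1.sub k1, fun y => vx y - wx y, ?_, h3.sub k3⟩
  filter_upwards [h2, k2] with y hy ky using hy.sub ky

theorem D12.add {v w : ℝ → ℝ → ℝ} {t x a b c d : ℝ} (h : D12 v t x a b) (k : D12 w t x c d) :
    D12 (fun t x => v t x + w t x) t x (a + c) (b + d) := by
  obtain ⟨h1, vx, h2, h3⟩ := h
  obtain ⟨k1, wx, k2, k3⟩ := k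
  refine ⟨h1.add k1, fun y => vx y + wx y, ?_, h3.add k3⟩
  filter_upwards [h2, k2] with y hy ky using hy.add ky

theorem D12.const_mul {v : ℝ → ℝ → ℝ} {t x a b : ℝ} (c : ℝ) (h : D12 v t x a b) :
    D12 (fun t x => c * v t x) t x (c * a) (c * b) := by
  obtain ⟨h1, vx, h2, h3⟩ := h
  refine ⟨h1.const_mul c, fun y => c * vx y, ?_, h3.const_mul c⟩
  filter_upwards [h2] with y hy using hy.const_mul c

theorem D12.congr {v w : ℝ → ℝ → ℝ} {t x a b : ℝ} (h : D12 v t x a b)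
    (hvw : ∀ᶠ q in 𝓝 (t, x), w q.1 q.2 = v q.1 q.2) : D12 w t x a b := by
  obtain ⟨h1, vx, h2, h3⟩ := h
  have e1 : ∀ᶠ τ in 𝓝 t, w τ x = v τ x := by
    have : Tendsto (fun τ : ℝ => (τ, x)) (𝓝 t) (𝓝 (t, x)) := by
      apply Continuous.tendsto' (by fun_prop); rfl
    exact this.eventually hvw
  have e2 : ∀ᶠ y in 𝓝 x, w t y = v t y := by
    have : Tendsto (fun y : ℝ => (t, y)) (𝓝 x) (𝓝 (t, x)) := by
      apply Continuous.tendsto' (by fun_prop); rfl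
    exact this.eventually hvw
  refine ⟨h1.congr_of_eventuallyEq e1, vx, ?_, h3⟩
  filter_upwards [h2, e2.eventually_nhds] with y hy ky using hy.congr_of_eventuallyEq ky

theorem deriv_nonneg_left {f : ℝ → ℝ} {d t : ℝ} (h : HasDerivWithinAt f d (Iic t) t)
    (hf : ∀ᶠ τ in 𝓝[<] t, f τ ≤ f t) : 0 ≤ d := by
  have h' : HasDerivWithinAt f d (Iio t) t := h.mono Iio_subset_Iic_self
  rw [hasDerivWithinAt_iff_tendsto_slope' (by simp)] at h'
  refine ge_of_tendsto h' ?_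
  filter_upwards [hf, self_mem_nhdsWithin] with τ h1 h2
  rw [slope_def_field]
  have : τ < t := h2
  exact div_nonneg_of_nonpos (by linarith) (by linarith)

theorem deriv_nonpos_right {f : ℝ → ℝ} {d t : ℝ} (h : HasDerivWithinAt f d (Ici t) t)
    (hf : ∀ᶠ τ in 𝓝[>] t, f τ ≤ f t) : d ≤ 0 := by
  have h' : HasDerivWithinAt f d (Ioi t) t := h.mono Ioi_subset_Ici_self
  rw [hasDerivWithinAt_iff_tendsto_slope' (by simp)] at h'
  refine le_of_tendsto h' ?_
  filter_upwards [hf, self_mem_nhdsWithin] with τ h1 h2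
  rw [slope_def_field]
  have : t < τ := h2
  exact div_nonpos_of_nonpos_of_nonneg (by linarith) (by linarith)

theorem second_deriv_test {f g : ℝ → ℝ} {x b : ℝ} (h1 : ∀ᶠ y in 𝓝 x, HasDerivAt f (g y) y)
    (h2 : HasDerivAt g b x) (hm : IsLocalMax f x) : b ≤ 0 := by
  by_contra hb
  push Not at hb
  have e : deriv f =ᶠ[𝓝 x] g := by
    filter_upwards [h1] with y hy using hy.deriv
  have d2 : deriv (deriv f) x = b := (h2.congr_of_eventuallyEq e).deriv
  have d1 : deriv f x = 0 := hm.deriv_eq_zero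
  have hmin := isLocalMin_of_deriv_deriv_pos (f := f) (x₀ := x) (by rw [d2]; exact hb) d1
    h1.self_of_nhds.continuousAt
  have hc : ∀ᶠ y in 𝓝 x, f y = f x := by
    filter_upwards [hm, hmin] with y a c using le_antisymm a c
  have : deriv f =ᶠ[𝓝 x] fun _ => 0 := by
    filter_upwards [hc.eventually_nhds] with y hy
    have : f =ᶠ[𝓝 y] fun _ => f x := hy
    rw [this.deriv_eq]; simp
  have := this.deriv_eq
  rw [d2] at this
  simp at this
  linarith

theorem first_touch {X : Type*} [TopologicalSpace X] {C : Set (ℝ × X)} (hC : IsCompact C)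
    {w : ℝ × X → ℝ} (hw : ContinuousOn w C) (hbad : ∃ q ∈ C, 0 ≤ w q) :
    ∃ q ∈ C, 0 ≤ w q ∧ (∀ q' ∈ C, q'.1 < q.1 → w q' < 0) ∧ (∀ q' ∈ C, q'.1 = q.1 → w q' ≤ w q) := by
  have hW : ∀ c : ℝ, IsCompact (C ∩ {q | c ≤ w q}) := by
    intro c
    have hcr : IsCompact C := hC
    obtain ⟨u, hu, he⟩ := continuousOn_iff_isClosed.1 hw (Ici c) isClosed_Ici
    have : C ∩ {q | c ≤ w q} = C ∩ u := by
      ext q; constructor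
      · rintro ⟨a, b⟩
        have : q ∈ w ⁻¹' Ici c ∩ C := ⟨b, a⟩
        rw [he] at this; exact ⟨a, this.1⟩
      · rintro ⟨a, b⟩
        have : q ∈ u ∩ C := ⟨b, a⟩
        rw [← he] at this; exact ⟨a, this.1⟩
    rw [this]; exact hC.inter_right hu
  obtain ⟨q0, hq0, hb⟩ := hbad
  obtain ⟨q1, ⟨hq1, hq1w⟩, hmin⟩ := (hW 0).exists_isMinOn ⟨q0, hq0, hb⟩
    (continuous_fst.continuousOn (s := C ∩ {q | 0 ≤ w q}))
  have hs : IsCompact (C ∩ {q | q.1 = q1.1}) :=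
    hC.inter_right (isClosed_eq continuous_fst continuous_const)
  obtain ⟨q2, ⟨hq2, hq2t⟩, hmax⟩ := hs.exists_isMaxOn ⟨q1, hq1, rfl⟩ (hw.mono inter_subset_left)
  refine ⟨q2, hq2, le_trans hq1w (hmax ⟨hq1, rfl⟩), ?_, ?_⟩
  · intro q' hq' hlt
    by_contra hcon
    push Not at hcon
    have := hmin (a := q') ⟨hq', hcon⟩
    simp only [mem_ofPred_eq] at this hq2t
    linarith
  · intro q' hq' he
    exact hmax ⟨hq', he.trans hq2t⟩

def Reg (a b : ℝ) (l r : ℝ → ℝ) : Set (ℝ × ℝ) := {q | q.1 ∈ Icc a b ∧ q.2 ∈ Icc (l q.1) (r q.1)}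

theorem isCompact_Reg {a b : ℝ} {l r : ℝ → ℝ} (hl : ContinuousOn l (Icc a b))
    (hr : ContinuousOn r (Icc a b)) (hlr : ∀ t ∈ Icc a b, l t ≤ r t) : IsCompact (Reg a b l r) := by
  have h : Reg a b l r = (fun q : ℝ × ℝ => (q.1, l q.1 + q.2 * (r q.1 - l q.1))) ''
      (Icc a b ×ˢ Icc (0:ℝ) 1) := by
    ext ⟨t, x⟩
    simp only [Reg, mem_ofPred_eq, mem_image, mem_prod, Prod.mk.injEq, Prod.exists]
    constructor
    · rintro ⟨ht, hx1, hx2⟩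
      rcases (hlr t ht).eq_or_lt with he | hlt
      · refine ⟨t, 0, ⟨ht, by simp⟩, rfl, ?_⟩
        linarith
      · have hd : 0 < r t - l t := by linarith
        refine ⟨t, (x - l t) / (r t - l t), ⟨ht, ?_, ?_⟩, rfl, ?_⟩
        · exact div_nonneg (by linarith) hd.le
        · rw [div_le_one hd]; linarith
        · field_simp; ring
    · rintro ⟨t', y, ⟨ht, hy0, hy1⟩, rfl, rfl⟩
      have := hlr t' ht
      refine ⟨ht, ?_, ?_⟩
      · nlinarith
      · nlinarith
  rw [h]
  apply (isCompact_Icc.prod isCompact_Icc).image_of_continuousOn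
  have hl' : ContinuousOn (fun q : ℝ × ℝ => l q.1) (Icc a b ×ˢ Icc (0:ℝ) 1) :=
    hl.comp continuous_fst.continuousOn (fun q hq => hq.1)
  have hr' : ContinuousOn (fun q : ℝ × ℝ => r q.1) (Icc a b ×ˢ Icc (0:ℝ) 1) :=
    hr.comp continuous_fst.continuousOn (fun q hq => hq.1)
  exact continuous_fst.continuousOn.prodMk (hl'.add (continuous_snd.continuousOn.mul (hr'.sub hl')))

/-- interior points: past times are in the region -/
theorem Reg_past {a b : ℝ} {l r : ℝ → ℝ} (hl : ContinuousOn l (Icc a b))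
    (hr : ContinuousOn r (Icc a b)) {t x : ℝ} (ht : t ∈ Ioc a b) (hx : x ∈ Ioo (l t) (r t)) :
    ∀ᶠ τ in 𝓝[<] t, (τ, x) ∈ Reg a b l r := by
  have hsub : 𝓝[<] t ≤ 𝓝[Icc a b] t := by
    rw [← nhdsWithin_Ioo_eq_nhdsLT ht.1]
    exact nhdsWithin_mono _ (fun y hy => ⟨hy.1.le, hy.2.le.trans ht.2⟩)
  have ht' : t ∈ Icc a b := ⟨ht.1.le, ht.2⟩
  have e1 := hsub ((hl t ht').eventually (gt_mem_nhds hx.1))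
  have e2 := hsub ((hr t ht').eventually (lt_mem_nhds hx.2))
  have e3 := hsub (self_mem_nhdsWithin (a := t) (s := Icc a b))
  filter_upwards [e1, e2, e3] with τ h1 h2 h3
  exact ⟨h3, h1.le, h2.le⟩

theorem maxprin {a b : ℝ} {l r : ℝ → ℝ} (hl : ContinuousOn l (Icc a b))
    (hr : ContinuousOn r (Icc a b)) (hlr : ∀ t ∈ Icc a b, l t < r t) {w : ℝ → ℝ → ℝ}
    (hw : ContinuousOn (fun q : ℝ × ℝ => w q.1 q.2) (Reg a b l r))
    (h0 : ∀ x ∈ Icc (l a) (r a), w a x < 0)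
    (hL : ∀ t ∈ Ioc a b, w t (l t) < 0 ∨ ∃ d, 0 < d ∧ HasDerivWithinAt (w t) d (Ici (l t)) (l t))
    (hR : ∀ t ∈ Ioc a b, w t (r t) < 0)
    (hI : ∀ t ∈ Ioc a b, ∀ x ∈ Ioo (l t) (r t), ∃ wt wxx, D12 w t x wt wxx ∧ wt < wxx) :
    ∀ t ∈ Icc a b, ∀ x ∈ Icc (l t) (r t), w t x < 0 := by
  by_contra hcon
  push Not at hcon
  obtain ⟨t1, ht1, x1, hx1, hb⟩ := hcon
  obtain ⟨⟨t, x⟩, ⟨ht, hx⟩, hge, hpast, hmax⟩ := first_touch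
    (isCompact_Reg hl hr (fun t ht => (hlr t ht).le)) hw ⟨(t1, x1), ⟨ht1, hx1⟩, hb⟩
  simp only at ht hx hge hpast hmax
  have hta : a < t := by
    rcases ht.1.eq_or_lt with h | h
    · subst h; exact absurd (h0 x hx) (not_lt.2 hge)
    · exact h
  have ht' : t ∈ Ioc a b := ⟨hta, ht.2⟩
  have hslice : ∀ y ∈ Icc (l t) (r t), w t y ≤ w t x := fun y hy => hmax (t, y) ⟨ht, hy⟩ rfl
  have hlt := hlr t ht
  rcases hx.2.eq_or_lt with h | hxr
  · subst h; exact absurd (hR t ht') (not_lt.2 hge)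
  rcases hx.1.eq_or_lt with h | hxl
  · subst h
    rcases hL t ht' with h | ⟨d, hd, hder⟩
    · exact absurd h (not_lt.2 hge)
    · have := deriv_nonpos_right hder (by
        filter_upwards [Ioo_mem_nhdsGT hlt] with y hy
        exact hslice y ⟨hy.1.le, hy.2.le⟩)
      linarith
  · obtain ⟨wt, wxx, ⟨d1, wx, d2, d3⟩, hlt⟩ := hI t ht' x ⟨hxl, hxr⟩
    have k1 := deriv_nonneg_left d1.hasDerivWithinAt (by
      filter_upwards [Reg_past hl hr ht' ⟨hxl, hxr⟩, self_mem_nhdsWithin] with τ h1 h2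
      exact (hpast (τ, x) h1 h2).le.trans hge)
    have k2 := second_deriv_test d2 d3 (by
      filter_upwards [Ioo_mem_nhds hxl hxr] with y hy
      exact hslice y ⟨hy.1.le, hy.2.le⟩)
    linarith

/-- nonnegative subsolution of the Stefan problem on times `[a,b]` -/
structure SubSol (p a b : ℝ) (σ : ℝ → ℝ) (v : ℝ → ℝ → ℝ) : Prop where
  s_cont : ContinuousOn σ (Icc a b)
  s_pos : ∀ t ∈ Icc a b, 0 < σ t
  v_cont : ContinuousOn (fun q : ℝ × ℝ => v q.1 q.2) (Reg a b (fun _ => 0) σ)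
  v_nonneg : ∀ t ∈ Icc a b, ∀ x ∈ Icc 0 (σ t), 0 ≤ v t x
  v_zero : ∀ t ∈ Icc a b, v t (σ t) = 0
  free : ∀ t ∈ Ioc a b, ∃ γ, HasDerivAt σ γ t ∧ HasDerivWithinAt (v t) (-γ) (Iic (σ t)) (σ t)
  flux : ∀ t ∈ Ioc a b, ∃ d, HasDerivWithinAt (v t) d (Ici 0) 0 ∧ -d ≤ v t 0 ^ p
  heat : ∀ t ∈ Ioc a b, ∀ x ∈ Ioo 0 (σ t), ∃ c, D12 v t x c c

theorem compare {p a b : ℝ} {σ S : ℝ → ℝ} {v V : ℝ → ℝ → ℝ} (hv : SubSol p a b σ v)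
    (hS : ContinuousOn S (Icc a b)) (hSpos : ∀ t ∈ Icc a b, 0 < S t)
    (hV : ContinuousOn (fun q : ℝ × ℝ => V q.1 q.2) (Reg a b (fun _ => 0) S))
    (hVpos : ∀ t ∈ Icc a b, ∀ x ∈ Ico 0 (S t), 0 < V t x)
    (hV0 : ∀ t ∈ Icc a b, V t (S t) = 0)
    (hfree : ∀ t ∈ Ioc a b, ∃ Sd Vd, HasDerivWithinAt S Sd (Iic t) t ∧
      HasDerivWithinAt (V t) Vd (Iic (S t)) (S t) ∧ -Vd < Sd)
    (hflux : ∀ t ∈ Ioc a b, ∃ d, HasDerivWithinAt (V t) d (Ici 0) 0 ∧ V t 0 ^ p < -d)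
    (hheat : ∀ t ∈ Ioc a b, ∀ x ∈ Ioo 0 (S t), ∃ vt vxx, D12 V t x vt vxx ∧ vxx < vt)
    (hi1 : σ a < S a) (hi2 : ∀ x ∈ Icc 0 (σ a), v a x < V a x) :
    ∀ t ∈ Icc a b, σ t < S t ∧ ∀ x ∈ Icc 0 (σ t), v t x < V t x := by
  set W : ℝ × ℝ → ℝ := fun q => v q.1 q.2 - V q.1 (min q.2 (S q.1)) with hWdef
  have hWc : ContinuousOn W (Reg a b (fun _ => 0) σ) := by
    apply hv.v_cont.sub
    have hm : ContinuousOn (fun q : ℝ × ℝ => (q.1, min q.2 (S q.1))) (Reg a b (fun _ => 0) σ) :=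
      continuous_fst.continuousOn.prodMk ((continuous_snd.continuousOn (s := Reg a b (fun _ => 0) σ)).inf
        (hS.comp continuous_fst.continuousOn (fun q hq => hq.1)))
    exact hV.comp hm (fun q hq => ⟨hq.1, le_min hq.2.1 (hSpos _ hq.1).le, min_le_right _ _⟩)
  -- good points
  have hgood : ∀ t ∈ Icc a b, (∀ x ∈ Icc 0 (σ t), W (t, x) < 0) → σ t < S t := by
    intro t ht h
    by_contra hc
    push Not at hc
    have := h (σ t) ⟨(hv.s_pos t ht).le, le_rfl⟩
    simp only [hWdef, min_eq_right hc, hv.v_zero t ht, hV0 t ht] at this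
    linarith
  suffices hmain : ∀ q ∈ Reg a b (fun _ => 0) σ, W q < 0 by
    intro t ht
    have h1 : ∀ x ∈ Icc 0 (σ t), W (t, x) < 0 := fun x hx => hmain (t, x) ⟨ht, hx⟩
    have h2 := hgood t ht h1
    refine ⟨h2, fun x hx => ?_⟩
    have := h1 x hx
    simp only [hWdef, min_eq_left (hx.2.trans h2.le)] at this
    linarith
  by_contra hcon
  push Not at hcon
  obtain ⟨⟨t, x⟩, ⟨ht, hx⟩, hge, hpast, hmax⟩ := first_touch
    (isCompact_Reg continuousOn_const hv.s_cont (fun t ht => (hv.s_pos t ht).le)) hWc hcon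
  simp only at ht hx hge hpast hmax
  have hta : a < t := by
    rcases ht.1.eq_or_lt with h | h
    · subst h
      have := hi2 x hx
      simp only [hWdef, min_eq_left (hx.2.trans hi1.le)] at hge
      linarith
    · exact h
  have ht' : t ∈ Ioc a b := ⟨hta, ht.2⟩
  have hslice : ∀ y ∈ Icc 0 (σ t), W (t, y) ≤ W (t, x) := fun y hy => hmax (t, y) ⟨ht, hy⟩ rfl
  have hsub : 𝓝[<] t ≤ 𝓝[Icc a b] t := by
    rw [← nhdsWithin_Ioo_eq_nhdsLT ht'.1]
    exact nhdsWithin_mono _ (fun y hy => ⟨hy.1.le, hy.2.le.trans ht'.2⟩)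
  have hpast' : ∀ᶠ τ in 𝓝[<] t, σ τ < S τ := by
    filter_upwards [Ioo_mem_nhdsLT hta] with τ hτ
    have hτ' : τ ∈ Icc a b := ⟨hτ.1.le, hτ.2.le.trans ht.2⟩
    exact hgood τ hτ' (fun y hy => hpast (τ, y) ⟨hτ', hy⟩ hτ.2)
  have hle : σ t ≤ S t := le_of_tendsto_of_tendsto ((hv.s_cont t ht).mono_left hsub)
    ((hS t ht).mono_left hsub) (by filter_upwards [hpast'] with τ h using h.le)
  -- w ≤ 0 at time t
  have hWle : ∀ y ∈ Ico 0 (σ t), W (t, y) ≤ 0 := by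
    intro y hy
    have hc : Tendsto (fun τ => W (τ, y)) (𝓝[<] t) (𝓝 (W (t, y))) := by
      have h1 : Tendsto (fun τ => (τ, y)) (𝓝[<] t) (𝓝[Reg a b (fun _ => 0) σ] (t, y)) := by
        apply tendsto_nhdsWithin_iff.2 ⟨?_, ?_⟩
        · exact ((Continuous.tendsto' (by fun_prop) _ _ rfl :
            Tendsto (fun τ : ℝ => (τ, y)) (𝓝 t) (𝓝 (t, y)))).mono_left nhdsWithin_le_nhds
        · have e2 := hsub ((hv.s_cont t ht).eventually (lt_mem_nhds hy.2))
          have e3 := hsub (self_mem_nhdsWithin (a := t) (s := Icc a b))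
          filter_upwards [e2, e3] with τ h2 h3
          exact ⟨h3, hy.1, h2.le⟩
      exact (hWc (t, y) ⟨ht, hy.1, hy.2.le⟩).tendsto.comp h1
    refine le_of_tendsto hc ?_
    have e2 := hsub ((hv.s_cont t ht).eventually (lt_mem_nhds hy.2))
    have e3 := hsub (self_mem_nhdsWithin (a := t) (s := Icc a b))
    filter_upwards [e2, e3, self_mem_nhdsWithin] with τ h2 h3 h4
    exact (hpast (τ, y) ⟨h3, hy.1, h2.le⟩ h4).le
  have hσ := hv.s_pos t ht
  rcases hle.eq_or_lt with he | hlt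
  · obtain ⟨γ, g1, g2⟩ := hv.free t ht'
    obtain ⟨Sd, Vd, k1, k2, k3⟩ := hfree t ht'
    have q1 := deriv_nonneg_left (g1.hasDerivWithinAt.sub k1) (by
      filter_upwards [hpast'] with τ hτ
      simp only [Pi.sub_apply]
      linarith)
    rw [← he] at k2
    have q2 := deriv_nonneg_left (g2.sub k2) (by
      filter_upwards [Ioo_mem_nhdsLT hσ] with y hy
      have := hWle y ⟨hy.1.le, hy.2⟩
      simp only [hWdef, min_eq_left (hy.2.le.trans hle)] at this
      simp only [Pi.sub_apply]
      rw [hv.v_zero t ht, he, hV0 t ht]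
      linarith)
    linarith
  · have hmin : ∀ y ∈ Icc 0 (σ t), W (t, y) = v t y - V t y := by
      intro y hy
      simp only [hWdef, min_eq_left (hy.2.trans hle)]
    have hsl : ∀ y ∈ Icc 0 (σ t), v t y - V t y ≤ v t x - V t x := by
      intro y hy
      rw [← hmin y hy, ← hmin x hx]; exact hslice y hy
    rw [hmin x hx] at hge
    rcases hx.2.eq_or_lt with h | hxr
    · have := hVpos t ht (σ t) ⟨hσ.le, hlt⟩
      rw [h, hv.v_zero t ht] at hge
      linarith
    rcases hx.1.eq_or_lt with h | hxl
    · subst h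
      obtain ⟨d1, k1, k2⟩ := hv.flux t ht'
      obtain ⟨d2, l1, l2⟩ := hflux t ht'
      have e0 := hWle 0 ⟨le_rfl, hσ⟩
      rw [hmin 0 ⟨le_rfl, hσ.le⟩] at e0
      have e1 : v t 0 = V t 0 := by linarith
      have := deriv_nonpos_right (k1.sub l1) (by
        filter_upwards [Ioo_mem_nhdsGT hσ] with y hy
        exact hsl y ⟨hy.1.le, hy.2.le⟩)
      rw [e1] at k2
      linarith
    · obtain ⟨c, hc⟩ := hv.heat t ht' x ⟨hxl, hxr⟩
      obtain ⟨vt, vxx, hc2, hlt2⟩ := hheat t ht' x ⟨hxl, hxr.trans hlt⟩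
      obtain ⟨d1, wx, d2, d3⟩ := hc.sub hc2
      have k1 := deriv_nonneg_left d1.hasDerivWithinAt (by
        have e1 := hsub ((hS t ht).eventually (lt_mem_nhds (hxr.trans hlt)))
        filter_upwards [Reg_past continuousOn_const hv.s_cont ht' ⟨hxl, hxr⟩,
          self_mem_nhdsWithin, e1] with τ h1 h2 h3
        have := (hpast (τ, x) h1 h2).le
        simp only [hWdef, min_eq_left h3.le] at this
        linarith)
      have k2 := second_deriv_test d2 d3 (by
        filter_upwards [Ioo_mem_nhds hxl hxr] with y hy
        exact hsl y ⟨hy.1.le, hy.2.le⟩)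
      linarith

def HK (z r : ℝ) : ℝ := Real.exp (-(z ^ 2 / (4 * r))) / (2 * √π * √r)
def HK1 (z r : ℝ) : ℝ := -z / (2 * r) * HK z r
def HK2 (z r : ℝ) : ℝ := (z ^ 2 / (4 * r ^ 2) - 1 / (2 * r)) * HK z r

theorem HK_of_nonpos {r : ℝ} (hr : r ≤ 0) (z : ℝ) : HK z r = 0 := by
  simp [HK, Real.sqrt_eq_zero_of_nonpos hr]
theorem HK1_of_nonpos {r : ℝ} (hr : r ≤ 0) (z : ℝ) : HK1 z r = 0 := by
  simp [HK1, HK_of_nonpos hr]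
theorem HK2_of_nonpos {r : ℝ} (hr : r ≤ 0) (z : ℝ) : HK2 z r = 0 := by
  simp [HK2, HK_of_nonpos hr]
theorem HK_nonneg (z r : ℝ) : 0 ≤ HK z r := by unfold HK; positivity
theorem HK_neg (z r : ℝ) : HK (-z) r = HK z r := by simp [HK]
theorem HK1_neg (z r : ℝ) : HK1 (-z) r = -HK1 z r := by simp only [HK1, HK_neg]; ring
theorem HK2_neg (z r : ℝ) : HK2 (-z) r = HK2 z r := by simp only [HK2, HK_neg]; ring

theorem hasDerivAt_HK_z {r : ℝ} (hr : 0 < r) (z : ℝ) : HasDerivAt (fun z => HK z r) (HK1 z r) z := by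
  have h1 : HasDerivAt (fun z : ℝ => -(z ^ 2 / (4 * r))) (-(2 * z / (4 * r))) z := by
    refine (((hasDerivAt_pow 2 z).div_const (4 * r)).fun_neg).congr_deriv ?_
    simp
  have h2 := h1.exp.div_const (2 * √π * √r)
  refine h2.congr_deriv ?_
  unfold HK1 HK
  field_simp; ring

theorem hasDerivAt_HK1_z {r : ℝ} (hr : 0 < r) (z : ℝ) :
    HasDerivAt (fun z => HK1 z r) (HK2 z r) z := by
  have h1 : HasDerivAt (fun z : ℝ => -z / (2 * r)) (-1 / (2 * r)) z := by
    exact ((hasDerivAt_id z).fun_neg).div_const (2 * r)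
  have h2 := h1.mul (hasDerivAt_HK_z hr z)
  refine h2.congr_deriv ?_
  unfold HK2 HK1
  field_simp; ring

theorem hasDerivAt_HK_r {r : ℝ} (hr : 0 < r) (z : ℝ) :
    HasDerivAt (fun r => HK z r) (HK2 z r) r := by
  have h1 : HasDerivAt (fun r : ℝ => -(z ^ 2 / (4 * r))) (z ^ 2 / (4 * r ^ 2)) r := by
    have h : HasDerivAt (fun r : ℝ => 4 * r) 4 r := by simpa using (hasDerivAt_id r).const_mul 4
    have := ((hasDerivAt_const r (z ^ 2)).div h (by positivity)).neg
    refine this.congr_deriv ?_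
    field_simp; ring
  have h3 : HasDerivAt (fun r : ℝ => 2 * √π * √r) (2 * √π * (1 / (2 * √r))) r :=
    (Real.hasDerivAt_sqrt hr.ne').const_mul _
  have h2 := h1.exp.div h3 (by positivity)
  refine h2.congr_deriv ?_
  unfold HK2 HK
  obtain ⟨q, hq, rfl⟩ : ∃ q, 0 < q ∧ r = q ^ 2 := ⟨√r, by positivity, (Real.sq_sqrt hr.le).symm⟩
  rw [Real.sqrt_sq hq.le]
  field_simp
  try ring

theorem pow_mul_exp_neg_le (n : ℕ) {y : ℝ} (hy : 0 ≤ y) : y ^ n * Real.exp (-y) ≤ n.factorial := by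
  have h := Real.pow_div_factorial_le_exp y hy n
  rw [Real.exp_neg]
  rw [div_le_iff₀ (by positivity)] at h
  rw [← div_eq_mul_inv, div_le_iff₀ (by positivity)]
  linarith

/-- master bounds -/
theorem HK_master {r : ℝ} (hr : 0 < r) (z : ℝ) :
    HK z r ≤ 1 / √r * Real.exp (-(z ^ 2 / (4 * r))) := by
  unfold HK
  have hpi : 1 ≤ √π := by
    rw [show (1:ℝ) = √1 by simp]; exact Real.sqrt_le_sqrt (by linarith [Real.pi_gt_three])
  rw [one_div_mul_eq_div]
  apply div_le_div_of_nonneg_left (by positivity) (by positivity)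
  have : 0 < √r := by positivity
  nlinarith

theorem HK_le {r : ℝ} (hr : 0 < r) (z : ℝ) : |HK z r| ≤ 1 / √r := by
  rw [abs_of_nonneg (HK_nonneg _ _)]
  refine (HK_master hr z).trans ?_
  have : Real.exp (-(z ^ 2 / (4 * r))) ≤ 1 := by
    apply Real.exp_le_one_iff.2; have : 0 ≤ z ^ 2 / (4 * r) := by positivity
    linarith
  have h2 : 0 < 1 / √r := by positivity
  nlinarith

theorem HK1_master {r : ℝ} (hr : 0 < r) (z : ℝ) :
    |HK1 z r| ≤ 1 / r * ((1 + z ^ 2 / (4 * r)) * Real.exp (-(z ^ 2 / (4 * r)))) := by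
  unfold HK1
  rw [abs_mul, abs_of_nonneg (HK_nonneg z r)]
  have h := HK_master hr z
  obtain ⟨q, hq, rfl⟩ : ∃ q, 0 < q ∧ r = q ^ 2 := ⟨√r, by positivity, (Real.sq_sqrt hr.le).symm⟩
  rw [Real.sqrt_sq hq.le] at h
  refine (mul_le_mul_of_nonneg_left h (abs_nonneg _)).trans ?_
  rw [← mul_assoc, ← mul_assoc]
  apply mul_le_mul_of_nonneg_right _ (Real.exp_pos _).le
  rw [abs_div, abs_neg, abs_of_pos (by positivity : 0 < 2 * q ^ 2)]
  rw [← sq_abs z]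
  have : |z| / (2 * q ^ 2) * (1 / q) = 1 / q ^ 2 * (|z| / (2 * q)) := by field_simp
  rw [this]
  apply mul_le_mul_of_nonneg_left _ (by positivity)
  have : |z| ^ 2 / (4 * q ^ 2) = (|z| / (2 * q)) ^ 2 := by field_simp; ring
  rw [this]
  nlinarith [sq_nonneg (|z| / (2 * q) - 1)]

theorem HK2_master {r : ℝ} (hr : 0 < r) (z : ℝ) :
    |HK2 z r| ≤ 1 / (r * √r) * ((1 + z ^ 2 / (4 * r)) * Real.exp (-(z ^ 2 / (4 * r)))) := by
  unfold HK2
  rw [abs_mul, abs_of_nonneg (HK_nonneg z r)]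
  have h := HK_master hr z
  refine (mul_le_mul_of_nonneg_left h (abs_nonneg _)).trans ?_
  rw [← mul_assoc, ← mul_assoc]
  apply mul_le_mul_of_nonneg_right _ (Real.exp_pos _).le
  have e : 1 / (r * √r) * (1 + z ^ 2 / (4 * r)) = (1 / r * (1 + z ^ 2 / (4 * r))) * (1 / √r) := by
    field_simp
  rw [e]
  apply mul_le_mul_of_nonneg_right _ (by positivity)
  have e2 : z ^ 2 / (4 * r ^ 2) = 1 / r * (z ^ 2 / (4 * r)) := by field_simp
  have e3 : 1 / (2 * r) = 1 / r * (1 / 2) := by field_simp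
  rw [e2, e3, ← mul_sub, abs_mul, abs_of_pos (by positivity : 0 < 1 / r)]
  apply mul_le_mul_of_nonneg_left _ (by positivity)
  have : 0 ≤ z ^ 2 / (4 * r) := by positivity
  rw [abs_le]; constructor <;> linarith

theorem one_add_mul_exp_le {y : ℝ} (hy : 0 ≤ y) : (1 + y) * Real.exp (-y) ≤ 1 := by
  have := Real.add_one_le_exp y
  rw [Real.exp_neg, ← div_eq_mul_inv, div_le_one (by positivity)]; linarith

theorem HK1_le {r : ℝ} (hr : 0 < r) (z : ℝ) : |HK1 z r| ≤ 1 / r := by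
  refine (HK1_master hr z).trans ?_
  have := one_add_mul_exp_le (y := z ^ 2 / (4 * r)) (by positivity)
  have h2 : 0 < 1 / r := by positivity
  nlinarith

theorem HK2_le {r : ℝ} (hr : 0 < r) (z : ℝ) : |HK2 z r| ≤ 1 / (r * √r) := by
  refine (HK2_master hr z).trans ?_
  have := one_add_mul_exp_le (y := z ^ 2 / (4 * r)) (by positivity)
  have h2 : 0 < 1 / (r * √r) := by positivity
  nlinarith

theorem HKaux {y : ℝ} (hy : 0 < y) : (1 + y) * Real.exp (-y) ≤ 144 / y ^ 4 := by
  have h4 := pow_mul_exp_neg_le 4 hy.le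
  have h5 := pow_mul_exp_neg_le 5 hy.le
  norm_num [Nat.factorial] at h4 h5
  rw [le_div_iff₀ (by positivity)]
  nlinarith

theorem HK_small {z r : ℝ} (hr : 0 < r) (hr1 : r ≤ 1) (hz : z ≠ 0) :
    |HK z r| ≤ 36864 * r ^ 2 / z ^ 8 ∧ |HK1 z r| ≤ 36864 * r ^ 2 / z ^ 8 ∧
      |HK2 z r| ≤ 36864 * r ^ 2 / z ^ 8 := by
  have hz2 : 0 < z ^ 2 := by positivity
  have hy : 0 < z ^ 2 / (4 * r) := by positivity
  have hA := HKaux hy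
  have hq1 : √r ≤ 1 := by rw [show (1:ℝ) = √1 by simp]; exact Real.sqrt_le_sqrt hr1
  have hq : 0 < √r := by positivity
  have hqq : √r * √r = r := Real.mul_self_sqrt hr.le
  have key : 1 / (r * √r) * ((1 + z ^ 2 / (4 * r)) * Real.exp (-(z ^ 2 / (4 * r)))) ≤
      36864 * r ^ 2 / z ^ 8 := by
    refine (mul_le_mul_of_nonneg_left hA (by positivity)).trans ?_
    have e : 1 / (r * √r) * (144 / (z ^ 2 / (4 * r)) ^ 4) = 36864 * (r ^ 3 / √r) / z ^ 8 := by
      field_simp; ring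
    rw [e]
    apply div_le_div_of_nonneg_right _ (by positivity)
    apply mul_le_mul_of_nonneg_left _ (by norm_num)
    rw [div_le_iff₀ hq]
    have : r ≤ √r := by nlinarith
    nlinarith [mul_le_mul_of_nonneg_left this (sq_nonneg r)]
  have hpos : 0 ≤ (1 + z ^ 2 / (4 * r)) * Real.exp (-(z ^ 2 / (4 * r))) := by positivity
  refine ⟨?_, ?_, (HK2_master hr z).trans key⟩
  · rw [abs_of_nonneg (HK_nonneg z r)]
    refine ((HK_master hr z).trans ?_).trans key
    apply mul_le_mul
    · apply one_div_le_one_div_of_le (by positivity); nlinarith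
    · nlinarith [Real.exp_pos (-(z ^ 2 / (4 * r)))]
    · positivity
    · positivity
  · refine ((HK1_master hr z).trans ?_).trans key
    apply mul_le_mul_of_nonneg_right _ hpos
    apply one_div_le_one_div_of_le (by positivity); nlinarith

theorem HK_bdd_off {ρ : ℝ} (hρ : 0 < ρ) : ∃ C, 0 < C ∧ ∀ z r, (ρ ≤ |z| ∨ ρ ≤ |r|) →
    |HK z r| ≤ C ∧ |HK1 z r| ≤ C ∧ |HK2 z r| ≤ C := by
  have key : ∀ m : ℝ, 0 < m → m ≤ 1 → ∀ z r, m ≤ r → |HK z r| ≤ 1/(m * m) ∧ |HK1 z r| ≤ 1/(m*m) ∧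
      |HK2 z r| ≤ 1/(m*m) := by
    intro m hm hm1 z r hr
    have hr0 : 0 < r := by linarith
    have hs : m ≤ √r := by
      apply Real.le_sqrt_of_sq_le; nlinarith
    refine ⟨(HK_le hr0 z).trans ?_, (HK1_le hr0 z).trans ?_, (HK2_le hr0 z).trans ?_⟩
    · apply one_div_le_one_div_of_le (by positivity); nlinarith
    · apply one_div_le_one_div_of_le (by positivity); nlinarith
    · apply one_div_le_one_div_of_le (by positivity); gcongr
  set m := min ρ 1 with hm
  have hm0 : 0 < m := by positivity
  refine ⟨1/(m*m) + 1 + 36864 / ρ ^ 8, by positivity, fun z r h => ?_⟩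
  have p1 : 0 < 1/(m*m) := by positivity
  have p2 : 0 < 36864 / ρ ^ 8 := by positivity
  rcases le_or_gt r 0 with hr | hr
  · rw [HK_of_nonpos hr, HK1_of_nonpos hr, HK2_of_nonpos hr]; simp; positivity
  rcases h with h | h
  · rcases le_or_gt r 1 with h1 | h1
    · have hz : z ≠ 0 := by rintro rfl; simp at h; linarith
      have hb : 36864 * r ^ 2 / z ^ 8 ≤ 36864 / ρ ^ 8 := by
        have : ρ ^ 8 ≤ z ^ 8 := by
          have := pow_le_pow_left₀ hρ.le h 8
          rwa [show |z| ^ 8 = z ^ 8 by rw [← abs_pow, abs_of_nonneg (by positivity)]] at this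
        apply div_le_div₀ (by positivity) _ (by positivity) this
        nlinarith
      obtain ⟨a, b, c⟩ := HK_small hr h1 hz
      refine ⟨?_, ?_, ?_⟩ <;> linarith
    · obtain ⟨a, b, c⟩ := key 1 one_pos le_rfl z r h1.le
      norm_num at a b c
      refine ⟨?_, ?_, ?_⟩ <;> linarith
  · rw [abs_of_pos hr] at h
    obtain ⟨a, b, c⟩ := key m hm0 (min_le_right _ _) z r ((min_le_left _ _).trans h)
    refine ⟨?_, ?_, ?_⟩ <;> linarith

theorem HK_cont_pos {z r : ℝ} (hr : 0 < r) : ContinuousAt (fun q : ℝ × ℝ => HK q.1 q.2) (z, r) ∧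
    ContinuousAt (fun q : ℝ × ℝ => HK1 q.1 q.2) (z, r) ∧
    ContinuousAt (fun q : ℝ × ℝ => HK2 q.1 q.2) (z, r) := by
  have h0 : ContinuousAt (fun q : ℝ × ℝ => HK q.1 q.2) (z, r) := by
    unfold HK
    apply ContinuousAt.div
    · apply Real.continuous_exp.continuousAt.comp
      apply ContinuousAt.neg
      exact ContinuousAt.div (by fun_prop) (by fun_prop) (by simpa using hr.ne')
    · fun_prop
    · simp only; positivity
  refine ⟨h0, ?_, ?_⟩
  · unfold HK1
    exact (ContinuousAt.div (by fun_prop) (by fun_prop) (by simpa using hr.ne')).mul h0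
  · unfold HK2
    refine ContinuousAt.mul (ContinuousAt.sub ?_ ?_) h0
    · exact (ContinuousAt.div (by fun_prop) (by fun_prop) (by simpa using hr.ne'))
    · exact (ContinuousAt.div (by fun_prop) (by fun_prop) (by simpa using hr.ne'))

theorem HK_cont {z r : ℝ} (h : z ≠ 0 ∨ r ≠ 0) : ContinuousAt (fun q : ℝ × ℝ => HK q.1 q.2) (z, r) ∧
    ContinuousAt (fun q : ℝ × ℝ => HK1 q.1 q.2) (z, r) ∧
    ContinuousAt (fun q : ℝ × ℝ => HK2 q.1 q.2) (z, r) := by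
  rcases lt_trichotomy r 0 with hr | hr | hr
  · have : ∀ᶠ q : ℝ × ℝ in 𝓝 (z, r), q.2 < 0 := continuousAt_snd.eventually (gt_mem_nhds hr)
    refine ⟨?_, ?_, ?_⟩
    all_goals
      refine (continuousAt_const (y := (0:ℝ))).congr ?_
      filter_upwards [this] with q hq
      simp [HK_of_nonpos hq.le, HK1_of_nonpos hq.le, HK2_of_nonpos hq.le]
  · subst hr
    have hz : z ≠ 0 := by simpa using h
    set ρ := |z| / 2
    have hρ : 0 < ρ := by positivity
    have e1 : ∀ᶠ q : ℝ × ℝ in 𝓝 (z, (0:ℝ)), ρ < |q.1| := by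
      have : ContinuousAt (fun q : ℝ × ℝ => |q.1|) (z, 0) := by fun_prop
      exact this.eventually (lt_mem_nhds (by simp only [ρ]; linarith [abs_pos.2 hz]))
    have e2 : ∀ᶠ q : ℝ × ℝ in 𝓝 (z, (0:ℝ)), q.2 < 1 :=
      continuousAt_snd.eventually (gt_mem_nhds one_pos)
    have hb : ∀ᶠ q : ℝ × ℝ in 𝓝 (z, (0:ℝ)), |HK q.1 q.2| ≤ 36864 / ρ ^ 8 * q.2 ^ 2 ∧
        |HK1 q.1 q.2| ≤ 36864 / ρ ^ 8 * q.2 ^ 2 ∧ |HK2 q.1 q.2| ≤ 36864 / ρ ^ 8 * q.2 ^ 2 := by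
      filter_upwards [e1, e2] with q h1 h2
      rcases le_or_gt q.2 0 with hr | hr
      · rw [HK_of_nonpos hr, HK1_of_nonpos hr, HK2_of_nonpos hr]; simp; positivity
      have hz' : q.1 ≠ 0 := by intro h; rw [h] at h1; simp at h1; linarith
      have hb : 36864 * q.2 ^ 2 / q.1 ^ 8 ≤ 36864 / ρ ^ 8 * q.2 ^ 2 := by
        have : ρ ^ 8 ≤ q.1 ^ 8 := by
          have := pow_le_pow_left₀ hρ.le h1.le 8
          rwa [show |q.1| ^ 8 = q.1 ^ 8 by rw [← abs_pow, abs_of_nonneg (by positivity)]] at this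
        rw [div_mul_eq_mul_div]
        apply div_le_div_of_nonneg_left (by positivity) (by positivity) this
      obtain ⟨a, b, c⟩ := HK_small hr h2.le hz'
      exact ⟨a.trans hb, b.trans hb, c.trans hb⟩
    have hlim : Tendsto (fun q : ℝ × ℝ => 36864 / ρ ^ 8 * q.2 ^ 2) (𝓝 (z, (0:ℝ))) (𝓝 0) :=
      Continuous.tendsto' (by fun_prop) _ _ (by simp)
    refine ⟨?_, ?_, ?_⟩
    · unfold ContinuousAt; simp only [HK_of_nonpos le_rfl]
      exact squeeze_zero_norm' (hb.mono fun q h => h.1) hlim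
    · unfold ContinuousAt; simp only [HK1_of_nonpos le_rfl]
      exact squeeze_zero_norm' (hb.mono fun q h => h.2.1) hlim
    · unfold ContinuousAt; simp only [HK2_of_nonpos le_rfl]
      exact squeeze_zero_norm' (hb.mono fun q h => h.2.2) hlim
  · exact HK_cont_pos hr

theorem hasDerivAt_HK_z' (r z : ℝ) : HasDerivAt (fun z => HK z r) (HK1 z r) z := by
  rcases lt_or_ge 0 r with h | h
  · exact hasDerivAt_HK_z h z
  · simp only [HK_of_nonpos h, HK1_of_nonpos h]; exact hasDerivAt_const _ _

theorem hasDerivAt_HK1_z' (r z : ℝ) : HasDerivAt (fun z => HK1 z r) (HK2 z r) z := by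
  rcases lt_or_ge 0 r with h | h
  · exact hasDerivAt_HK1_z h z
  · simp only [HK1_of_nonpos h, HK2_of_nonpos h]; exact hasDerivAt_const _ _

theorem hasDerivAt_HK_r' {z r : ℝ} (h : z ≠ 0 ∨ r ≠ 0) :
    HasDerivAt (fun r => HK z r) (HK2 z r) r := by
  rcases lt_trichotomy r 0 with hr | hr | hr
  · rw [HK2_of_nonpos hr.le]
    refine (hasDerivAt_const r (0:ℝ)).congr_of_eventuallyEq ?_
    filter_upwards [gt_mem_nhds hr] with q hq using HK_of_nonpos hq.le z
  · subst hr
    have hz : z ≠ 0 := by simpa using h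
    rw [HK2_of_nonpos le_rfl, hasDerivAt_iff_isLittleO]
    simp only [HK_of_nonpos le_rfl, sub_zero, smul_zero]
    have h1 : (fun r : ℝ => HK z r) =O[𝓝 0] fun r : ℝ => r ^ 2 := by
      apply Asymptotics.IsBigO.of_bound (36864 / z ^ 8)
      filter_upwards [gt_mem_nhds (zero_lt_one' ℝ)] with r hr
      rcases le_or_gt r 0 with h0 | h0
      · rw [HK_of_nonpos h0]; simp; positivity
      · have := (HK_small h0 hr.le hz).1
        rw [Real.norm_eq_abs, Real.norm_eq_abs, abs_of_nonneg (sq_nonneg r)]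
        refine this.trans (le_of_eq (by ring))
    refine h1.trans_isLittleO ?_
    have := Asymptotics.isLittleO_pow_pow (𝕜 := ℝ) (m := 1) (n := 2) (by norm_num)
    simpa using this
  · exact hasDerivAt_HK_r hr z

theorem measurable_HK : Measurable (fun q : ℝ × ℝ => HK q.1 q.2) := by unfold HK; fun_prop
theorem measurable_HK1 : Measurable (fun q : ℝ × ℝ => HK1 q.1 q.2) := by
  unfold HK1; exact Measurable.mul (by fun_prop) measurable_HK
theorem measurable_HK2 : Measurable (fun q : ℝ × ℝ => HK2 q.1 q.2) := by
  unfold HK2; exact Measurable.mul (by fun_prop) measurable_HK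

/-- generic heat potential -/
def Pot (k : ℝ → ℝ → ℝ) (f c θ : ℝ → ℝ) (t x : ℝ) : ℝ := ∫ τ, f τ * k (x - c τ) (t - θ τ)

/-- the point `q = (t,x)` stays away from the singular set -/
def Off (ρ : ℝ) (f c θ : ℝ → ℝ) (q : ℝ × ℝ) : Prop :=
  ∀ τ, f τ ≠ 0 → ρ ≤ |q.2 - c τ| ∨ ρ ≤ |q.1 - θ τ|

theorem Off_ne {ρ : ℝ} (hρ : 0 < ρ) {f c θ : ℝ → ℝ} {q : ℝ × ℝ} (h : Off ρ f c θ q) {τ : ℝ}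
    (hf : f τ ≠ 0) : q.2 - c τ ≠ 0 ∨ q.1 - θ τ ≠ 0 := by
  rcases h τ hf with h | h
  · left; intro h0; rw [h0] at h; simp at h; linarith
  · right; intro h0; rw [h0] at h; simp at h; linarith

theorem slice1 {t x : ℝ} {p : ℝ × ℝ → Prop} (h : ∀ᶠ q in 𝓝 (t, x), p q) :
    ∀ᶠ τ in 𝓝 t, p (τ, x) := by
  have : Tendsto (fun τ : ℝ => (τ, x)) (𝓝 t) (𝓝 (t, x)) := by
    apply Continuous.tendsto' (by fun_prop); rfl
  exact this.eventually h

theorem slice2 {t x : ℝ} {p : ℝ × ℝ → Prop} (h : ∀ᶠ q in 𝓝 (t, x), p q) :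
    ∀ᶠ y in 𝓝 x, p (t, y) := by
  have : Tendsto (fun τ : ℝ => (t, τ)) (𝓝 x) (𝓝 (t, x)) := by
    apply Continuous.tendsto' (by fun_prop); rfl
  exact this.eventually h

section
variable {f c θ : ℝ → ℝ} {ρ t x : ℝ}

theorem pot_meas {k : ℝ → ℝ → ℝ} (hk : Measurable (fun q : ℝ × ℝ => k q.1 q.2))
    (hf : AEStronglyMeasurable f) (hc : AEMeasurable c) (hθ : AEMeasurable θ) (t x : ℝ) :
    AEStronglyMeasurable (fun τ => f τ * k (x - c τ) (t - θ τ)) := by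
  apply hf.mul
  exact (hk.comp_aemeasurable ((hc.const_sub x).prodMk (hθ.const_sub t))).aestronglyMeasurable

theorem pot_cont_gen {k : ℝ → ℝ → ℝ} (hk : Measurable (fun q : ℝ × ℝ => k q.1 q.2)) {C : ℝ}
    (hkb : ∀ z r, (ρ ≤ |z| ∨ ρ ≤ |r|) → |k z r| ≤ C)
    (hkc : ∀ z r, (z ≠ 0 ∨ r ≠ 0) → ContinuousAt (fun q : ℝ × ℝ => k q.1 q.2) (z, r))
    (hρ : 0 < ρ) (hf : Integrable f) (hc : AEMeasurable c) (hθ : AEMeasurable θ)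
    (hoff : ∀ᶠ q in 𝓝 (t, x), Off ρ f c θ q) :
    ContinuousAt (fun q : ℝ × ℝ => Pot k f c θ q.1 q.2) (t, x) := by
  unfold Pot
  apply continuousAt_of_dominated (bound := fun τ => |f τ| * C)
  · exact Eventually.of_forall fun q => pot_meas hk hf.1 hc hθ _ _
  · filter_upwards [hoff] with q hq
    refine Eventually.of_forall fun τ => ?_
    rw [norm_mul, Real.norm_eq_abs]
    by_cases h0 : f τ = 0
    · simp [h0]
    · exact mul_le_mul_of_nonneg_left (hkb _ _ (hq τ h0)) (abs_nonneg _)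
  · exact hf.abs.mul_const C
  · refine Eventually.of_forall fun τ => ?_
    by_cases h0 : f τ = 0
    · simp only [h0, zero_mul]; exact continuousAt_const
    · apply ContinuousAt.mul continuousAt_const
      have h1 : ContinuousAt (fun q : ℝ × ℝ => (q.2 - c τ, q.1 - θ τ)) (t, x) := by fun_prop
      exact ContinuousAt.comp (g := fun q : ℝ × ℝ => k q.1 q.2) (x := (t, x))
        (hkc _ _ (Off_ne hρ hoff.self_of_nhds h0)) h1

theorem pot_int_gen {k : ℝ → ℝ → ℝ} (hk : Measurable (fun q : ℝ × ℝ => k q.1 q.2)) {C : ℝ}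
    (hkb : ∀ z r, (ρ ≤ |z| ∨ ρ ≤ |r|) → |k z r| ≤ C)
    (hf : Integrable f) (hc : AEMeasurable c) (hθ : AEMeasurable θ)
    (hoff : Off ρ f c θ (t, x)) :
    Integrable (fun τ => f τ * k (x - c τ) (t - θ τ)) := by
  refine (hf.abs.mul_const C).mono' (pot_meas hk hf.1 hc hθ _ _) ?_
  refine Eventually.of_forall fun τ => ?_
  rw [norm_mul, Real.norm_eq_abs]
  by_cases h0 : f τ = 0
  · simp [h0]
  · exact mul_le_mul_of_nonneg_left (hkb _ _ (hoff τ h0)) (abs_nonneg _)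

theorem pot_cont (hρ : 0 < ρ) (hf : Integrable f) (hc : AEMeasurable c) (hθ : AEMeasurable θ)
    (hoff : ∀ᶠ q in 𝓝 (t, x), Off ρ f c θ q) :
    ContinuousAt (fun q : ℝ × ℝ => Pot HK f c θ q.1 q.2) (t, x) ∧
    ContinuousAt (fun q : ℝ × ℝ => Pot HK1 f c θ q.1 q.2) (t, x) ∧
    ContinuousAt (fun q : ℝ × ℝ => Pot HK2 f c θ q.1 q.2) (t, x) := by
  obtain ⟨C, hC, hb⟩ := HK_bdd_off hρ
  exact ⟨pot_cont_gen measurable_HK (fun z r h => (hb z r h).1) (fun z r h => (HK_cont h).1)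
      hρ hf hc hθ hoff,
    pot_cont_gen measurable_HK1 (fun z r h => (hb z r h).2.1) (fun z r h => (HK_cont h).2.1)
      hρ hf hc hθ hoff,
    pot_cont_gen measurable_HK2 (fun z r h => (hb z r h).2.2) (fun z r h => (HK_cont h).2.2)
      hρ hf hc hθ hoff⟩

theorem pot_x_gen {k k' : ℝ → ℝ → ℝ} (hk : Measurable (fun q : ℝ × ℝ => k q.1 q.2))
    (hk' : Measurable (fun q : ℝ × ℝ => k' q.1 q.2)) {C : ℝ}
    (hkb : ∀ z r, (ρ ≤ |z| ∨ ρ ≤ |r|) → |k z r| ≤ C)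
    (hkb' : ∀ z r, (ρ ≤ |z| ∨ ρ ≤ |r|) → |k' z r| ≤ C)
    (hd : ∀ r z, HasDerivAt (fun z => k z r) (k' z r) z)
    (hf : Integrable f) (hc : AEMeasurable c) (hθ : AEMeasurable θ)
    (hoff : ∀ᶠ q in 𝓝 (t, x), Off ρ f c θ q) :
    HasDerivAt (fun y => Pot k f c θ t y) (Pot k' f c θ t x) x := by
  obtain ⟨s, hs, hoff'⟩ := eventually_iff_exists_mem.1 (slice2 hoff)
  refine (hasDerivAt_integral_of_dominated_loc_of_deriv_le (𝕜 := ℝ) (s := s)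
    (bound := fun τ => |f τ| * C) (F := fun y τ => f τ * k (y - c τ) (t - θ τ))
    (F' := fun y τ => f τ * k' (y - c τ) (t - θ τ)) hs
    (Eventually.of_forall fun y => pot_meas hk hf.1 hc hθ _ _)
    (pot_int_gen hk hkb hf hc hθ hoff.self_of_nhds) (pot_meas hk' hf.1 hc hθ _ _) ?_
    (hf.abs.mul_const C) ?_).2
  · refine Eventually.of_forall fun τ y hy => ?_
    rw [norm_mul, Real.norm_eq_abs]
    by_cases h0 : f τ = 0
    · simp [h0]
    · exact mul_le_mul_of_nonneg_left (hkb' _ _ (hoff' y hy τ h0)) (abs_nonneg _)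
  · refine Eventually.of_forall fun τ y hy => ?_
    exact ((hd (t - θ τ) (y - c τ)).comp_sub_const y (c τ)).const_mul (f τ)

theorem pot_x (hρ : 0 < ρ) (hf : Integrable f) (hc : AEMeasurable c) (hθ : AEMeasurable θ)
    (hoff : ∀ᶠ q in 𝓝 (t, x), Off ρ f c θ q) :
    HasDerivAt (fun y => Pot HK f c θ t y) (Pot HK1 f c θ t x) x := by
  obtain ⟨C, hC, hb⟩ := HK_bdd_off hρ
  exact pot_x_gen measurable_HK measurable_HK1 (fun z r h => (hb z r h).1)
    (fun z r h => (hb z r h).2.1) hasDerivAt_HK_z' hf hc hθ hoff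

theorem pot_xx (hρ : 0 < ρ) (hf : Integrable f) (hc : AEMeasurable c) (hθ : AEMeasurable θ)
    (hoff : ∀ᶠ q in 𝓝 (t, x), Off ρ f c θ q) :
    HasDerivAt (fun y => Pot HK1 f c θ t y) (Pot HK2 f c θ t x) x := by
  obtain ⟨C, hC, hb⟩ := HK_bdd_off hρ
  exact pot_x_gen measurable_HK1 measurable_HK2 (fun z r h => (hb z r h).2.1)
    (fun z r h => (hb z r h).2.2) hasDerivAt_HK1_z' hf hc hθ hoff

theorem pot_t (hρ : 0 < ρ) (hf : Integrable f) (hc : AEMeasurable c) (hθ : AEMeasurable θ)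
    (hoff : ∀ᶠ q in 𝓝 (t, x), Off ρ f c θ q) :
    HasDerivAt (fun y => Pot HK f c θ y x) (Pot HK2 f c θ t x) t := by
  obtain ⟨C, hC, hb⟩ := HK_bdd_off hρ
  obtain ⟨s, hs, hoff'⟩ := eventually_iff_exists_mem.1 (slice1 hoff)
  refine (hasDerivAt_integral_of_dominated_loc_of_deriv_le (𝕜 := ℝ) (s := s)
    (bound := fun τ => |f τ| * C) (F := fun y τ => f τ * HK (x - c τ) (y - θ τ))
    (F' := fun y τ => f τ * HK2 (x - c τ) (y - θ τ)) hs
    (Eventually.of_forall fun y => pot_meas measurable_HK hf.1 hc hθ _ _)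
    (pot_int_gen measurable_HK (fun z r h => (hb z r h).1) hf hc hθ hoff.self_of_nhds)
    (pot_meas measurable_HK2 hf.1 hc hθ _ _) ?_
    (hf.abs.mul_const C) ?_).2
  · refine Eventually.of_forall fun τ y hy => ?_
    rw [norm_mul, Real.norm_eq_abs]
    by_cases h0 : f τ = 0
    · simp [h0]
    · exact mul_le_mul_of_nonneg_left (hb _ _ (hoff' y hy τ h0)).2.2 (abs_nonneg _)
  · refine Eventually.of_forall fun τ y hy => ?_
    by_cases h0 : f τ = 0
    · simp only [h0, zero_mul]; exact hasDerivAt_const _ _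
    · exact ((hasDerivAt_HK_r' (Off_ne hρ (hoff' y hy) h0)).comp_sub_const y (θ τ)).const_mul (f τ)

theorem pot_D12 (hρ : 0 < ρ) (hf : Integrable f) (hc : AEMeasurable c) (hθ : AEMeasurable θ)
    (hoff : ∀ᶠ q in 𝓝 (t, x), Off ρ f c θ q) :
    D12 (Pot HK f c θ) t x (Pot HK2 f c θ t x) (Pot HK2 f c θ t x) := by
  refine ⟨pot_t hρ hf hc hθ hoff, Pot HK1 f c θ t, ?_, pot_xx hρ hf hc hθ hoff⟩
  have := slice2 hoff.eventually_nhds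
  filter_upwards [this] with y hy
  exact pot_x hρ hf hc hθ hy
end

def Gs (z : ℝ) : ℝ := HK z 1

theorem Gs_eq (z : ℝ) : Gs z = 1 / (2 * √π) * Real.exp (-(1/4) * z ^ 2) := by
  unfold Gs HK; rw [Real.sqrt_one, mul_one, mul_one, div_eq_mul_inv, mul_comm, one_div]
  congr 2; ring

theorem Gs_cont : Continuous Gs := by
  have : Gs = fun z => 1 / (2 * √π) * Real.exp (-(1/4) * z ^ 2) := funext Gs_eq
  rw [this]; fun_prop

theorem Gs_nonneg (z : ℝ) : 0 ≤ Gs z := HK_nonneg z 1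
theorem Gs_neg (z : ℝ) : Gs (-z) = Gs z := HK_neg z 1

theorem Gs_integrable : Integrable Gs := by
  have : Gs = fun z => 1 / (2 * √π) * Real.exp (-(1/4) * z ^ 2) := funext Gs_eq
  rw [this]
  exact (integrable_exp_neg_mul_sq (by norm_num)).const_mul _

theorem sqrt_aux : √(π / (1/4)) = 2 * √π := by
  rw [show π / (1/4) = 2 ^ 2 * π by ring, Real.sqrt_mul (by norm_num), Real.sqrt_sq (by norm_num)]

theorem Gs_integral : ∫ z, Gs z = 1 := by
  have : Gs = fun z => 1 / (2 * √π) * Real.exp (-(1/4) * z ^ 2) := funext Gs_eq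
  rw [this, integral_const_mul, integral_gaussian, sqrt_aux]
  have : 0 < √π := Real.sqrt_pos.2 Real.pi_pos
  field_simp

theorem Gs_integral_Ioi : ∫ z in Ioi 0, Gs z = 1/2 := by
  have : Gs = fun z => 1 / (2 * √π) * Real.exp (-(1/4) * z ^ 2) := funext Gs_eq
  rw [this, integral_const_mul, integral_gaussian_Ioi, sqrt_aux]
  have : 0 < √π := Real.sqrt_pos.2 Real.pi_pos
  field_simp

def Th (y : ℝ) : ℝ := ∫ z in (0:ℝ)..y, Gs z

theorem hasDerivAt_Th (y : ℝ) : HasDerivAt Th (Gs y) y :=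
  intervalIntegral.integral_hasDerivAt_right (Gs_cont.intervalIntegrable _ _)
    (Gs_cont.stronglyMeasurableAtFilter _ _) Gs_cont.continuousAt

theorem Th_zero : Th 0 = 0 := by simp [Th]
theorem Th_cont : Continuous Th := continuous_iff_continuousAt.2 fun y => (hasDerivAt_Th y).continuousAt

theorem Th_neg (y : ℝ) : Th (-y) = -Th y := by
  unfold Th
  have := intervalIntegral.integral_comp_neg (f := Gs) (a := 0) (b := y)
  simp only [Gs_neg, neg_zero] at this
  rw [this, intervalIntegral.integral_symm]

theorem Th_top : Tendsto Th atTop (𝓝 (1/2)) := by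
  rw [← Gs_integral_Ioi]
  exact intervalIntegral_tendsto_integral_Ioi 0 Gs_integrable.integrableOn tendsto_id

theorem Th_bot : Tendsto Th atBot (𝓝 (-(1/2))) := by
  have h : Th = fun y => -Th (-y) := by funext y; rw [Th_neg]; simp
  rw [h]
  exact (Th_top.comp tendsto_neg_atBot_atTop).neg

def EK (z r : ℝ) : ℝ := Th (z / √r)

theorem HK_eq_Gs {r : ℝ} (hr : 0 < r) (z : ℝ) : HK z r = Gs (z / √r) / √r := by
  unfold Gs HK
  rw [div_pow, Real.sq_sqrt hr.le]
  have : 0 < √r := by positivity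
  rw [Real.sqrt_one, div_div, mul_one, mul_one, div_div, mul_comm 4 r]

theorem hasDerivAt_EK_comp {z r : ℝ → ℝ} {z' r' τ : ℝ} (hr : 0 < r τ) (hz : HasDerivAt z z' τ)
    (hrd : HasDerivAt r r' τ) :
    HasDerivAt (fun τ => EK (z τ) (r τ)) (z' * HK (z τ) (r τ) + r' * HK1 (z τ) (r τ)) τ := by
  have h1 : HasDerivAt (fun τ => z τ / √(r τ)) _ τ := hz.div (hrd.sqrt hr.ne') (by positivity)
  refine ((hasDerivAt_Th _).comp τ h1).congr_deriv ?_
  unfold HK1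
  rw [HK_eq_Gs hr]
  have hq : √(r τ) ^ 2 = r τ := Real.sq_sqrt hr.le
  have : 0 < √(r τ) := by positivity
  rw [← hq]
  generalize √(r τ) = q at *
  rw [Real.sqrt_sq this.le]
  field_simp; ring

theorem EK_tendsto_zero {a : ℝ} (ha : 0 < a) : Tendsto (fun r => EK a r) (𝓝[>] 0) (𝓝 (1/2)) := by
  apply Th_top.comp
  apply Tendsto.const_mul_atTop ha
  apply Tendsto.inv_tendsto_nhdsGT_zero
  rw [tendsto_nhdsWithin_iff]
  refine ⟨?_, ?_⟩
  · exact (Continuous.tendsto' Real.continuous_sqrt _ _ (by simp)).mono_left nhdsWithin_le_nhds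
  · filter_upwards [self_mem_nhdsWithin] with r hr
    exact Real.sqrt_pos.2 hr

theorem HK1_integral_pos {a : ℝ} (ha : 0 < a) : IntegrableOn (fun r => |HK1 a r|) (Ioi 0) ∧
    ∫ r in Ioi 0, |HK1 a r| ≤ 1/2 := by
  set g : ℝ → ℝ := fun r => if r ≤ 0 then -(1/2) else -EK a r with hg
  have hcont : ContinuousWithinAt g (Ici 0) 0 := by
    rw [← continuousWithinAt_Ioi_iff_Ici]
    unfold ContinuousWithinAt
    have : g 0 = -(1/2) := by simp [hg]
    rw [this]
    refine (EK_tendsto_zero ha).neg.congr' ?_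
    filter_upwards [self_mem_nhdsWithin] with r hr
    simp [hg, not_le.2 (show 0 < r from hr)]
  have habs : ∀ r ∈ Ioi (0:ℝ), |HK1 a r| = -HK1 a r := by
    intro r hr
    have hr' : 0 < r := hr
    apply abs_of_nonpos
    unfold HK1
    apply mul_nonpos_of_nonpos_of_nonneg _ (HK_nonneg _ _)
    rw [neg_div]; have : 0 < a / (2 * r) := by positivity
    linarith
  have hderiv : ∀ r ∈ Ioi (0:ℝ), HasDerivAt g |HK1 a r| r := by
    intro r hr
    have hr' : 0 < r := hr
    rw [habs r hr]
    have := (hasDerivAt_EK_comp (z := fun _ => a) (r := fun r => r) (τ := r) hr'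
      (hasDerivAt_const _ _) (hasDerivAt_id r)).neg
    simp only [zero_mul, zero_add, one_mul] at this
    refine this.congr_of_eventuallyEq ?_
    filter_upwards [lt_mem_nhds hr'] with q hq
    simp [hg, not_le.2 hq]
  have hlim : Tendsto g atTop (𝓝 0) := by
    have h1 : Tendsto (fun r : ℝ => -Th (a / √r)) atTop (𝓝 (-Th 0)) := by
      apply Tendsto.neg
      apply (Th_cont.tendsto 0).comp
      apply Tendsto.const_div_atTop
      exact Real.tendsto_sqrt_atTop
    rw [Th_zero, neg_zero] at h1
    refine h1.congr' ?_
    filter_upwards [eventually_gt_atTop 0] with r hr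
    simp [hg, not_le.2 hr, EK]
  have hpos : ∀ r ∈ Ioi (0:ℝ), 0 ≤ |HK1 a r| := fun r _ => abs_nonneg _
  refine ⟨integrableOn_Ioi_deriv_of_nonneg hcont hderiv hpos hlim, ?_⟩
  rw [integral_Ioi_of_hasDerivAt_of_nonneg hcont hderiv hpos hlim]
  simp [hg]

theorem HK1_integral (a : ℝ) : IntegrableOn (fun r => |HK1 a r|) (Ioi 0) ∧
    ∫ r in Ioi 0, |HK1 a r| ≤ 1/2 := by
  rcases lt_trichotomy a 0 with h | h | h
  · have := HK1_integral_pos (a := -a) (by linarith)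
    simpa only [HK1_neg, abs_neg] using this
  · subst h; simp [HK1]
  · exact HK1_integral_pos h

theorem inv_sqrt_int {R : ℝ} (hR : 0 ≤ R) : IntegrableOn (fun r : ℝ => 1 / √r) (Ioo 0 R) ∧
    ∫ r in Ioo 0 R, 1 / √r = 2 * √R := by
  have hc : ContinuousOn (fun r : ℝ => 2 * √r) (Icc 0 R) := by fun_prop
  have hd : ∀ r ∈ Ioo 0 R, HasDerivAt (fun r : ℝ => 2 * √r) (1 / √r) r := by
    intro r hr
    refine ((Real.hasDerivAt_sqrt hr.1.ne').const_mul 2).congr_deriv ?_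
    have : 0 < √r := Real.sqrt_pos.2 hr.1
    field_simp
  have h1 := intervalIntegral.integrableOn_deriv_of_nonneg hc hd (fun r _ => by positivity)
  have h2 := intervalIntegral.integral_eq_sub_of_hasDerivAt_of_le hR hc hd
    ((intervalIntegrable_iff_integrableOn_Ioc_of_le hR).2 h1)
  refine ⟨h1.mono_set Ioo_subset_Ioc_self, ?_⟩
  rw [intervalIntegral.integral_of_le hR, integral_Ioc_eq_integral_Ioo] at h2
  rw [h2]; simp

theorem near_bound {M R r d e : ℝ} (hr : 0 < r) (hrR : r ≤ R) (he : |e| ≤ M * r) :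
    |HK1 (d + e) r| ≤ Real.exp (M ^ 2 * R / 4) * (2 * |HK1 (d / 2) r| + M / 2 * (1 / √r)) := by
  have hM : 0 ≤ M := by
    by_contra h; push Not at h
    have := abs_nonneg e; nlinarith
  have h1 : HK (d + e) r ≤ Real.exp (M ^ 2 * R / 4) * HK (d / 2) r := by
    unfold HK
    rw [← mul_div_assoc, ← Real.exp_add]
    apply div_le_div_of_nonneg_right _ (by positivity)
    apply Real.exp_le_exp.2
    have e2 : e ^ 2 ≤ M ^ 2 * r ^ 2 := by
      rw [← mul_pow, ← sq_abs e]; exact pow_le_pow_left₀ (abs_nonneg e) he 2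
    have e3 : M ^ 2 * r ^ 2 ≤ M ^ 2 * R * r := by nlinarith [sq_nonneg M, mul_nonneg (sq_nonneg M) hr.le]
    have : -((d + e) ^ 2 / (4 * r)) - (M ^ 2 * R / 4 + -((d / 2) ^ 2 / (4 * r))) =
        (-(d + e) ^ 2 + (d/2) ^ 2 - M ^ 2 * R * r) / (4 * r) := by field_simp; ring
    have h4 : (-(d + e) ^ 2 + (d/2) ^ 2 - M ^ 2 * R * r) / (4 * r) ≤ 0 := by
      apply div_nonpos_of_nonpos_of_nonneg _ (by positivity)
      nlinarith [sq_nonneg (3 * d + 4 * e)]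
    linarith
  have h2 : |HK1 (d + e) r| = |d + e| / (2 * r) * HK (d + e) r := by
    unfold HK1
    rw [abs_mul, abs_of_nonneg (HK_nonneg _ _), abs_div, abs_neg, abs_of_pos (by positivity : 0 < 2 * r)]
  have h3 : |HK1 (d / 2) r| = |d| / (4 * r) * HK (d / 2) r := by
    unfold HK1
    rw [abs_mul, abs_of_nonneg (HK_nonneg _ _), abs_div, abs_neg, abs_of_pos (by positivity : 0 < 2 * r),
      abs_div]
    norm_num
    left
    field_simp; ring
  rw [h2, h3]
  have hk := HK_le hr (d / 2)
  rw [abs_of_nonneg (HK_nonneg _ _)] at hk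
  have h5 : |d + e| / (2 * r) ≤ |d| / (2 * r) + M / 2 := by
    rw [div_add' _ _ _ (by positivity)]
    apply div_le_div_of_nonneg_right _ (by positivity)
    have := abs_add_le d e
    nlinarith
  calc |d + e| / (2 * r) * HK (d + e) r
      ≤ (|d| / (2 * r) + M / 2) * (Real.exp (M ^ 2 * R / 4) * HK (d / 2) r) := by
        apply mul_le_mul h5 h1 (HK_nonneg _ _) (by positivity)
    _ = Real.exp (M ^ 2 * R / 4) * (2 * (|d| / (4 * r) * HK (d / 2) r) + M / 2 * HK (d / 2) r) := by
        field_simp; ring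
    _ ≤ _ := by gcongr

theorem curve_K1 {M R : ℝ} (hM : 0 ≤ M) (hR : 0 ≤ R) (d : ℝ) : ∃ G : ℝ → ℝ, (∀ r, 0 ≤ G r) ∧
    Integrable G ∧ ∫ r, G r ≤ Real.exp (M ^ 2 * R / 4) * (1 + M * √R) ∧
    ∀ r ∈ Ioo 0 R, ∀ e, |e| ≤ M * r → |HK1 (d + e) r| ≤ G r := by
  obtain ⟨i1, b1⟩ := HK1_integral (d / 2)
  obtain ⟨i2, b2⟩ := inv_sqrt_int hR
  have i1' := i1.mono_set (Ioo_subset_Ioi_self : Ioo 0 R ⊆ Ioi 0)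
  have b1' : ∫ r in Ioo 0 R, |HK1 (d / 2) r| ≤ 1/2 := by
    refine le_trans ?_ b1
    exact setIntegral_mono_set i1 (Eventually.of_forall fun r => abs_nonneg _)
      (LE.le.eventuallyLE Ioo_subset_Ioi_self)
  have hint := ((i1'.const_mul 2).add (i2.const_mul (M / 2))).const_mul (Real.exp (M ^ 2 * R / 4))
  refine ⟨indicator (Ioo 0 R) (fun r => Real.exp (M ^ 2 * R / 4) * (2 * |HK1 (d / 2) r| + M / 2 * (1 / √r))),
    ?_, ?_, ?_, ?_⟩
  · intro r; apply indicator_nonneg; intro r _; positivity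
  · exact (integrable_indicator_iff measurableSet_Ioo).2 hint
  · rw [integral_indicator measurableSet_Ioo, integral_const_mul,
      integral_add (i1'.const_mul 2) (i2.const_mul (M / 2)), integral_const_mul, integral_const_mul, b2]
    apply mul_le_mul_of_nonneg_left _ (Real.exp_pos _).le
    linarith
  · intro r hr e he
    rw [indicator_of_mem hr]
    exact near_bound hr.1 hr.2.le he

abbrev idt : ℝ → ℝ := fun τ => τ

structure Dens (f : ℝ → ℝ) (B : ℝ) : Prop where
  zero : ∀ τ ≤ 0, f τ = 0
  bdd : ∀ τ, |f τ| ≤ B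
  cont : ∀ τ, 0 < τ → ContinuousAt f τ

structure Curve (c c' : ℝ → ℝ) (M : ℝ) : Prop where
  dens : Dens c' M
  lip : ∀ a b, |c a - c b| ≤ M * |a - b|
  der : ∀ τ, 0 < τ → HasDerivAt c (c' τ) τ

theorem Dens.nonneg {f : ℝ → ℝ} {B : ℝ} (h : Dens f B) : 0 ≤ B := (abs_nonneg _).trans (h.bdd 0)

theorem Dens.contAt {f : ℝ → ℝ} {B : ℝ} (h : Dens f B) {τ : ℝ} (hτ : τ ≠ 0) : ContinuousAt f τ := by
  rcases lt_or_gt_of_ne hτ with h1 | h1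
  · refine (continuousAt_const (y := (0:ℝ))).congr ?_
    filter_upwards [gt_mem_nhds h1] with q hq using (h.zero q hq.le).symm
  · exact h.cont τ h1

theorem Dens.meas {f : ℝ → ℝ} {B : ℝ} (h : Dens f B) : AEStronglyMeasurable f := by
  have e : f = indicator (Ioi 0) f := by
    funext τ
    by_cases ht : 0 < τ
    · rw [indicator_of_mem (show τ ∈ Ioi 0 from ht)]
    · rw [indicator_of_notMem (by simpa using ht), h.zero τ (not_lt.1 ht)]
  rw [e, aestronglyMeasurable_indicator_iff measurableSet_Ioi]
  exact ContinuousOn.aestronglyMeasurable (fun τ hτ => (h.cont τ hτ).continuousWithinAt) measurableSet_Ioi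

theorem Dens.trunc_int {f : ℝ → ℝ} {B : ℝ} (h : Dens f B) (T : ℝ) : Integrable (indicator (Iio T) f) := by
  refine Integrable.mono' (g := indicator (Ioo 0 T) fun _ => B) ?_ (h.meas.indicator measurableSet_Iio) ?_
  · rw [integrable_indicator_iff measurableSet_Ioo]; simp
  · refine Eventually.of_forall fun τ => ?_
    by_cases h1 : τ < T
    · by_cases h2 : 0 < τ
      · rw [indicator_of_mem (show τ ∈ Iio T from h1), indicator_of_mem (show τ ∈ Ioo 0 T from ⟨h2, h1⟩)]
        exact h.bdd τ
      · rw [indicator_of_mem (show τ ∈ Iio T from h1), h.zero τ (not_lt.1 h2), norm_zero]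
        exact indicator_nonneg (fun _ _ => h.nonneg) _
    · rw [indicator_of_notMem (by simpa using h1), norm_zero]
      exact indicator_nonneg (fun _ _ => h.nonneg) _

theorem pot_trunc {k : ℝ → ℝ → ℝ} (hk : ∀ r ≤ 0, ∀ z, k z r = 0) {f c : ℝ → ℝ} {t T : ℝ}
    (htT : t ≤ T) (x : ℝ) : Pot k (indicator (Iio T) f) c idt t x = Pot k f c idt t x := by
  unfold Pot
  congr 1; funext τ
  by_cases h1 : τ < T
  · rw [indicator_of_mem (show τ ∈ Iio T from h1)]
  · rw [hk (t - τ) (by linarith)]; simp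

theorem off_curve {c : ℝ → ℝ} {t x : ℝ} (hc : ContinuousAt c t) (hx : x ≠ c t) :
    ∃ ρ, 0 < ρ ∧ ∀ᶠ q : ℝ × ℝ in 𝓝 (t, x), ∀ τ, ρ ≤ |q.2 - c τ| ∨ ρ ≤ |q.1 - τ| := by
  have hm : 0 < |x - c t| := abs_pos.2 (sub_ne_zero.2 hx)
  set m := |x - c t| with hmdef
  obtain ⟨δ, hδ, hcd⟩ := Metric.continuousAt_iff.1 hc (m / 4) (by positivity)
  refine ⟨min (m / 4) (δ / 2), by positivity, ?_⟩
  have e1 : ∀ᶠ q : ℝ × ℝ in 𝓝 (t, x), |q.2 - x| < m / 4 := by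
    have : ContinuousAt (fun q : ℝ × ℝ => |q.2 - x|) (t, x) := by fun_prop
    exact this.eventually (gt_mem_nhds (by simpa using hm))
  have e2 : ∀ᶠ q : ℝ × ℝ in 𝓝 (t, x), |q.1 - t| < δ / 2 := by
    have : ContinuousAt (fun q : ℝ × ℝ => |q.1 - t|) (t, x) := by fun_prop
    exact this.eventually (gt_mem_nhds (by simpa using hδ))
  filter_upwards [e1, e2] with q h1 h2 τ
  by_cases hτ : |τ - t| < δ
  · left
    have := hcd (x := τ) (by simpa [Real.dist_eq] using hτ)
    rw [Real.dist_eq] at this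
    refine (min_le_left _ _).trans ?_
    have h3 : m ≤ |x - q.2| + |q.2 - c τ| + |c τ - c t| := by
      rw [hmdef]
      calc |x - c t| = |(x - q.2) + (q.2 - c τ) + (c τ - c t)| := by congr 1; ring
        _ ≤ _ := (abs_add_le _ _).trans (by gcongr; exact abs_add_le _ _)
    rw [abs_sub_comm x q.2] at h3
    linarith
  · right
    refine (min_le_right _ _).trans ?_
    push Not at hτ
    have h3 : |τ - t| ≤ |q.1 - τ| + |q.1 - t| := by
      calc |τ - t| = |(q.1 - t) - (q.1 - τ)| := by congr 1; ring
        _ ≤ _ := by have := abs_sub (q.1 - t) (q.1 - τ); linarith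
    linarith

theorem Pot_eventually {k : ℝ → ℝ → ℝ} (hk : ∀ r ≤ 0, ∀ z, k z r = 0) (f c : ℝ → ℝ) (t x : ℝ) :
    ∀ᶠ q : ℝ × ℝ in 𝓝 (t, x),
      Pot k f c idt q.1 q.2 = Pot k (indicator (Iio (t + 1)) f) c idt q.1 q.2 := by
  have : ∀ᶠ q : ℝ × ℝ in 𝓝 (t, x), q.1 < t + 1 :=
    continuousAt_fst.eventually (gt_mem_nhds (by simp))
  filter_upwards [this] with q hq
  exact (pot_trunc hk hq.le _).symm

theorem sl_off {f c : ℝ → ℝ} {B t x : ℝ} (hf : Dens f B) (hc : Continuous c) (hx : x ≠ c t) :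
    (ContinuousAt (fun q : ℝ × ℝ => Pot HK f c idt q.1 q.2) (t, x) ∧
    ContinuousAt (fun q : ℝ × ℝ => Pot HK1 f c idt q.1 q.2) (t, x) ∧
    ContinuousAt (fun q : ℝ × ℝ => Pot HK2 f c idt q.1 q.2) (t, x)) ∧
    HasDerivAt (fun y => Pot HK f c idt t y) (Pot HK1 f c idt t x) x ∧
    HasDerivAt (fun y => Pot HK1 f c idt t y) (Pot HK2 f c idt t x) x ∧
    HasDerivAt (fun τ => Pot HK f c idt τ x) (Pot HK2 f c idt t x) t := by
  obtain ⟨ρ, hρ, ho⟩ := off_curve hc.continuousAt hx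
  set F := indicator (Iio (t + 1)) f with hF
  have hoff : ∀ᶠ q in 𝓝 (t, x), Off ρ F c idt q := by
    filter_upwards [ho] with q hq τ _ using hq τ
  have hFi : Integrable F := hf.trunc_int _
  have hcm : AEMeasurable c := hc.measurable.aemeasurable
  have him : AEMeasurable idt := measurable_id.aemeasurable
  have h0 : ∀ r ≤ 0, ∀ z, HK z r = 0 := fun r hr z => HK_of_nonpos hr z
  have h1 : ∀ r ≤ 0, ∀ z, HK1 z r = 0 := fun r hr z => HK1_of_nonpos hr z
  have h2 : ∀ r ≤ 0, ∀ z, HK2 z r = 0 := fun r hr z => HK2_of_nonpos hr z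
  have E0 := Pot_eventually h0 f c t x
  have E1 := Pot_eventually h1 f c t x
  have E2 := Pot_eventually h2 f c t x
  obtain ⟨c0, c1, c2⟩ := pot_cont hρ hFi hcm him hoff
  refine ⟨⟨c0.congr_of_eventuallyEq E0, c1.congr_of_eventuallyEq E1, c2.congr_of_eventuallyEq E2⟩, ?_, ?_, ?_⟩
  · rw [E1.self_of_nhds]
    exact (pot_x hρ hFi hcm him hoff).congr_of_eventuallyEq (slice2 E0)
  · rw [E2.self_of_nhds]
    exact (pot_xx hρ hFi hcm him hoff).congr_of_eventuallyEq (slice2 E1)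
  · rw [E2.self_of_nhds]
    exact (pot_t hρ hFi hcm him hoff).congr_of_eventuallyEq (slice1 E0)

/-- change of variables -/
theorem Pot_rev (k : ℝ → ℝ → ℝ) (f c : ℝ → ℝ) (t x : ℝ) :
    Pot k f c idt t x = ∫ r, f (t - r) * k (x - c (t - r)) r := by
  unfold Pot
  rw [← integral_sub_left_eq_self _ volume t]
  congr 1; funext r; simp

theorem sl_bound_aux {f c : ℝ → ℝ} {B : ℝ} (hf : Dens f B) (t x T : ℝ) (htT : t ≤ T) (r : ℝ) :
    ‖f (t - r) * HK (x - c (t - r)) r‖ ≤ indicator (Ioo 0 T) (fun r => B * (1 / √r)) r := by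
  have hn := hf.nonneg
  have hnn : 0 ≤ indicator (Ioo 0 T) (fun r => B * (1 / √r)) r :=
    indicator_nonneg (fun r _ => by positivity) r
  by_cases h1 : 0 < r
  · by_cases h2 : r < t
    · rw [indicator_of_mem (show r ∈ Ioo 0 T from ⟨h1, by linarith⟩), norm_mul]
      exact mul_le_mul (hf.bdd _) (HK_le h1 _) (abs_nonneg _) hn
    · rw [hf.zero (t - r) (by linarith)]; simpa using hnn
  · rw [HK_of_nonpos (not_lt.1 h1)]; simpa using hnn

theorem sl_bound_int {B : ℝ} (T : ℝ) (hT : 0 ≤ T) :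
    Integrable (indicator (Ioo 0 T) (fun r => B * (1 / √r))) ∧
    ∫ r, indicator (Ioo 0 T) (fun r => B * (1 / √r)) r = 2 * B * √T := by
  obtain ⟨a, b⟩ := inv_sqrt_int hT
  refine ⟨(integrable_indicator_iff measurableSet_Ioo).2 (a.const_mul B), ?_⟩
  rw [integral_indicator measurableSet_Ioo, integral_const_mul, b]; ring

theorem sl_int {f c : ℝ → ℝ} {B : ℝ} (hf : Dens f B) (hc : Continuous c) (t x : ℝ) :
    Integrable (fun τ => f τ * HK (x - c τ) (t - τ)) := by
  have h1 : Integrable (fun r => f (t - r) * HK (x - c (t - r)) r) := by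
    refine (sl_bound_int (B := B) (max t 0) (le_max_right _ _)).1.mono' ?_
      (Eventually.of_forall (sl_bound_aux hf t x _ (le_max_left _ _)))
    have hm := pot_meas measurable_HK hf.meas hc.measurable.aemeasurable
      (θ := idt) measurable_id.aemeasurable t x
    have := hm.comp_quasiMeasurePreserving (Measure.measurePreserving_sub_left volume t).quasiMeasurePreserving
    refine this.congr (Eventually.of_forall fun r => ?_)
    simp [Function.comp]
  have := h1.comp_sub_left t
  simpa using this

theorem sl_bound {f c : ℝ → ℝ} {B : ℝ} (hf : Dens f B) (t x : ℝ) :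
    |Pot HK f c idt t x| ≤ 2 * B * √t := by
  rw [Pot_rev]
  have h := sl_bound_int (B := B) (max t 0) (le_max_right _ _)
  have := norm_integral_le_of_norm_le h.1
    (Eventually.of_forall (sl_bound_aux (c := c) hf t x _ (le_max_left _ _)))
  rw [h.2] at this
  have e : √(max t 0) = √t := by
    rcases le_total 0 t with h | h
    · rw [max_eq_left h]
    · rw [max_eq_right h, Real.sqrt_zero, Real.sqrt_eq_zero_of_nonpos h]
  rwa [e] at this

theorem sl_cont {f c : ℝ → ℝ} {B : ℝ} (hf : Dens f B) (hc : Continuous c) :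
    Continuous (fun q : ℝ × ℝ => Pot HK f c idt q.1 q.2) := by
  rw [continuous_iff_continuousAt]
  rintro ⟨t, x⟩
  have hrw : (fun q : ℝ × ℝ => Pot HK f c idt q.1 q.2) =
      fun q : ℝ × ℝ => ∫ r, f (q.1 - r) * HK (q.2 - c (q.1 - r)) r := by
    funext q; exact Pot_rev _ _ _ _ _
  rw [hrw]
  have e1 : ∀ᶠ q : ℝ × ℝ in 𝓝 (t, x), q.1 ≤ |t| + 1 := by
    filter_upwards [continuousAt_fst.eventually (gt_mem_nhds (show (t, x).1 < t + 1 by simp))] with q hq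
    have := le_abs_self t; linarith
  apply continuousAt_of_dominated (bound := indicator (Ioo 0 (|t| + 1)) (fun r => B * (1 / √r)))
  · refine Eventually.of_forall fun q => ?_
    have := ((sl_int hf hc q.1 q.2).comp_sub_left q.1).1
    simpa using this
  · filter_upwards [e1] with q hq
    exact Eventually.of_forall (sl_bound_aux hf q.1 q.2 _ hq)
  · exact (sl_bound_int _ (by positivity)).1
  · have h1 : ∀ᵐ r : ℝ, r ≠ t := by simp [ae_iff, measure_singleton]
    have h2 : ∀ᵐ r : ℝ, r ≠ 0 := by simp [ae_iff, measure_singleton]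
    filter_upwards [h1, h2] with r hr1 hr2
    have g1 : ContinuousAt (fun q : ℝ × ℝ => q.1 - r) (t, x) := by fun_prop
    apply ContinuousAt.mul
    · exact ContinuousAt.comp (g := f) (hf.contAt (sub_ne_zero.2 hr1.symm)) g1
    · have g2 : ContinuousAt (fun q : ℝ × ℝ => q.2 - c (q.1 - r)) (t, x) := by fun_prop
      have h3 : Continuous (fun z => HK z r) :=
        continuous_iff_continuousAt.2 fun z => (hasDerivAt_HK_z' r z).continuousAt
      exact h3.continuousAt.comp g2

def Cn (M R : ℝ) : ℝ := Real.exp (M ^ 2 * R / 4) * (1 + M * √R)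

theorem Curve.cont {c c' : ℝ → ℝ} {M : ℝ} (h : Curve c c' M) : Continuous c :=
  (LipschitzWith.of_dist_le_mul (K := ⟨M, h.dens.nonneg⟩) fun a b => h.lip a b).continuous

theorem dl_bound {f c c' : ℝ → ℝ} {B M R a t x : ℝ} (hfm : AEStronglyMeasurable f) (hc : Curve c c' M)
    (hB : 0 ≤ B) (hfz : ∀ τ ≤ a, f τ = 0) (hfb : ∀ τ ∈ Ioo a t, |f τ| ≤ B) (hR0 : 0 ≤ R) (hR : t - a ≤ R) :
    Integrable (fun τ => f τ * HK1 (x - c τ) (t - τ)) ∧ |Pot HK1 f c idt t x| ≤ B * Cn M R := by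
  obtain ⟨G, G0, Gi, Gb, hG⟩ := curve_K1 hc.dens.nonneg hR0 (x - c t)
  have key : ∀ τ, ‖f τ * HK1 (x - c τ) (t - τ)‖ ≤ B * G (t - τ) := by
    intro τ
    have h0 : 0 ≤ B * G (t - τ) := mul_nonneg hB (G0 _)
    by_cases h1 : τ < t
    · by_cases h2 : a < τ
      · rw [norm_mul]
        refine mul_le_mul (hfb τ ⟨h2, h1⟩) ?_ (norm_nonneg _) hB
        have h3 := hG (t - τ) ⟨by linarith, by linarith⟩ (c t - c τ) ((hc.lip t τ).trans_eq (by
          rw [abs_of_pos (show 0 < t - τ by linarith)]))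
        rwa [show x - c t + (c t - c τ) = x - c τ by ring] at h3
      · rw [hfz τ (not_lt.1 h2)]; simpa using h0
    · rw [HK1_of_nonpos (by linarith)]; simpa using h0
  have Gi' : Integrable (fun τ => B * G (t - τ)) := (Gi.comp_sub_left t).const_mul B
  refine ⟨Gi'.mono' (pot_meas measurable_HK1 hfm hc.cont.measurable.aemeasurable
      (θ := idt) measurable_id.aemeasurable t x) (Eventually.of_forall key), ?_⟩
  refine (norm_integral_le_of_norm_le Gi' (Eventually.of_forall key)).trans ?_
  rw [integral_const_mul, integral_sub_left_eq_self G volume t]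
  exact mul_le_mul_of_nonneg_left Gb hB

theorem dl_int {f c c' : ℝ → ℝ} {B M : ℝ} (hf : Dens f B) (hc : Curve c c' M) (t x : ℝ) :
    Integrable (fun τ => f τ * HK1 (x - c τ) (t - τ)) :=
  (dl_bound (R := |t|) hf.meas hc hf.nonneg hf.zero (fun τ _ => hf.bdd τ) (abs_nonneg t)
    (by have := le_abs_self t; linarith)).1

def chi : ℝ → ℝ := indicator (Ioi (0:ℝ)) fun _ => (1:ℝ)

theorem chi_dens : Dens chi 1 := by
  refine ⟨fun τ h => indicator_of_notMem (by simpa using h) _, fun τ => ?_, fun τ h => ?_⟩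
  · unfold chi indicator; split_ifs <;> simp
  · refine (continuousAt_const (y := (1:ℝ))).congr ?_
    filter_upwards [lt_mem_nhds h] with q hq
    exact (indicator_of_mem (show q ∈ Ioi (0:ℝ) from hq) fun _ => (1:ℝ)).symm

theorem EK_end {c c' : ℝ → ℝ} {M : ℝ} (hc : Curve c c' M) (t x : ℝ) :
    Tendsto (fun τ => EK (x - c τ) (t - τ)) (𝓝[<] t) (𝓝 (1/2 * Real.sign (x - c t))) := by
  have hsq : Tendsto (fun τ => √(t - τ)) (𝓝[<] t) (𝓝 0) :=
    (Continuous.tendsto' (by fun_prop) _ _ (by simp)).mono_left nhdsWithin_le_nhds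
  have hinv : Tendsto (fun τ => (√(t - τ))⁻¹) (𝓝[<] t) atTop := by
    apply Tendsto.inv_tendsto_nhdsGT_zero
    rw [tendsto_nhdsWithin_iff]
    refine ⟨hsq, ?_⟩
    filter_upwards [self_mem_nhdsWithin] with r hr
    exact Real.sqrt_pos.2 (sub_pos.2 hr)
  have hz : Tendsto (fun τ => x - c τ) (𝓝[<] t) (𝓝 (x - c t)) := by
    have h := hc.cont
    exact (Continuous.tendsto (by fun_prop) t).mono_left nhdsWithin_le_nhds
  unfold EK
  simp only [div_eq_mul_inv (_ - _)]
  rcases lt_trichotomy (x - c t) 0 with h | h | h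
  · rw [Real.sign_of_neg h, mul_neg, mul_one]
    exact Th_bot.comp (hz.neg_mul_atTop h hinv)
  · rw [h, Real.sign_zero, mul_zero, ← Th_zero]
    refine (Th_cont.tendsto 0).comp ?_
    refine squeeze_zero_norm' (a := fun τ => M * √(t - τ)) ?_ (by simpa using hsq.const_mul M)
    filter_upwards [self_mem_nhdsWithin] with τ hτ
    have h1 : 0 < t - τ := sub_pos.2 hτ
    have h2 := hc.lip t τ
    rw [abs_of_pos h1] at h2
    have h3 : 0 < √(t - τ) := Real.sqrt_pos.2 h1
    rw [norm_mul, norm_inv, Real.norm_eq_abs, Real.norm_of_nonneg h3.le, ← div_eq_mul_inv, div_le_iff₀ h3,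
      mul_assoc, Real.mul_self_sqrt h1.le]
    rwa [show x = c t by linarith]
  · rw [Real.sign_of_pos h, mul_one]
    exact Th_top.comp (hz.pos_mul_atTop h hinv)

theorem D1_id {c c' : ℝ → ℝ} {M t : ℝ} (hc : Curve c c' M) (ht : 0 < t) (x : ℝ) :
    Pot HK1 chi c idt t x = EK (x - c 0) t - 1/2 * Real.sign (x - c t) - Pot HK c' c idt t x := by
  have hcc := hc.cont
  have i1 := dl_int chi_dens hc t x
  have i2 := sl_int hc.dens hcc t x
  have key : ∫ τ in (0:ℝ)..t, (-c' τ * HK (x - c τ) (t - τ) + -1 * HK1 (x - c τ) (t - τ)) =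
      1/2 * Real.sign (x - c t) - EK (x - c 0) t := by
    refine intervalIntegral.integral_eq_sub_of_hasDerivAt_of_tendsto
      (f := fun τ => EK (x - c τ) (t - τ)) ht ?_ ?_ ?_ (EK_end hc t x)
    · intro τ hτ
      exact hasDerivAt_EK_comp (by linarith [hτ.2]) ((hc.der τ hτ.1).const_sub x)
        ((hasDerivAt_id τ).const_sub t)
    · rw [intervalIntegrable_iff_integrableOn_Ioo_of_le ht.le]
      refine ((i2.add i1).neg.integrableOn (s := Ioo 0 t)).congr_fun (fun τ hτ => ?_) measurableSet_Ioo
      simp [chi, indicator_of_mem (show τ ∈ Ioi 0 from hτ.1)]; ring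
    · have : ContinuousAt (fun τ => EK (x - c τ) (t - τ)) 0 := by
        unfold EK
        refine Th_cont.continuousAt.comp (ContinuousAt.div (by fun_prop) (by fun_prop) ?_)
        simpa using (Real.sqrt_pos.2 ht).ne'
      have := this.tendsto.mono_left (nhdsWithin_le_nhds (s := Ioi 0))
      simpa using this
  have e : Pot HK1 chi c idt t x + Pot HK c' c idt t x =
      -∫ τ in (0:ℝ)..t, (-c' τ * HK (x - c τ) (t - τ) + -1 * HK1 (x - c τ) (t - τ)) := by
    unfold Pot
    rw [← integral_add i1 i2, intervalIntegral.integral_of_le ht.le, ← intervalIntegral.integral_of_le ht.le,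
      ← intervalIntegral.integral_neg, intervalIntegral.integral_of_le ht.le, integral_Ioc_eq_integral_Ioo,
      ← integral_indicator measurableSet_Ioo]
    congr 1; funext τ
    by_cases h : τ ∈ Ioo 0 t
    · rw [indicator_of_mem h]
      simp only [chi, indicator_of_mem (show τ ∈ Ioi 0 from h.1)]; ring
    · rw [indicator_of_notMem h]
      rcases lt_or_ge 0 τ with h1 | h1
      · have h2 : t - τ ≤ 0 := by by_contra h3; exact h ⟨h1, by linarith⟩
        rw [HK1_of_nonpos h2, HK_of_nonpos h2]; ring
      · rw [chi_dens.zero τ h1, hc.dens.zero τ h1]; ring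
  rw [key] at e
  linarith

theorem Pot_lin {k : ℝ → ℝ → ℝ} {f g c : ℝ → ℝ} {t x : ℝ} (A : ℝ)
    (hf : Integrable (fun τ => f τ * k (x - c τ) (t - τ)))
    (hg : Integrable (fun τ => g τ * k (x - c τ) (t - τ))) :
    Pot k (fun τ => f τ + A * g τ) c idt t x = Pot k f c idt t x + A * Pot k g c idt t x := by
  unfold Pot
  rw [← integral_const_mul, ← integral_add hf (hg.const_mul A)]
  congr 1; funext τ; ring

theorem J_cont {f c c' : ℝ → ℝ} {B M t₀ : ℝ} (hf : Dens f B) (hc : Curve c c' M) (ht₀ : 0 < t₀) (x₀ : ℝ) :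
    ContinuousAt (fun q : ℝ × ℝ => Pot HK1 f c idt q.1 q.2 + 1/2 * Real.sign (q.2 - c q.1) * f q.1) (t₀, x₀) := by
  have hcc := hc.cont
  apply continuousAt_of_locally_uniform_approx_of_continuousAt
  intro u hu
  obtain ⟨ε, hε, hεu⟩ := Metric.mem_uniformity_dist.1 hu
  have hCn : 0 < Cn M t₀ := by
    have := hc.dens.nonneg; unfold Cn; positivity
  set ε' := ε / (4 * Cn M t₀) with hε'
  obtain ⟨δ, hδ, hfd⟩ := Metric.continuousAt_iff.1 (hf.cont t₀ ht₀) ε' (by positivity)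
  set b := min δ t₀ / 4 with hb
  have hbp : 0 < b := by positivity
  have hbδ : b ≤ δ / 4 := by rw [hb]; linarith [min_le_left δ t₀]
  have hbt : b ≤ t₀ / 4 := by rw [hb]; linarith [min_le_right δ t₀]
  set a := t₀ - b with ha
  let G : ℝ × ℝ → ℝ := fun q => Pot HK1 (indicator (Iio a) f) c idt q.1 q.2 +
    f q.1 * (-Pot HK1 (indicator (Iio a) chi) c idt q.1 q.2 + (EK (q.2 - c 0) q.1 - Pot HK c' c idt q.1 q.2))
  have hoff : ∀ g : ℝ → ℝ, ∀ᶠ q in 𝓝 (t₀, x₀), Off (b / 2) (indicator (Iio a) g) c idt q := by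
    intro g
    have e1 : ∀ᶠ q : ℝ × ℝ in 𝓝 (t₀, x₀), t₀ - b / 2 < q.1 :=
      continuousAt_fst.eventually (lt_mem_nhds (by simpa using hbp))
    filter_upwards [e1] with q hq τ hτ
    right
    have : τ < a := by
      by_contra h; exact hτ (indicator_of_notMem (by simpa using h) _)
    simp only [idt]
    rw [abs_of_pos (by linarith)]; linarith
  have hfar : ∀ {g : ℝ → ℝ} {B'}, Dens g B' →
      ContinuousAt (fun q : ℝ × ℝ => Pot HK1 (indicator (Iio a) g) c idt q.1 q.2) (t₀, x₀) := fun {g B'} hg =>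
    (pot_cont (half_pos hbp) (hg.trunc_int a) hcc.measurable.aemeasurable
      measurable_id.aemeasurable (hoff g)).2.1
  refine ⟨{q : ℝ × ℝ | dist q (t₀, x₀) < b}, Metric.ball_mem_nhds _ hbp, G, ?_, ?_⟩
  · have f1 : ContinuousAt (fun q : ℝ × ℝ => f q.1) (t₀, x₀) :=
      ContinuousAt.comp (g := f) (x := (t₀, x₀)) (hf.cont t₀ ht₀) continuousAt_fst
    have f2 : ContinuousAt (fun q : ℝ × ℝ => EK (q.2 - c 0) q.1) (t₀, x₀) := by
      unfold EK
      refine Th_cont.continuousAt.comp (ContinuousAt.div (by fun_prop) (by fun_prop) ?_)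
      simpa using (Real.sqrt_pos.2 ht₀).ne'
    exact (hfar hf).add (f1.mul ((hfar chi_dens).neg.add (f2.sub (sl_cont hc.dens hcc).continuousAt)))
  · rintro ⟨t, x⟩ hq
    apply hεu
    have hq1 : |t - t₀| < b := by
      have := (le_max_left _ _).trans_lt (show max (dist t t₀) (dist x x₀) < b from hq)
      rwa [Real.dist_eq] at this
    obtain ⟨q1, q2⟩ := abs_lt.1 hq1
    have htp : 0 < t := by linarith
    have hft := hfd (x := t) (by rw [Real.dist_eq]; linarith)
    rw [Real.dist_eq] at hft ⊢
    let h : ℝ → ℝ := indicator (Ici a) fun τ => f τ + (-f t) * chi τ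
    have hhz : ∀ τ ≤ a - b / 4, h τ = 0 := fun τ hτ => indicator_of_notMem (by simp; linarith) _
    have hhb : ∀ τ ∈ Ioo (a - b / 4) t, |h τ| ≤ 2 * ε' := by
      intro τ hτ
      by_cases h1 : a ≤ τ
      · have h2 : 0 < τ := by linarith
        simp only [h, indicator_of_mem (show τ ∈ Ici a from h1), chi, indicator_of_mem (show τ ∈ Ioi 0 from h2)]
        have h3 := hfd (x := τ) (by rw [Real.dist_eq, abs_lt]; constructor <;> linarith [hτ.2])
        rw [Real.dist_eq] at h3
        rw [abs_lt] at h3 hft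
        rw [abs_le]; constructor <;> linarith
      · simp only [h]; rw [indicator_of_notMem (by simpa using h1)]; simp; positivity
    have hhm : AEStronglyMeasurable h :=
      (hf.meas.add (chi_dens.meas.const_mul _)).indicator measurableSet_Ici
    obtain ⟨hi, hbd⟩ := dl_bound (R := t₀) (x := x) hhm hc (by positivity) hhz hhb ht₀.le (by linarith)
    have hsm : 2 * ε' * Cn M t₀ = ε / 2 := by rw [hε']; field_simp; ring
    rw [hsm] at hbd
    have ifar : ∀ {g : ℝ → ℝ} {B'}, Dens g B' →
        Integrable (fun τ => indicator (Iio a) g τ * HK1 (x - c τ) (t - τ)) := fun {g B'} hg =>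
      (dl_bound (R := t₀ + b) (hg.meas.indicator measurableSet_Iio) hc hg.nonneg
        (fun τ hτ => by
          by_cases h1 : τ ∈ Iio a
          · rw [indicator_of_mem h1, hg.zero τ hτ]
          · rw [indicator_of_notMem h1])
        (fun τ _ => by
          by_cases h1 : τ ∈ Iio a
          · rw [indicator_of_mem h1]; exact hg.bdd τ
          · rw [indicator_of_notMem h1]; simpa using hg.nonneg) (by linarith) (by linarith)).1
    have e1 : Pot HK1 f c idt t x + (-f t) * Pot HK1 chi c idt t x =
        (Pot HK1 (indicator (Iio a) f) c idt t x + (-f t) * Pot HK1 (indicator (Iio a) chi) c idt t x)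
        + 1 * Pot HK1 h c idt t x := by
      rw [← Pot_lin _ (dl_int hf hc t x) (dl_int chi_dens hc t x), ← Pot_lin _ (ifar hf) (ifar chi_dens),
        ← Pot_lin (k := HK1) (f := fun τ => indicator (Iio a) f τ + -f t * indicator (Iio a) chi τ) _ ?_ hi]
      · congr 1; funext τ
        by_cases h1 : τ < a
        · simp only [h, indicator_of_mem (show τ ∈ Iio a from h1), indicator_of_notMem (show τ ∉ Ici a by simpa using h1)]
          ring
        · simp only [h, indicator_of_notMem (show τ ∉ Iio a by simpa using h1),
            indicator_of_mem (show τ ∈ Ici a by simpa using h1)]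
          ring
      · refine ((ifar hf).add ((ifar chi_dens).const_mul (-f t))).congr (Eventually.of_forall fun τ => ?_)
        simp only [Pi.add_apply]; ring
    have e2 := D1_id hc htp x
    have e3 : Pot HK1 f c idt t x + 1/2 * Real.sign (x - c t) * f t - G (t, x) = Pot HK1 h c idt t x := by
      simp only [G]
      rw [e2] at e1
      linear_combination e1
    simp only
    rw [e3]; linarith

structure IniD (w : ℝ → ℝ) (σ L : ℝ) : Prop where
  pos : 0 < σ
  Lnn : 0 ≤ L
  lip : ∀ a b, |w a - w b| ≤ L * |a - b|
  even : ∀ x, w (-x) = w x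
  nonneg : ∀ x, 0 ≤ w x
  zero : ∀ x, σ ≤ x → w x = 0

abbrev zt : ℝ → ℝ := fun _ => 0

def IP (w : ℝ → ℝ) (t x : ℝ) : ℝ := ∫ z, w (x - √t * z) * Gs z

section
variable {w : ℝ → ℝ} {σ L : ℝ} (h : IniD w σ L)
include h

theorem IniD.cont : Continuous w :=
  (LipschitzWith.of_dist_le_mul (K := ⟨L, h.Lnn⟩) fun a b => h.lip a b).continuous

theorem IniD.bd' (x : ℝ) (hx : 0 ≤ x) : w x ≤ L * max (σ - x) 0 := by
  rcases le_total σ x with h1 | h1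
  · rw [h.zero x h1]; exact mul_nonneg h.Lnn (le_max_right _ _)
  · have := h.lip x σ
    rw [h.zero σ le_rfl, sub_zero, abs_of_nonneg (h.nonneg x), abs_sub_comm, abs_of_nonneg (by linarith)] at this
    exact this.trans (mul_le_mul_of_nonneg_left (le_max_left _ _) h.Lnn)

theorem IniD.bd (x : ℝ) : |w x| ≤ L * σ := by
  rw [abs_of_nonneg (h.nonneg x)]
  have key : ∀ y, 0 ≤ y → w y ≤ L * σ := fun y hy => (h.bd' y hy).trans
    (mul_le_mul_of_nonneg_left (max_le (by linarith) h.pos.le) h.Lnn)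
  rcases le_total 0 x with hx | hx
  · exact key x hx
  · rw [← h.even]; exact key _ (by linarith)

theorem IniD.supp (x : ℝ) (hx : w x ≠ 0) : x ∈ Icc (-σ) σ := by
  constructor
  · by_contra h1; exact hx (by rw [← h.even]; exact h.zero _ (by linarith))
  · by_contra h1; exact hx (h.zero _ (by linarith))

theorem IniD.int : Integrable w := by
  refine h.cont.integrable_of_hasCompactSupport ?_
  exact HasCompactSupport.of_support_subset_isCompact (isCompact_Icc (a := -σ) (b := σ)) (fun x hx => h.supp x hx)

theorem ip_int (t x : ℝ) : Integrable (fun z => w (x - √t * z) * Gs z) := by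
  have := h.cont
  refine (Gs_integrable.const_mul (L * σ)).mono' ?_ (Eventually.of_forall fun z => ?_)
  · have := Gs_cont; exact Continuous.aestronglyMeasurable (by fun_prop)
  · rw [norm_mul, Real.norm_of_nonneg (Gs_nonneg z)]
    exact mul_le_mul_of_nonneg_right (h.bd _) (Gs_nonneg z)

theorem ip_cont : Continuous (fun q : ℝ × ℝ => IP w q.1 q.2) := by
  have hw := h.cont
  have hg := Gs_cont
  refine continuous_of_dominated (bound := fun z => L * σ * Gs z) (fun q => (ip_int h _ _).1)
    (fun q => Eventually.of_forall fun z => ?_) (Gs_integrable.const_mul _)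
    (Eventually.of_forall fun z => by fun_prop)
  rw [norm_mul, Real.norm_of_nonneg (Gs_nonneg z)]
  exact mul_le_mul_of_nonneg_right (h.bd _) (Gs_nonneg z)

theorem ip_bd (t x : ℝ) : |IP w t x| ≤ L * σ := by
  have := norm_integral_le_of_norm_le (Gs_integrable.const_mul (L * σ))
    (f := fun z => w (x - √t * z) * Gs z) (Eventually.of_forall fun z => by
      rw [norm_mul, Real.norm_of_nonneg (Gs_nonneg z)]
      exact mul_le_mul_of_nonneg_right (h.bd _) (Gs_nonneg z))
  rw [integral_const_mul, Gs_integral, mul_one] at this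
  exact this

omit h in
theorem ip_zero (x : ℝ) : IP w 0 x = w x := by
  unfold IP; simp [integral_const_mul, Gs_integral]

theorem ip_lip (t a b : ℝ) : |IP w t a - IP w t b| ≤ L * |a - b| := by
  unfold IP
  rw [← integral_sub (ip_int h t a) (ip_int h t b)]
  have := norm_integral_le_of_norm_le (Gs_integrable.const_mul (L * |a - b|))
    (f := fun z => w (a - √t * z) * Gs z - w (b - √t * z) * Gs z) (Eventually.of_forall fun z => by
      rw [← sub_mul, norm_mul, Real.norm_of_nonneg (Gs_nonneg z)]
      refine mul_le_mul_of_nonneg_right ((h.lip _ _).trans_eq ?_) (Gs_nonneg z)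
      congr 2; ring)
  rw [integral_const_mul, Gs_integral, mul_one] at this
  exact this

omit h in
theorem HK1_scale {t : ℝ} (ht : 0 < t) (z : ℝ) : HK1 (√t * z) t = HK1 z 1 / t := by
  unfold HK1
  rw [HK_eq_Gs ht, HK_eq_Gs one_pos]
  have h1 : 0 < √t := Real.sqrt_pos.2 ht
  have h2 : √t * √t = t := Real.mul_self_sqrt ht.le
  rw [mul_div_cancel_left₀ _ h1.ne', Real.sqrt_one, div_one, div_one]
  have : t ≠ 0 := ht.ne'
  field_simp

omit h in
theorem ip_cv {t : ℝ} (ht : 0 < t) (k : ℝ → ℝ → ℝ) (x : ℝ) :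
    Pot k w idt zt t x = √t * ∫ z, w (x - √t * z) * k (√t * z) t := by
  have h1 : 0 < √t := Real.sqrt_pos.2 ht
  have e := Measure.integral_comp_mul_left (fun y => w (x - y) * k y t) (√t)
  rw [e, abs_of_pos (inv_pos.2 h1), smul_eq_mul, ← mul_assoc, mul_inv_cancel₀ h1.ne', one_mul,
    ← integral_sub_left_eq_self _ volume x]
  unfold Pot
  simp

omit h in
theorem ip_eq {t : ℝ} (ht : 0 < t) (x : ℝ) : IP w t x = Pot HK w idt zt t x := by
  rw [ip_cv ht, ← integral_const_mul]
  have h1 : 0 < √t := Real.sqrt_pos.2 ht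
  unfold IP; congr 1; funext z
  rw [HK_eq_Gs ht, mul_div_cancel_left₀ _ h1.ne']; field_simp

omit h in
theorem ip1_eq {t : ℝ} (ht : 0 < t) (x : ℝ) :
    Pot HK1 w idt zt t x = (∫ z, w (x - √t * z) * HK1 z 1) / √t := by
  have h1 : 0 < √t := Real.sqrt_pos.2 ht
  have h2 : √t * √t = t := Real.mul_self_sqrt ht.le
  rw [ip_cv ht, ← integral_const_mul, ← integral_div]
  congr 1; funext z
  rw [HK1_scale ht]
  nth_rewrite 3 [← h2]
  field_simp

theorem ip_reg {t : ℝ} (ht : 0 < t) (x : ℝ) :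
    ContinuousAt (fun q : ℝ × ℝ => Pot HK1 w idt zt q.1 q.2) (t, x) ∧
    ContinuousAt (fun q : ℝ × ℝ => Pot HK2 w idt zt q.1 q.2) (t, x) ∧
    HasDerivAt (IP w t) (Pot HK1 w idt zt t x) x ∧
    HasDerivAt (Pot HK1 w idt zt t) (Pot HK2 w idt zt t x) x ∧
    HasDerivAt (fun τ => IP w τ x) (Pot HK2 w idt zt t x) t := by
  have hoff : ∀ᶠ q in 𝓝 (t, x), Off (t / 2) w idt zt q := by
    have e1 : ∀ᶠ q : ℝ × ℝ in 𝓝 (t, x), t / 2 < q.1 :=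
      continuousAt_fst.eventually (lt_mem_nhds (by simpa using ht))
    filter_upwards [e1] with q hq τ _
    right
    rw [show q.1 - zt τ = q.1 from sub_zero _, abs_of_pos (by linarith)]; exact hq.le
  have m1 : AEMeasurable idt := measurable_id.aemeasurable
  have m2 : AEMeasurable zt := measurable_const.aemeasurable
  have hc := pot_cont (half_pos ht) h.int m1 m2 hoff
  refine ⟨hc.2.1, hc.2.2, ?_, pot_xx (half_pos ht) h.int m1 m2 hoff, ?_⟩
  · rw [show IP w t = fun y => Pot HK w idt zt t y from funext fun y => ip_eq ht y]
    exact pot_x (half_pos ht) h.int m1 m2 hoff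
  · refine (pot_t (half_pos ht) h.int m1 m2 hoff).congr_of_eventuallyEq ?_
    filter_upwards [lt_mem_nhds ht] with τ hτ using ip_eq hτ x

theorem ip1_bd {t : ℝ} (ht : 0 < t) (x : ℝ) : |Pot HK1 w idt zt t x| ≤ L := by
  have hl : LipschitzWith ⟨L, h.Lnn⟩ (IP w t) := LipschitzWith.of_dist_le_mul fun a b => ip_lip h t a b
  have := norm_deriv_le_of_lipschitz hl (x₀ := x)
  rw [(ip_reg h ht x).2.2.1.deriv] at this
  exact this

omit h in
theorem HK1_int_z : Integrable (fun z => HK1 z 1) := by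
  have : (fun z => HK1 z 1) = fun z => (-1 / 2 * (1 / (2 * √π))) * (z * Real.exp (-(1/4) * z ^ 2)) := by
    funext z
    rw [show HK1 z 1 = -z / (2 * 1) * Gs z from rfl, Gs_eq]; ring
  rw [this]
  exact (integrable_mul_exp_neg_mul_sq (by norm_num)).const_mul _

def CK : ℝ := ∫ z, |HK1 z 1|

omit h in
theorem CK_nonneg : 0 ≤ CK := integral_nonneg fun _ => abs_nonneg _

theorem ip1_int (t x : ℝ) : Integrable (fun z => w (x - √t * z) * HK1 z 1) := by
  have := h.cont
  refine (HK1_int_z.abs.const_mul (L * σ)).mono' ?_ (Eventually.of_forall fun z => ?_)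
  · exact (Continuous.aestronglyMeasurable (by fun_prop)).mul HK1_int_z.1
  · rw [norm_mul]
    exact mul_le_mul_of_nonneg_right (h.bd _) (abs_nonneg _)

theorem ip1_lip {t : ℝ} (ht : 0 < t) (a b : ℝ) :
    |Pot HK1 w idt zt t a - Pot HK1 w idt zt t b| ≤ L * CK * |a - b| / √t := by
  have h1 : 0 < √t := Real.sqrt_pos.2 ht
  rw [ip1_eq ht, ip1_eq ht, ← sub_div, abs_div, abs_of_pos h1, ← integral_sub (ip1_int h t a) (ip1_int h t b)]
  gcongr
  have := norm_integral_le_of_norm_le (HK1_int_z.abs.const_mul (L * |a - b|))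
    (f := fun z => w (a - √t * z) * HK1 z 1 - w (b - √t * z) * HK1 z 1) (Eventually.of_forall fun z => by
      rw [← sub_mul, norm_mul]
      refine mul_le_mul_of_nonneg_right ((h.lip _ _).trans_eq ?_) (abs_nonneg _)
      congr 2; ring)
  rw [integral_const_mul] at this
  exact this.trans_eq (by unfold CK; ring)

theorem ip1_zero (t : ℝ) : Pot HK1 w idt zt t 0 = 0 := by
  have e := integral_neg_eq_self (fun ξ => w ξ * HK1 (0 - ξ) (t - 0)) volume
  have e2 : ∫ ξ, w (-ξ) * HK1 (0 - -ξ) (t - 0) = -∫ ξ, w ξ * HK1 (0 - ξ) (t - 0) := by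
    rw [← integral_neg]; congr 1; funext ξ
    rw [h.even, show (0:ℝ) - -ξ = -(0 - ξ) by ring, HK1_neg]; ring
  rw [e2] at e
  change ∫ ξ, w ξ * HK1 (0 - ξ) (t - 0) = 0
  linarith

theorem ip1_nonpos {t : ℝ} (ht : 0 < t) : Pot HK1 w idt zt t σ ≤ 0 := by
  have h1 : 0 < √t := Real.sqrt_pos.2 ht
  rw [ip1_eq ht]
  refine div_nonpos_of_nonpos_of_nonneg (integral_nonpos fun z => ?_) h1.le
  change w (σ - √t * z) * HK1 z 1 ≤ 0
  rcases le_total 0 z with hz | hz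
  · refine mul_nonpos_of_nonneg_of_nonpos (h.nonneg _) ?_
    exact mul_nonpos_of_nonpos_of_nonneg (by linarith) (HK_nonneg z 1)
  · rw [h.zero _ (by nlinarith), zero_mul]
end

def qk (l r : ℝ) : ℝ := min r (1 / l) / (r * √r)

theorem qk_nonneg {l r : ℝ} (hl : 0 < l) (hr : 0 ≤ r) : 0 ≤ qk l r := by unfold qk; positivity

theorem qk_int {l : ℝ} (hl : 0 < l) : IntegrableOn (qk l) (Ioi 0) ∧ ∫ r in Ioi 0, qk l r = 4 / √l := by
  have ha : 0 < 1 / l := by positivity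
  obtain ⟨i1, b1⟩ := inv_sqrt_int ha.le
  have i2 := integrableOn_Ioi_rpow_of_lt (show (-3/2 : ℝ) < -1 by norm_num) ha
  have b2 := integral_Ioi_rpow_of_lt (show (-3/2 : ℝ) < -1 by norm_num) ha
  have e1 : EqOn (fun r : ℝ => 1 / √r) (qk l) (Ioo 0 (1 / l)) := by
    intro r hr
    have h1 : 0 < √r := Real.sqrt_pos.2 hr.1
    have := hr.1
    simp only [qk]
    rw [min_eq_left hr.2.le]; field_simp
  have e2 : EqOn (fun r : ℝ => 1 / l * r ^ (-3/2 : ℝ)) (qk l) (Ioi (1 / l)) := by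
    intro r hr
    have hr0 : 0 < r := ha.trans hr
    simp only [qk]
    rw [min_eq_right (le_of_lt hr), show (-3/2 : ℝ) = -(1 + 1/2) by norm_num, Real.rpow_neg hr0.le,
      Real.rpow_add hr0, Real.rpow_one, ← Real.sqrt_eq_rpow, ← div_eq_mul_inv]
  have j1 := i1.congr_fun e1 measurableSet_Ioo
  rw [← integrableOn_Ioc_iff_integrableOn_Ioo] at j1
  have j2 := IntegrableOn.congr_fun (Integrable.const_mul i2 (1 / l)) e2 measurableSet_Ioi
  rw [← Ioc_union_Ioi_eq_Ioi ha.le]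
  refine ⟨j1.union j2, ?_⟩
  rw [setIntegral_union (Ioc_disjoint_Ioi le_rfl) measurableSet_Ioi j1 j2, integral_Ioc_eq_integral_Ioo,
    ← setIntegral_congr_fun measurableSet_Ioo e1, ← setIntegral_congr_fun measurableSet_Ioi e2, b1,
    integral_const_mul, b2, show (-3/2 + 1 : ℝ) = -(1/2) by norm_num, Real.rpow_neg ha.le, ← Real.sqrt_eq_rpow,
    Real.sqrt_div zero_le_one, Real.sqrt_one]
  have : 0 < √l := Real.sqrt_pos.2 hl
  have h2 : l = √l * √l := (Real.mul_self_sqrt hl.le).symm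
  rw [show 1 / l = 1 / (√l * √l) by rw [← h2]]
  field_simp; norm_num

theorem qk_exp {l r : ℝ} (hl : 0 < l) (hr : 0 < r) : Real.exp (-(l * r)) / √r ≤ qk l r := by
  have h1 : 0 < √r := Real.sqrt_pos.2 hr
  unfold qk
  rw [div_mul_eq_div_div]
  gcongr
  rw [le_div_iff₀ hr]
  have hx : 0 < l * r := by positivity
  refine le_min ?_ ?_
  · have : Real.exp (-(l * r)) ≤ 1 := Real.exp_le_one_iff.2 (by linarith)
    nlinarith
  · have := pow_mul_exp_neg_le 1 hx.le
    norm_num at this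
    rw [le_div_iff₀ hl]; linarith

theorem offker {ρ : ℝ} (hρ : 0 < ρ) : ∃ C, 1 ≤ C ∧ ∀ z r, 0 < r → ρ ≤ |z| →
    |HK1 z r| ≤ C / √r ∧ |HK2 z r| ≤ C * (min r 1 / (r * √r)) := by
  obtain ⟨C, hC, hb⟩ := HK_bdd_off hρ
  refine ⟨C + 1, by linarith, fun z r hr hz => ?_⟩
  obtain ⟨-, b1, b2⟩ := hb z r (Or.inl hz)
  have h1 : 0 < √r := Real.sqrt_pos.2 hr
  have h2 : √r * √r = r := Real.mul_self_sqrt hr.le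
  rcases le_total r 1 with h | h
  · have hs : √r ≤ 1 := Real.sqrt_le_one.2 h
    rw [min_eq_left h, ← div_div, div_self hr.ne', mul_one_div]
    constructor <;> rw [le_div_iff₀ h1] <;> nlinarith [abs_nonneg (HK1 z r), abs_nonneg (HK2 z r)]
  · have hs : 1 ≤ √r := Real.one_le_sqrt.2 h
    rw [min_eq_right h]
    refine ⟨(HK1_le hr z).trans ?_, (HK2_le hr z).trans ?_⟩
    · rw [div_le_div_iff₀ hr h1]; nlinarith
    · have : 0 < 1 / (r * √r) := by positivity
      nlinarith

theorem incr {D D' : ℝ → ℝ} {d l : ℝ} (hl : 0 < l) (hd : 0 ≤ d) (hD : Continuous D)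
    (hder : ∀ τ, 0 < τ → HasDerivAt D (D' τ) τ) (hb : ∀ τ, 0 < τ → |D' τ| ≤ d * Real.exp (l * τ))
    {τ t : ℝ} (hτ : 0 ≤ τ) (ht : τ ≤ t) :
    |D t - D τ| ≤ d * Real.exp (l * t) * min (t - τ) (1 / l) := by
  have hE : ∀ y, HasDerivAt (fun y => d / l * Real.exp (l * y)) (d * Real.exp (l * y)) y := by
    intro y
    refine ((((hasDerivAt_id y).const_mul l).exp).const_mul (d / l)).congr_deriv ?_
    simp only [id]; field_simp
  have gen : ∀ F F' : ℝ → ℝ, Continuous F → (∀ τ, 0 < τ → HasDerivAt F (F' τ) τ) →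
      (∀ τ, 0 < τ → F' τ ≤ d * Real.exp (l * τ)) →
      F t - F τ ≤ d / l * Real.exp (l * t) - d / l * Real.exp (l * τ) := by
    intro F F' hF hFd hFb
    have := antitoneOn_of_hasDerivWithinAt_nonpos (convex_Icc 0 t)
      (f := fun y => F y - d / l * Real.exp (l * y)) (f' := fun y => F' y - d * Real.exp (l * y))
      (Continuous.continuousOn (by fun_prop))
      (fun y hy => by
        rw [interior_Icc] at hy
        exact ((hFd y hy.1).sub (hE y)).hasDerivWithinAt)
      (fun y hy => by rw [interior_Icc] at hy; linarith [hFb y hy.1])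
    have := this ⟨hτ, ht⟩ ⟨hτ.trans ht, le_rfl⟩ ht
    simp only at this; linarith
  have g1 := gen D D' hD hder (fun τ h => (le_abs_self _).trans (hb τ h))
  have g2 := gen (fun y => -D y) (fun y => -D' y) hD.neg (fun τ h => (hder τ h).fun_neg)
    (fun τ h => (neg_le_abs _).trans (hb τ h))
  have hmin : Real.exp (l * t) - Real.exp (l * τ) ≤ l * (Real.exp (l * t) * min (t - τ) (1 / l)) := by
    have e1 : Real.exp (l * τ) = Real.exp (l * t) * Real.exp (-(l * (t - τ))) := by
      rw [← Real.exp_add]; congr 1; ring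
    have e2 := Real.add_one_le_exp (-(l * (t - τ)))
    have e3 := Real.exp_pos (-(l * (t - τ)))
    have e4 := Real.exp_pos (l * t)
    rw [e1]
    rcases min_cases (t - τ) (1 / l) with ⟨h, -⟩ | ⟨h, -⟩ <;> rw [h]
    · nlinarith
    · rw [show l * (Real.exp (l * t) * (1 / l)) = Real.exp (l * t) by field_simp]; nlinarith
  have : d / l * Real.exp (l * t) - d / l * Real.exp (l * τ) ≤ d * Real.exp (l * t) * min (t - τ) (1 / l) := by
    calc _ = d / l * (Real.exp (l * t) - Real.exp (l * τ)) := by ring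
      _ ≤ d / l * (l * (Real.exp (l * t) * min (t - τ) (1 / l))) := by gcongr
      _ = _ := by field_simp
  rw [abs_le]; constructor <;> linarith

theorem pot_diff {k : ℝ → ℝ → ℝ} (hk : ∀ r ≤ 0, ∀ z, k z r = 0) {f₁ f₂ c₁ c₂ : ℝ → ℝ} {t x₁ x₂ A l : ℝ}
    (hl : 0 < l) (hA : 0 ≤ A)
    (i₁ : Integrable (fun τ => f₁ τ * k (x₁ - c₁ τ) (t - τ)))
    (i₂ : Integrable (fun τ => f₂ τ * k (x₂ - c₂ τ) (t - τ)))
    (z₁ : ∀ τ ≤ 0, f₁ τ = 0) (z₂ : ∀ τ ≤ 0, f₂ τ = 0)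
    (hb : ∀ τ, 0 < τ → τ < t →
      |f₁ τ * k (x₁ - c₁ τ) (t - τ) - f₂ τ * k (x₂ - c₂ τ) (t - τ)| ≤ A * qk l (t - τ)) :
    |Pot k f₁ c₁ idt t x₁ - Pot k f₂ c₂ idt t x₂| ≤ A * (4 / √l) := by
  obtain ⟨qi, qb⟩ := qk_int hl
  have qi' := ((integrable_indicator_iff measurableSet_Ioi).2 qi).comp_sub_left t
  have := norm_integral_le_of_norm_le (qi'.const_mul A)
    (f := fun τ => f₁ τ * k (x₁ - c₁ τ) (t - τ) - f₂ τ * k (x₂ - c₂ τ) (t - τ))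
    (Eventually.of_forall fun τ => by
      have h0 : 0 ≤ A * (Ioi 0).indicator (qk l) (t - τ) :=
        mul_nonneg hA (indicator_nonneg (fun r hr => qk_nonneg hl (le_of_lt hr)) _)
      rcases le_or_gt τ 0 with h | h
      · rw [z₁ τ h, z₂ τ h]; simpa using h0
      · rcases le_or_gt t τ with h' | h'
        · rw [hk (t - τ) (by linarith), hk (t - τ) (by linarith)]; simpa using h0
        · rw [indicator_of_mem (show t - τ ∈ Ioi 0 from sub_pos.2 h')]
          exact hb τ h h')
  rw [integral_sub i₁ i₂, integral_const_mul, integral_sub_left_eq_self _ volume t,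
    integral_indicator measurableSet_Ioi, qb] at this
  exact this

theorem K1_lip {S : Set ℝ} (hS : Convex ℝ S) {r C : ℝ} (hC : ∀ z ∈ S, |HK2 z r| ≤ C) {a b : ℝ}
    (ha : a ∈ S) (hb : b ∈ S) : |HK1 a r - HK1 b r| ≤ C * |a - b| :=
  hS.norm_image_sub_le_of_norm_hasDerivWithin_le
    (fun z _ => (hasDerivAt_HK1_z' r z).hasDerivWithinAt) hC hb ha

theorem K_lip {S : Set ℝ} (hS : Convex ℝ S) {r C : ℝ} (hC : ∀ z ∈ S, |HK1 z r| ≤ C) {a b : ℝ}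
    (ha : a ∈ S) (hb : b ∈ S) : |HK a r - HK b r| ≤ C * |a - b| :=
  hS.norm_image_sub_le_of_norm_hasDerivWithin_le
    (fun z _ => (hasDerivAt_HK_z' r z).hasDerivWithinAt) hC hb ha

theorem prod_diff {a b k m A K N D : ℝ} (h1 : |a - b| ≤ A) (h2 : |k| ≤ K) (h3 : |b| ≤ N) (h4 : |k - m| ≤ D) :
    |a * k - b * m| ≤ A * K + N * D := by
  calc |a * k - b * m| = |(a - b) * k + b * (k - m)| := by congr 1; ring
    _ ≤ |a - b| * |k| + |b| * |k - m| := by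
      refine (abs_add_le _ _).trans_eq ?_; rw [abs_mul, abs_mul]
    _ ≤ A * K + N * D := by
      have := abs_nonneg (a - b); have := abs_nonneg k; have := abs_nonneg b; have := abs_nonneg (k - m)
      gcongr <;> linarith

structure Dat (γ f s : ℝ → ℝ) (M B ρ : ℝ) : Prop where
  curve : Curve s γ M
  dens : Dens f B
  low : ∀ t, ρ ≤ s t

def ng (s : ℝ → ℝ) : ℝ → ℝ := fun τ => -s τ

def U0 (w γ f s : ℝ → ℝ) (t x : ℝ) : ℝ := IP w t x + 2 * Pot HK f zt idt t x -
  Pot HK γ s idt t x - Pot HK γ (ng s) idt t x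

def U1 (w γ f s : ℝ → ℝ) (t x : ℝ) : ℝ := Pot HK1 w idt zt t x + 2 * Pot HK1 f zt idt t x -
  Pot HK1 γ s idt t x - Pot HK1 γ (ng s) idt t x

theorem zt_dens : Dens zt 0 := ⟨fun _ _ => rfl, fun _ => by simp, fun _ _ => continuousAt_const⟩
theorem zt_curve : Curve zt zt 0 := ⟨zt_dens, fun _ _ => by simp, fun τ _ => hasDerivAt_const τ 0⟩

theorem Curve.neg {c c' : ℝ → ℝ} {M : ℝ} (h : Curve c c' M) : Curve (ng c) (fun τ => -c' τ) M where
  dens := ⟨fun τ hτ => by rw [h.dens.zero τ hτ, neg_zero], fun τ => by rw [abs_neg]; exact h.dens.bdd τ,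
    fun τ hτ => (h.dens.cont τ hτ).neg⟩
  lip a b := by
    have := h.lip a b
    rwa [show ng c a - ng c b = -(c a - c b) by simp [ng]; ring, abs_neg]
  der τ hτ := (h.der τ hτ).fun_neg

theorem contr {w : ℝ → ℝ} {σ L M B ρ : ℝ} (hw : IniD w σ L) (hM : 0 ≤ M) (hB : 0 ≤ B) (hρ : 0 < ρ) :
    ∃ C, 0 ≤ C ∧ ∀ l, 1 ≤ l → ∀ d, 0 ≤ d → ∀ γ₁ f₁ s₁ γ₂ f₂ s₂, Dat γ₁ f₁ s₁ M B ρ → Dat γ₂ f₂ s₂ M B ρ →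
      s₁ 0 = s₂ 0 → (∀ τ, 0 < τ → |γ₁ τ - γ₂ τ| ≤ d * Real.exp (l * τ)) →
      (∀ τ, 0 < τ → |f₁ τ - f₂ τ| ≤ d * Real.exp (l * τ)) → ∀ t, 0 < t →
      |U1 w γ₁ f₁ s₁ t (s₁ t) - U1 w γ₂ f₂ s₂ t (s₂ t)| ≤ C * (d * Real.exp (l * t)) / √l ∧
      |U0 w γ₁ f₁ s₁ t 0 - U0 w γ₂ f₂ s₂ t 0| ≤ C * (d * Real.exp (l * t)) / √l := by
  obtain ⟨C0, hC0, hker⟩ := offker hρ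
  have hCK := CK_nonneg
  have hL := hw.Lnn
  refine ⟨L * CK + 4 * (4 + 2 * (C0 + B * C0) + 2 * M + C0 + 4 * M * C0), by positivity, ?_⟩
  intro l hl d hd γ₁ f₁ s₁ γ₂ f₂ s₂ D₁ D₂ hs0 hγ hf t ht
  have hl0 : 0 < l := by linarith
  set E := d * Real.exp (l * t) with hE
  have hE0 : 0 ≤ E := by positivity
  have hsl : 0 < √l := Real.sqrt_pos.2 hl0
  have hi : ∀ {a b : ℝ}, 0 ≤ a → a ≤ b → |(s₁ b - s₂ b) - (s₁ a - s₂ a)| ≤ d * Real.exp (l * b) * min (b - a) (1 / l) :=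
    fun {a b} ha hab => incr (D := fun y => s₁ y - s₂ y) hl0 hd (D₁.curve.cont.sub D₂.curve.cont)
      (fun τ h => (D₁.curve.der τ h).sub (D₂.curve.der τ h)) hγ ha hab
  have hi0 : ∀ {b : ℝ}, 0 ≤ b → |s₁ b - s₂ b| ≤ d * Real.exp (l * b) * min b (1 / l) := fun {b} hb => by
    have := hi le_rfl hb
    rwa [hs0, sub_self, sub_zero, sub_zero] at this
  have h1l : 1 / l ≤ 1 := by rw [div_le_one hl0]; exact hl
  have hed : ∀ τ, τ < t → ∀ K, 0 ≤ K → d * Real.exp (l * τ) * (K / √(t - τ)) ≤ K * E * qk l (t - τ) := by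
    intro τ hτ K hK
    have h := qk_exp hl0 (sub_pos.2 hτ)
    have e : d * Real.exp (l * τ) = E * Real.exp (-(l * (t - τ))) := by
      rw [hE, mul_assoc, ← Real.exp_add]; congr 2; ring
    calc _ = K * E * (Real.exp (-(l * (t - τ))) / √(t - τ)) := by rw [e]; ring
      _ ≤ _ := by gcongr
  have hq1 : ∀ r, 0 < r → 1 / l * (min r 1 / (r * √r)) ≤ qk l r := by
    intro r hr
    unfold qk
    rw [← mul_div_assoc]
    gcongr
    have : 0 < 1 / l := by positivity
    have := min_le_left r 1; have := min_le_right r 1; have : 0 < min r 1 := by positivity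
    refine le_min ?_ ?_ <;> nlinarith
  have hst : |s₁ t - s₂ t| ≤ E * (1 / l) :=
    (hi0 ht.le).trans (mul_le_mul_of_nonneg_left (min_le_right _ _) hE0)
  have hsτ' : ∀ τ, 0 < τ → |s₁ τ - s₂ τ| ≤ d * Real.exp (l * τ) := fun τ hτ =>
    (hi0 hτ.le).trans (by
      have h1 : min τ (1 / l) ≤ 1 := (min_le_right _ _).trans h1l
      have h2 : 0 ≤ d * Real.exp (l * τ) := by positivity
      nlinarith)
  have hsτ : ∀ τ, 0 < τ → τ < t → |s₁ τ - s₂ τ| ≤ E * (1 / l) := fun τ hτ hτt =>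
    (hi0 hτ.le).trans (by
      refine mul_le_mul ?_ (min_le_right _ _) (by positivity) hE0
      rw [hE]; gcongr)
  have h0 : ∀ r ≤ 0, ∀ z, HK z r = 0 := fun r hr z => HK_of_nonpos hr z
  have h1 : ∀ r ≤ 0, ∀ z, HK1 z r = 0 := fun r hr z => HK1_of_nonpos hr z
  constructor
  · -- gradient part
    have T1 : |Pot HK1 w idt zt t (s₁ t) - Pot HK1 w idt zt t (s₂ t)| ≤ L * CK * E / √l := by
      refine (ip1_lip hw ht _ _).trans ?_
      have hst : 0 < √t := Real.sqrt_pos.2 ht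
      have hm : min t (1 / l) ≤ √t / √l := by
        have e1 : t = √t * √t := (Real.mul_self_sqrt ht.le).symm
        have e2 : l = √l * √l := (Real.mul_self_sqrt hl0.le).symm
        rcases le_total (√t * √l) 1 with h | h
        · refine (min_le_left _ _).trans ?_
          rw [le_div_iff₀ hsl]; nlinarith
        · refine (min_le_right _ _).trans ?_
          rw [div_le_div_iff₀ hl0 hsl]; nlinarith
      have h2 := (hi0 ht.le).trans (mul_le_mul_of_nonneg_left hm hE0)
      calc L * CK * |s₁ t - s₂ t| / √t ≤ L * CK * (E * (√t / √l)) / √t := by gcongr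
        _ = _ := by field_simp
    have T2 : |Pot HK1 f₁ zt idt t (s₁ t) - Pot HK1 f₂ zt idt t (s₂ t)| ≤ ((C0 + B * C0) * E) * (4 / √l) := by
      refine pot_diff h1 hl0 (by positivity) (dl_int D₁.dens zt_curve _ _) (dl_int D₂.dens zt_curve _ _)
        D₁.dens.zero D₂.dens.zero (fun τ hτ hτt => ?_)
      have hr := sub_pos.2 hτt
      simp only [zt, sub_zero]
      have hk := hker (s₁ t) _ hr ((D₁.low t).trans (le_abs_self _))
      have hlp := K1_lip (convex_Ici ρ) (fun z hz => (hker z _ hr (le_trans hz (le_abs_self z))).2)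
        (D₁.low t) (D₂.low t)
      refine (prod_diff (hf τ hτ) hk.1 (D₂.dens.bdd τ) hlp).trans ?_
      have a1 := hed τ hτt C0 (by linarith)
      have a2 := hq1 _ hr
      calc _ ≤ C0 * E * qk l (t - τ) + B * (C0 * (min (t - τ) 1 / ((t - τ) * √(t - τ))) * (E * (1 / l))) := by
            gcongr
        _ = C0 * E * qk l (t - τ) + B * C0 * E * (1 / l * (min (t - τ) 1 / ((t - τ) * √(t - τ)))) := by ring
        _ ≤ C0 * E * qk l (t - τ) + B * C0 * E * qk l (t - τ) := by gcongr
        _ = _ := by ring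
    have T3 : |Pot HK1 γ₁ s₁ idt t (s₁ t) - Pot HK1 γ₂ s₂ idt t (s₂ t)| ≤ ((2 * M) * E) * (4 / √l) := by
      refine pot_diff h1 hl0 (by positivity) (dl_int D₁.curve.dens D₁.curve _ _)
        (dl_int D₂.curve.dens D₂.curve _ _) D₁.curve.dens.zero D₂.curve.dens.zero (fun τ hτ hτt => ?_)
      have hr := sub_pos.2 hτt
      have hk : |HK1 (s₁ t - s₁ τ) (t - τ)| ≤ M / √(t - τ) := by
        have b1 := D₁.curve.lip t τ
        rw [abs_of_pos hr] at b1
        have b2 := HK_le hr (s₁ t - s₁ τ)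
        unfold HK1
        rw [abs_mul, abs_div, abs_neg, abs_of_pos (show 0 < 2 * (t - τ) by linarith)]
        have b3 : |s₁ t - s₁ τ| / (2 * (t - τ)) ≤ M := by
          rw [div_le_iff₀ (by linarith)]; nlinarith
        calc _ ≤ M * (1 / √(t - τ)) := by gcongr
          _ = _ := by ring
      have hlp := K1_lip convex_univ (fun z _ => HK2_le hr z) (mem_univ (s₁ t - s₁ τ)) (mem_univ (s₂ t - s₂ τ))
      refine (prod_diff (hγ τ hτ) hk (D₂.curve.dens.bdd τ) hlp).trans ?_
      have a1 := hed τ hτt M hM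
      have a3 : |(s₁ t - s₁ τ) - (s₂ t - s₂ τ)| ≤ E * min (t - τ) (1 / l) := by
        have := hi hτ.le hτt.le
        rwa [show s₁ t - s₂ t - (s₁ τ - s₂ τ) = (s₁ t - s₁ τ) - (s₂ t - s₂ τ) by ring] at this
      calc _ ≤ M * E * qk l (t - τ) + M * (1 / ((t - τ) * √(t - τ)) * (E * min (t - τ) (1 / l))) := by
            gcongr
        _ = _ := by unfold qk; ring
    have T4 : |Pot HK1 γ₁ (ng s₁) idt t (s₁ t) - Pot HK1 γ₂ (ng s₂) idt t (s₂ t)| ≤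
        ((C0 + 2 * M * C0) * E) * (4 / √l) := by
      refine pot_diff h1 hl0 (by positivity) (dl_int D₁.curve.dens D₁.curve.neg _ _)
        (dl_int D₂.curve.dens D₂.curve.neg _ _) D₁.curve.dens.zero D₂.curve.dens.zero (fun τ hτ hτt => ?_)
      have hr := sub_pos.2 hτt
      have m1 : ρ ≤ s₁ t - ng s₁ τ := by
        have := D₁.low t; have := D₁.low τ; simp only [ng]; linarith
      have m2 : ρ ≤ s₂ t - ng s₂ τ := by
        have := D₂.low t; have := D₂.low τ; simp only [ng]; linarith
      have hk := hker _ _ hr (m1.trans (le_abs_self _))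
      have hlp := K1_lip (convex_Ici ρ) (fun z hz => (hker z _ hr (le_trans hz (le_abs_self z))).2) m1 m2
      refine (prod_diff (hγ τ hτ) hk.1 (D₂.curve.dens.bdd τ) hlp).trans ?_
      have a1 := hed τ hτt C0 (by linarith)
      have a2 := hq1 _ hr
      have a3 : |(s₁ t - ng s₁ τ) - (s₂ t - ng s₂ τ)| ≤ 2 * (E * (1 / l)) := by
        rw [show (s₁ t - ng s₁ τ) - (s₂ t - ng s₂ τ) = (s₁ t - s₂ t) + (s₁ τ - s₂ τ) by simp [ng]; ring]
        refine (abs_add_le _ _).trans ?_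
        linarith [hsτ τ hτ hτt]
      calc _ ≤ C0 * E * qk l (t - τ) + M * (C0 * (min (t - τ) 1 / ((t - τ) * √(t - τ))) * (2 * (E * (1 / l)))) := by
            gcongr
        _ = C0 * E * qk l (t - τ) + 2 * M * C0 * E * (1 / l * (min (t - τ) 1 / ((t - τ) * √(t - τ)))) := by ring
        _ ≤ C0 * E * qk l (t - τ) + 2 * M * C0 * E * qk l (t - τ) := by gcongr
        _ = _ := by ring
    unfold U1
    have fin : L * CK * E / √l + 2 * (((C0 + B * C0) * E) * (4 / √l)) + ((2 * M) * E) * (4 / √l) +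
        ((C0 + 2 * M * C0) * E) * (4 / √l) ≤
        (L * CK + 4 * (4 + 2 * (C0 + B * C0) + 2 * M + C0 + 4 * M * C0)) * E / √l := by
      have : 0 ≤ (4 * (4 + 2 * M * C0)) * E / √l := by positivity
      refine le_of_sub_nonneg (this.trans_eq ?_)
      ring
    refine le_trans ?_ fin
    rw [abs_le] at *
    constructor <;> linarith [T1.1, T1.2, T2.1, T2.2, T3.1, T3.2, T4.1, T4.2]
  · have T2 : |Pot HK f₁ zt idt t 0 - Pot HK f₂ zt idt t 0| ≤ (1 * E) * (4 / √l) := by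
      refine pot_diff h0 hl0 (by positivity) (sl_int D₁.dens continuous_const _ _)
        (sl_int D₂.dens continuous_const _ _) D₁.dens.zero D₂.dens.zero (fun τ hτ hτt => ?_)
      have hr := sub_pos.2 hτt
      rw [← sub_mul, abs_mul]
      refine le_trans ?_ (hed τ hτt 1 zero_le_one)
      exact mul_le_mul (hf τ hτ) (HK_le hr _) (abs_nonneg _) (by positivity)
    have gen : ∀ S : Set ℝ, Convex ℝ S → (∀ z ∈ S, ρ ≤ |z|) → ∀ c₁ c₂ : ℝ → ℝ, Continuous c₁ → Continuous c₂ →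
        (∀ τ, 0 - c₁ τ ∈ S) → (∀ τ, 0 - c₂ τ ∈ S) → (∀ τ, |c₁ τ - c₂ τ| = |s₁ τ - s₂ τ|) →
        |Pot HK γ₁ c₁ idt t 0 - Pot HK γ₂ c₂ idt t 0| ≤ ((1 + M * C0) * E) * (4 / √l) := by
      intro S hS hSρ c₁ c₂ k₁ k₂ m₁ m₂ hc
      refine pot_diff h0 hl0 (by positivity) (sl_int D₁.curve.dens k₁ _ _)
        (sl_int D₂.curve.dens k₂ _ _) D₁.curve.dens.zero D₂.curve.dens.zero (fun τ hτ hτt => ?_)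
      have hr := sub_pos.2 hτt
      have hlp := K_lip hS (fun z hz => (hker z _ hr (hSρ z hz)).1) (m₁ τ) (m₂ τ)
      refine (prod_diff (hγ τ hτ) (HK_le hr _) (D₂.curve.dens.bdd τ) hlp).trans ?_
      rw [show 0 - c₁ τ - (0 - c₂ τ) = -(c₁ τ - c₂ τ) by ring, abs_neg, hc]
      have a1 := hed τ hτt 1 zero_le_one
      have a2 := hed τ hτt C0 (by linarith)
      have a3 := hsτ' τ hτ
      calc _ ≤ 1 * E * qk l (t - τ) + M * (C0 / √(t - τ) * (d * Real.exp (l * τ))) := by gcongr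
        _ ≤ 1 * E * qk l (t - τ) + M * (C0 * E * qk l (t - τ)) := by
            rw [mul_comm (C0 / √(t - τ))]; gcongr
        _ = _ := by ring
    have T3 := gen (Iic (-ρ)) (convex_Iic _) (fun z hz => by
        have := neg_le_abs z; have h : z ≤ -ρ := hz; linarith) s₁ s₂ D₁.curve.cont D₂.curve.cont
      (fun τ => by have := D₁.low τ; simp; linarith) (fun τ => by have := D₂.low τ; simp; linarith) (fun τ => rfl)
    have T4 := gen (Ici ρ) (convex_Ici _) (fun z hz => le_trans hz (le_abs_self z)) (ng s₁) (ng s₂)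
      D₁.curve.neg.cont D₂.curve.neg.cont
      (fun τ => by have := D₁.low τ; simp [ng]; linarith) (fun τ => by have := D₂.low τ; simp [ng]; linarith)
      (fun τ => by rw [← abs_neg]; congr 1; simp [ng]; ring)
    unfold U0
    have fin : 2 * ((1 * E) * (4 / √l)) + ((1 + M * C0) * E) * (4 / √l) + ((1 + M * C0) * E) * (4 / √l) ≤
        (L * CK + 4 * (4 + 2 * (C0 + B * C0) + 2 * M + C0 + 4 * M * C0)) * E / √l := by
      have : 0 ≤ (L * CK + 4 * (2 * (C0 + B * C0) + 2 * M + C0 + 2 * M * C0)) * E / √l := by positivity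
      refine le_of_sub_nonneg (this.trans_eq ?_)
      ring
    refine le_trans ?_ fin
    rw [abs_le] at *
    constructor <;> linarith [T2.1, T2.2, T3.1, T3.2, T4.1, T4.2]

theorem fp_abstract (Φ : (ℝ → ℝ × ℝ) → ℝ → ℝ × ℝ) (l C : ℝ)
    (h1 : ∀ w, ContinuousOn w (Ioi 0) → ContinuousOn (Φ w) (Ioi 0))
    (h0 : ∀ t, 0 < t → ‖Φ (fun _ => 0) t‖ ≤ C * Real.exp (l * t))
    (h2 : ∀ w₁ w₂, ContinuousOn w₁ (Ioi 0) → ContinuousOn w₂ (Ioi 0) → ∀ d, 0 ≤ d →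
      (∀ t, 0 < t → ‖w₁ t - w₂ t‖ ≤ d * Real.exp (l * t)) →
      ∀ t, 0 < t → ‖Φ w₁ t - Φ w₂ t‖ ≤ 1/2 * d * Real.exp (l * t)) :
    ∃ w, ContinuousOn w (Ioi 0) ∧ ∀ t, 0 < t → w t = Φ w t := by
  classical
  let X := BoundedContinuousFunction (Ioi (0:ℝ)) (ℝ × ℝ)
  let W : X → ℝ → ℝ × ℝ := fun φ t => if h : 0 < t then Real.exp (l * t) • φ ⟨t, h⟩ else 0
  have hW : ∀ φ : X, ∀ t (h : 0 < t), W φ t = Real.exp (l * t) • φ ⟨t, h⟩ := fun φ t h => dif_pos h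
  have hWc : ∀ φ : X, ContinuousOn (W φ) (Ioi 0) := by
    intro φ
    rw [continuousOn_iff_continuous_domRestrict]
    have : (Ioi (0:ℝ)).domRestrict (W φ) = fun t : Ioi (0:ℝ) => Real.exp (l * (t:ℝ)) • φ t := by
      funext t; exact hW φ t t.2
    rw [this]; fun_prop
  have hWd : ∀ φ ψ : X, ∀ t, 0 < t → ‖W φ t - W ψ t‖ ≤ dist φ ψ * Real.exp (l * t) := by
    intro φ ψ t ht
    rw [hW φ t ht, hW ψ t ht, ← smul_sub, norm_smul, Real.norm_of_nonneg (Real.exp_pos _).le, mul_comm]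
    gcongr
    rw [← dist_eq_norm]; exact BoundedContinuousFunction.dist_coe_le_dist _
  have hcan : ∀ t : ℝ, Real.exp (-(l * t)) * Real.exp (l * t) = 1 := fun t => by
    rw [← Real.exp_add]; simp
  let T : X → X := fun φ => BoundedContinuousFunction.ofNormedAddCommGroup
    (fun t : Ioi (0:ℝ) => Real.exp (-(l * t)) • Φ (W φ) t)
    (by
      have := continuousOn_iff_continuous_domRestrict.1 (h1 _ (hWc φ))
      have h3 : Continuous fun t : Ioi (0:ℝ) => Φ (W φ) t := this
      have h4 : Continuous fun t : Ioi (0:ℝ) => Real.exp (-(l * (t:ℝ))) := by fun_prop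
      exact h4.smul h3) (C + 1/2 * dist φ 0) (by
      rintro ⟨t, ht⟩
      have ht' : 0 < t := ht
      have e1 := h2 _ _ (hWc φ) (hWc 0) _ dist_nonneg (hWd φ 0) t ht'
      have e2 : W 0 = fun _ => 0 := by
        funext t; by_cases h : 0 < t
        · rw [hW 0 t h]; exact smul_zero _
        · simp [W, h]
      rw [e2] at e1
      have e3 := h0 t ht'
      rw [norm_smul, Real.norm_of_nonneg (Real.exp_pos _).le]
      have e4 : ‖Φ (W φ) t‖ ≤ (C + 1/2 * dist φ 0) * Real.exp (l * t) := by
        have := norm_add_le (Φ (W φ) t - Φ (fun _ => 0) t) (Φ (fun _ => 0) t)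
        rw [sub_add_cancel] at this; linarith
      calc Real.exp (-(l * t)) * ‖Φ (W φ) t‖ ≤ Real.exp (-(l * t)) * ((C + 1/2 * dist φ 0) * Real.exp (l * t)) := by
            gcongr
        _ = (C + 1/2 * dist φ 0) * (Real.exp (-(l * t)) * Real.exp (l * t)) := by ring
        _ = _ := by rw [hcan, mul_one])
  have hT : ∀ φ (t : Ioi (0:ℝ)), T φ t = Real.exp (-(l * t)) • Φ (W φ) t := fun φ t => rfl
  have hcontr : ContractingWith (1/2) T := by
    refine ⟨by rw [div_lt_one] <;> norm_num, LipschitzWith.of_dist_le_mul fun φ ψ => ?_⟩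
    rw [BoundedContinuousFunction.dist_le (by positivity)]
    rintro ⟨t, ht⟩
    have e1 := h2 _ _ (hWc φ) (hWc ψ) _ dist_nonneg (hWd φ ψ) t ht
    rw [hT, hT, dist_eq_norm, ← smul_sub, norm_smul, Real.norm_of_nonneg (Real.exp_pos _).le]
    calc _ ≤ Real.exp (-(l * t)) * (1/2 * dist φ ψ * Real.exp (l * t)) := by gcongr
      _ = 1/2 * dist φ ψ * (Real.exp (-(l * t)) * Real.exp (l * t)) := by ring
      _ = _ := by rw [hcan, mul_one]; simp
  have hfix := hcontr.fixedPoint_isFixedPt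
  set φ := ContractingWith.fixedPoint T hcontr
  refine ⟨W φ, hWc φ, fun t ht => ?_⟩
  have h := hT φ ⟨t, ht⟩
  rw [hfix.eq] at h
  rw [hW φ t ht, h, smul_smul, mul_comm, hcan, one_smul]

def gam (σ M : ℝ) (g : ℝ → ℝ) (τ : ℝ) : ℝ := if 0 < τ then max (-(σ / 2 * Real.exp (-τ))) (min (g τ) M) else 0
def Ftr (p H y : ℝ) : ℝ := (max 0 (min y H)) ^ p
def ff (p H : ℝ) (h : ℝ → ℝ) (τ : ℝ) : ℝ := if 0 < τ then Ftr p H (h τ) else 0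
def fs (σ : ℝ) (γ : ℝ → ℝ) (t : ℝ) : ℝ := σ + ∫ τ in (0:ℝ)..t, γ τ

theorem clip_lip (a b x y : ℝ) : |max a (min x b) - max a (min y b)| ≤ |x - y| := by
  have h1 := abs_max_sub_max_le_abs (min x b) (min y b) a
  rw [max_comm a, max_comm a]
  refine h1.trans ?_
  have := abs_min_sub_min_le_max x b y b
  simpa using this

theorem Ftr_lip {p H : ℝ} (hp : 1 < p) (hH : 0 ≤ H) (x y : ℝ) :
    |Ftr p H x - Ftr p H y| ≤ p * H ^ (p - 1) * |x - y| := by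
  have hm : ∀ y, max 0 (min y H) ∈ Icc 0 H := fun y => ⟨le_max_left _ _, max_le hH (min_le_right _ _)⟩
  have := (convex_Icc (0:ℝ) H).norm_image_sub_le_of_norm_hasDerivWithin_le (f := fun z => z ^ p)
    (C := p * H ^ (p - 1))
    (fun z _ => (Real.hasDerivAt_rpow_const (Or.inr hp.le)).hasDerivWithinAt)
    (fun z hz => by
      have := Real.rpow_nonneg hz.1 (p - 1)
      rw [Real.norm_of_nonneg (by positivity)]
      have := Real.rpow_le_rpow hz.1 hz.2 (show 0 ≤ p - 1 by linarith)
      gcongr) (hm y) (hm x)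
  refine this.trans ?_
  have h2 := Real.rpow_nonneg hH (p - 1)
  have := clip_lip 0 H x y
  gcongr
  exact this

theorem Ftr_bd {p H : ℝ} (hp : 1 < p) (hH : 0 ≤ H) (y : ℝ) : 0 ≤ Ftr p H y ∧ Ftr p H y ≤ H ^ p :=
  ⟨Real.rpow_nonneg (le_max_left _ _) _,
    Real.rpow_le_rpow (le_max_left _ _) (max_le hH (min_le_right _ _)) (by linarith)⟩

theorem gam_dens {σ M : ℝ} (hσ : 0 < σ) (hM : σ / 2 ≤ M) {g : ℝ → ℝ} (hg : ContinuousOn g (Ioi 0)) :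
    Dens (gam σ M g) M := by
  refine ⟨fun τ h => if_neg (not_lt.2 h), fun τ => ?_, fun τ h => ?_⟩
  · unfold gam; split_ifs with h
    · have e1 : Real.exp (-τ) ≤ 1 := Real.exp_le_one_iff.2 (by linarith)
      have e2 := Real.exp_pos (-τ)
      rw [abs_le]
      refine ⟨le_trans ?_ (le_max_left _ _), max_le (by nlinarith) (min_le_right _ _)⟩
      nlinarith
    · simp; linarith
  · have hg' : ContinuousAt g τ := hg.continuousAt (Ioi_mem_nhds h)
    have : ContinuousAt (fun τ => max (-(σ / 2 * Real.exp (-τ))) (min (g τ) M)) τ := by fun_prop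
    refine this.congr ?_
    filter_upwards [lt_mem_nhds h] with y hy
    exact (if_pos hy).symm

theorem ff_dens {p H : ℝ} (hp : 1 < p) (hH : 0 ≤ H) {g : ℝ → ℝ} (hg : ContinuousOn g (Ioi 0)) :
    Dens (ff p H g) (H ^ p) := by
  refine ⟨fun τ h => if_neg (not_lt.2 h), fun τ => ?_, fun τ h => ?_⟩
  · unfold ff; split_ifs with h
    · have := Ftr_bd hp hH (g τ)
      rw [abs_of_nonneg this.1]; exact this.2
    · simpa using Real.rpow_nonneg hH p
  · have hg' : ContinuousAt g τ := hg.continuousAt (Ioi_mem_nhds h)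
    have : ContinuousAt (fun τ => Ftr p H (g τ)) τ := by
      unfold Ftr
      exact ContinuousAt.rpow_const (by fun_prop) (Or.inr (by linarith))
    refine this.congr ?_
    filter_upwards [lt_mem_nhds h] with y hy
    exact (if_pos hy).symm

theorem Dens.ii {f : ℝ → ℝ} {B : ℝ} (h : Dens f B) (a b : ℝ) : IntervalIntegrable f volume a b := by
  rw [intervalIntegrable_iff]
  exact Measure.integrableOn_of_bounded (M := B) (by simp) h.meas (Eventually.of_forall h.bdd)

theorem fs_curve {σ M : ℝ} {γ : ℝ → ℝ} (hγ : Dens γ M) : Curve (fs σ γ) γ M := by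
  refine ⟨hγ, fun a b => ?_, fun τ hτ => ?_⟩
  · unfold fs
    rw [add_sub_add_left_eq_sub, intervalIntegral.integral_interval_sub_left (hγ.ii _ _) (hγ.ii _ _)]
    have := intervalIntegral.norm_integral_le_of_norm_le_const (f := γ) (C := M) (a := b) (b := a) (fun x _ => hγ.bdd x)
    exact this
  · exact (intervalIntegral.integral_hasDerivAt_right (hγ.ii _ _)
      hγ.meas.stronglyMeasurableAtFilter (hγ.cont τ hτ)).const_add σ

theorem gam_ge {σ M : ℝ} {g : ℝ → ℝ} {τ : ℝ} (hτ : 0 < τ) : -(σ / 2 * Real.exp (-τ)) ≤ gam σ M g τ := by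
  unfold gam; rw [if_pos hτ]; exact le_max_left _ _

theorem fs_neg {σ M : ℝ} {γ : ℝ → ℝ} (hγ : Dens γ M) {t : ℝ} (ht : t ≤ 0) : fs σ γ t = σ := by
  unfold fs
  rw [intervalIntegral.integral_symm, intervalIntegral.integral_of_le ht,
    setIntegral_congr_fun (g := fun _ => 0) measurableSet_Ioc (fun τ hτ => hγ.zero τ hτ.2)]
  simp

theorem fs_low {σ M : ℝ} (hσ : 0 < σ) (hM : σ / 2 ≤ M) {g : ℝ → ℝ} (hg : ContinuousOn g (Ioi 0)) (t : ℝ) :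
    σ / 2 ≤ fs σ (gam σ M g) t := by
  have hd := gam_dens hσ hM hg
  have hc := fs_curve (σ := σ) hd
  have hcc := hc.cont
  rcases le_total t 0 with h | h
  · rw [fs_neg hd h]; linarith
  · have := monotoneOn_of_hasDerivWithinAt_nonneg (convex_Ici (0:ℝ))
      (f := fun t => fs σ (gam σ M g) t - σ / 2 * Real.exp (-t))
      (f' := fun t => gam σ M g t - σ / 2 * (Real.exp (-t) * -1))
      (Continuous.continuousOn (by fun_prop))
      (fun τ hτ => by
        rw [interior_Ici] at hτ
        exact ((hc.der τ hτ).sub (((hasDerivAt_neg τ).exp).const_mul _)).hasDerivWithinAt)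
      (fun τ hτ => by
        rw [interior_Ici] at hτ
        have := gam_ge (σ := σ) (M := M) (g := g) hτ; linarith)
    have h2 := this (mem_Ici.2 le_rfl) h h
    simp only [fs_neg hd le_rfl, neg_zero, Real.exp_zero] at h2
    have := Real.exp_pos (-t)
    nlinarith

def Qf (w γ f s : ℝ → ℝ) (t x : ℝ) : ℝ := U1 w γ f s t x + Real.sign (x - zt t) * f t
  - 1/2 * Real.sign (x - s t) * γ t - 1/2 * Real.sign (x - ng s t) * γ t

theorem Q_cont {w γ f s : ℝ → ℝ} {σ L M B ρ : ℝ} (hw : IniD w σ L) (hD : Dat γ f s M B ρ) {t : ℝ} (ht : 0 < t)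
    (x : ℝ) : ContinuousAt (fun q : ℝ × ℝ => Qf w γ f s q.1 q.2) (t, x) := by
  have h1 := (ip_reg hw ht x).1
  have h2 := J_cont hD.dens zt_curve ht x
  have h3 := J_cont hD.curve.dens hD.curve ht x
  have h4 := J_cont hD.curve.dens hD.curve.neg ht x
  refine (((h1.add (h2.const_mul 2)).sub h3).sub h4).congr (Eventually.of_forall fun q => ?_)
  simp only [Qf, U1, Pi.sub_apply, Pi.add_apply]; ring

theorem U0_cont {w γ f s : ℝ → ℝ} {σ L M B ρ : ℝ} (hw : IniD w σ L) (hD : Dat γ f s M B ρ) :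
    Continuous (fun q : ℝ × ℝ => U0 w γ f s q.1 q.2) :=
  (((ip_cont hw).add ((sl_cont hD.dens continuous_const).const_mul 2)).sub
    (sl_cont hD.curve.dens hD.curve.cont)).sub (sl_cont hD.curve.dens hD.curve.neg.cont)

theorem U1_s {w γ f s : ℝ → ℝ} {M B ρ : ℝ} (hρ : 0 < ρ) (hD : Dat γ f s M B ρ) (t : ℝ) :
    U1 w γ f s t (s t) = Qf w γ f s t (s t) - f t + 1/2 * γ t := by
  have := hD.low t
  unfold Qf ng zt
  rw [sub_self, Real.sign_zero, Real.sign_of_pos (by linarith), Real.sign_of_pos (by linarith)]; ring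

structure FixD (p H : ℝ) (w γ f s g : ℝ → ℝ) (σ L M : ℝ) : Prop where
  ini : IniD w σ L
  dat : Dat γ f s M (H ^ p) (σ / 2)
  s0 : ∀ t ≤ 0, s t = σ
  gam : ∀ t, 0 < t → γ t = max (-(σ / 2 * Real.exp (-t))) (min (g t) M)
  ff : ∀ t, 0 < t → f t = Ftr p H (U0 w γ f s t 0)
  gg : ∀ t, 0 < t → g t = -2 * U1 w γ f s t (s t)
  gcont : ContinuousOn g (Ioi 0)

theorem fix_exists {p H : ℝ} {w : ℝ → ℝ} {σ L M : ℝ} (hw : IniD w σ L) (hM : σ / 2 ≤ M) (hH : 0 ≤ H) (hp : 1 < p) :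
    ∃ γ f s g, FixD p H w γ f s g σ L M := by
  have hσ := hw.pos
  have hM0 : 0 ≤ M := by linarith
  obtain ⟨C, hC, hcon⟩ := contr hw hM0 (Real.rpow_nonneg hH p) (half_pos hσ)
  set LF := p * H ^ (p - 1) with hLF
  have hLF0 : 0 ≤ LF := by have := Real.rpow_nonneg hH (p - 1); positivity
  set K := 4 * C * (1 + LF) with hK
  have hK0 : 0 ≤ K := by positivity
  set l := (1 + K) ^ 2 with hl
  have hl1 : 1 ≤ l := by rw [hl]; nlinarith
  have hsl : √l = 1 + K := Real.sqrt_sq (by linarith)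
  let Γ : (ℝ → ℝ × ℝ) → ℝ → ℝ := fun v => gam σ M fun t => (v t).1
  let Fv : (ℝ → ℝ × ℝ) → ℝ → ℝ := fun v => ff p H fun t => (v t).2
  let Φ : (ℝ → ℝ × ℝ) → ℝ → ℝ × ℝ := fun v t =>
    (-2 * U1 w (Γ v) (Fv v) (fs σ (Γ v)) t (fs σ (Γ v) t), U0 w (Γ v) (Fv v) (fs σ (Γ v)) t 0)
  have c1 : ∀ v : ℝ → ℝ × ℝ, ContinuousOn v (Ioi 0) → ContinuousOn (fun t => (v t).1) (Ioi 0) := fun v hv =>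
    continuous_fst.comp_continuousOn hv
  have c2 : ∀ v : ℝ → ℝ × ℝ, ContinuousOn v (Ioi 0) → ContinuousOn (fun t => (v t).2) (Ioi 0) := fun v hv =>
    continuous_snd.comp_continuousOn hv
  have hdat : ∀ v, ContinuousOn v (Ioi 0) → Dat (Γ v) (Fv v) (fs σ (Γ v)) M (H ^ p) (σ / 2) := fun v hv =>
    ⟨fs_curve (gam_dens hσ hM (c1 v hv)), ff_dens hp hH (c2 v hv), fs_low hσ hM (c1 v hv)⟩
  have h1 : ∀ v, ContinuousOn v (Ioi 0) → ContinuousOn (Φ v) (Ioi 0) := by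
    intro v hv t ht
    have hD := hdat v hv
    have ht' : 0 < t := ht
    have hcc := hD.curve.cont
    refine (ContinuousAt.prodMk ?_ ?_).continuousWithinAt
    · simp only [U1_s (half_pos hσ) hD]
      have q1 : ContinuousAt (fun t => Qf w (Γ v) (Fv v) (fs σ (Γ v)) t (fs σ (Γ v) t)) t :=
        ContinuousAt.comp (f := fun t => (t, fs σ (Γ v) t)) (Q_cont hw hD ht' (fs σ (Γ v) t)) (by fun_prop)
      exact ((q1.sub (hD.dens.cont t ht')).add ((hD.curve.dens.cont t ht').const_mul _)).const_mul _
    · exact ContinuousAt.comp (f := fun t => (t, (0:ℝ))) (U0_cont hw hD).continuousAt (by fun_prop)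
  have h2 : ∀ w₁ w₂, ContinuousOn w₁ (Ioi 0) → ContinuousOn w₂ (Ioi 0) → ∀ d, 0 ≤ d →
      (∀ t, 0 < t → ‖w₁ t - w₂ t‖ ≤ d * Real.exp (l * t)) →
      ∀ t, 0 < t → ‖Φ w₁ t - Φ w₂ t‖ ≤ 1/2 * d * Real.exp (l * t) := by
    intro v₁ v₂ hv₁ hv₂ d hd hdist t ht
    have D₁ := hdat v₁ hv₁
    have D₂ := hdat v₂ hv₂
    have hb1 : ∀ τ, 0 < τ → |(v₁ τ).1 - (v₂ τ).1| ≤ d * Real.exp (l * τ) := fun τ hτ =>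
      (norm_fst_le (v₁ τ - v₂ τ)).trans (hdist τ hτ)
    have hb2 : ∀ τ, 0 < τ → |(v₁ τ).2 - (v₂ τ).2| ≤ d * Real.exp (l * τ) := fun τ hτ =>
      (norm_snd_le (v₁ τ - v₂ τ)).trans (hdist τ hτ)
    obtain ⟨r1, r2⟩ := hcon l hl1 ((1 + LF) * d) (by positivity) _ _ _ _ _ _ D₁ D₂
      (by rw [fs_neg D₁.curve.dens le_rfl, fs_neg D₂.curve.dens le_rfl])
      (fun τ hτ => by
        simp only [Γ, gam, if_pos hτ]
        refine ((clip_lip _ _ _ _).trans (hb1 τ hτ)).trans ?_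
        have : 0 ≤ d * Real.exp (l * τ) := by positivity
        nlinarith)
      (fun τ hτ => by
        simp only [Fv, ff, if_pos hτ]
        refine (Ftr_lip hp hH _ _).trans ?_
        have h3 := hb2 τ hτ
        have : 0 ≤ d * Real.exp (l * τ) := by positivity
        rw [← hLF]
        nlinarith) t ht
    have hfin : 2 * (C * ((1 + LF) * d * Real.exp (l * t)) / √l) ≤ 1/2 * d * Real.exp (l * t) := by
      rw [hsl, ← mul_div_assoc, div_le_iff₀ (by linarith)]
      have : 0 ≤ d * Real.exp (l * t) := by positivity
      calc _ = 1/2 * K * (d * Real.exp (l * t)) := by rw [hK]; ring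
        _ ≤ _ := by nlinarith
    have hnn : 0 ≤ C * ((1 + LF) * d * Real.exp (l * t)) / √l := by positivity
    refine max_le ?_ ?_
    · change |(-2 * _) - (-2 * _)| ≤ _
      rw [← mul_sub, abs_mul]
      norm_num
      linarith
    · change |_ - _| ≤ _
      linarith
  have z1 : Γ (fun _ => 0) = zt := by
    funext t
    simp only [Γ, gam]
    split_ifs with h
    · have := Real.exp_pos (-t)
      rw [min_eq_left (by simpa using hM0)]
      exact max_eq_right (by simp; positivity)
    · rfl
  have z2 : Fv (fun _ => 0) = zt := by
    funext t
    simp only [Fv, ff, Ftr]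
    split_ifs with h
    · have : max 0 (min (0:ℝ × ℝ).2 H) = 0 := by simp
      rw [this, Real.zero_rpow (by linarith)]
    · rfl
  have h0 : ∀ t, 0 < t → ‖Φ (fun _ => 0) t‖ ≤ (2 * L + L * σ) * Real.exp (l * t) := by
    intro t ht
    have e1 : ∀ k c, Pot k zt c idt = fun _ _ => 0 := by intro k c; funext t x; simp [Pot]
    have hL := hw.Lnn
    have hge : 1 ≤ Real.exp (l * t) := Real.one_le_exp (by positivity)
    have hb : ‖Φ (fun _ => 0) t‖ ≤ 2 * L + L * σ := by
      simp only [Φ, z1, z2, U1, U0, e1]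
      refine max_le ?_ ?_
      · have := ip1_bd hw ht (fs σ zt t)
        simp only [mul_zero, add_zero, sub_zero, norm_mul, Real.norm_eq_abs]
        norm_num
        nlinarith
      · have := ip_bd hw t 0
        simp only [mul_zero, add_zero, sub_zero, Real.norm_eq_abs]; linarith
    have : 0 ≤ 2 * L + L * σ := by positivity
    nlinarith
  obtain ⟨v, hv, hfix⟩ := fp_abstract Φ l _ h1 h0 h2
  have hD := hdat v hv
  refine ⟨Γ v, Fv v, fs σ (Γ v), fun t => (v t).1, hw, hD, fun t ht => fs_neg hD.curve.dens ht,
    fun t ht => if_pos ht, fun t ht => ?_, fun t ht => congrArg Prod.fst (hfix t ht), c1 v hv⟩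
  rw [show U0 w (Γ v) (Fv v) (fs σ (Γ v)) t 0 = (v t).2 from (congrArg Prod.snd (hfix t ht)).symm]
  exact if_pos ht

def U2 (w γ f s : ℝ → ℝ) (t x : ℝ) : ℝ := Pot HK2 w idt zt t x + 2 * Pot HK2 f zt idt t x -
  Pot HK2 γ s idt t x - Pot HK2 γ (ng s) idt t x

section
variable {w γ f s : ℝ → ℝ} {σ L M B ρ : ℝ} (hw : IniD w σ L) (hD : Dat γ f s M B ρ) {t x : ℝ}
include hw hD

theorem U_reg (ht : 0 < t) (h0 : x ≠ 0) (h1 : x ≠ s t) (h2 : x ≠ -s t) :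
    ContinuousAt (fun q : ℝ × ℝ => U2 w γ f s q.1 q.2) (t, x) ∧
    HasDerivAt (U0 w γ f s t) (U1 w γ f s t x) x ∧ HasDerivAt (U1 w γ f s t) (U2 w γ f s t x) x ∧
    HasDerivAt (fun τ => U0 w γ f s τ x) (U2 w γ f s t x) t := by
  obtain ⟨-, a2, a3, a4, a5⟩ := ip_reg hw ht x
  obtain ⟨⟨-, -, b2⟩, b3, b4, b5⟩ := sl_off hD.dens (c := zt) continuous_const (t := t) h0
  obtain ⟨⟨-, -, c2⟩, c3, c4, c5⟩ := sl_off hD.curve.dens hD.curve.cont h1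
  obtain ⟨⟨-, -, d2⟩, d3, d4, d5⟩ := sl_off hD.curve.dens hD.curve.neg.cont (t := t) (x := x) h2
  exact ⟨((a2.add (b2.const_mul 2)).sub c2).sub d2, ((a3.add (b3.const_mul 2)).sub c3).sub d3,
    ((a4.add (b4.const_mul 2)).sub c4).sub d4, ((a5.add (b5.const_mul 2)).sub c5).sub d5⟩

theorem U_D12 (hρ : 0 < ρ) (ht : 0 < t) (h0 : 0 < x) (h1 : x ≠ s t) :
    D12 (U0 w γ f s) t x (U2 w γ f s t x) (U2 w γ f s t x) := by
  have hl := hD.low t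
  obtain ⟨-, -, h3, h4⟩ := U_reg hw hD ht h0.ne' h1 (by linarith)
  refine ⟨h4, U1 w γ f s t, ?_, h3⟩
  filter_upwards [lt_mem_nhds h0, isOpen_ne.mem_nhds h1] with y hy1 hy2
  exact (U_reg hw hD ht hy1.ne' hy2 (by linarith)).2.1

omit hw in
theorem U1_in (hρ : 0 < ρ) (h0 : 0 < x) (h1 : x < s t) :
    U1 w γ f s t x = Qf w γ f s t x - f t := by
  have hl := hD.low t
  unfold Qf ng zt
  rw [Real.sign_of_pos (by linarith), Real.sign_of_neg (by linarith), Real.sign_of_pos (by linarith)]; ring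

omit hw in
theorem U1_out (hρ : 0 < ρ) (h1 : s t < x) :
    U1 w γ f s t x = Qf w γ f s t x - f t + γ t := by
  have hl := hD.low t
  unfold Qf ng zt
  rw [Real.sign_of_pos (by linarith), Real.sign_of_pos (by linarith), Real.sign_of_pos (by linarith)]; ring

theorem Q_zero (hρ : 0 < ρ) : Qf w γ f s t 0 = 0 := by
  have hl := hD.low t
  have e1 : Pot HK1 γ (ng s) idt t 0 = -Pot HK1 γ s idt t 0 := by
    unfold Pot; rw [← integral_neg]; congr 1; funext τ
    rw [show (0:ℝ) - ng s τ = -(0 - s τ) by simp [ng], HK1_neg]; ring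
  have e2 : Pot HK1 f zt idt t 0 = 0 := by
    have : ∀ r, HK1 0 r = 0 := fun r => by simp [HK1]
    simp [Pot, zt, this]
  unfold Qf U1 ng zt at *
  rw [sub_self, Real.sign_zero, Real.sign_of_neg (by linarith), Real.sign_of_pos (by linarith)]
  have e3 := ip1_zero hw t
  unfold zt at e3
  rw [e1, e2, e3]; ring

theorem Qx_cont (ht : 0 < t) : Continuous (Qf w γ f s t) :=
  continuous_iff_continuousAt.2 fun x => ContinuousAt.comp (f := fun x : ℝ => (t, x)) (Q_cont hw hD ht x) (by fun_prop)

theorem U_left (hρ : 0 < ρ) (ht : 0 < t) : HasDerivWithinAt (U0 w γ f s t) (-f t) (Ici 0) 0 := by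
  have hl := hD.low t
  have hc := Qx_cont hw hD ht
  have hu : Continuous (U0 w γ f s t) := (U0_cont hw hD).comp (f := fun x : ℝ => (t, x)) (by fun_prop)
  have hd : ∀ y ∈ Ioo 0 (s t), HasDerivAt (U0 w γ f s t) (Qf w γ f s t y - f t) y := fun y hy => by
    rw [← U1_in hD hρ hy.1 hy.2]
    exact (U_reg hw hD ht hy.1.ne' hy.2.ne (by linarith [hy.1])).2.1
  refine hasDerivWithinAt_Ici_of_tendsto_deriv (s := Ioo 0 (s t))
    (fun y hy => (hd y hy).differentiableAt.differentiableWithinAt) hu.continuousWithinAt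
    (Ioo_mem_nhdsGT (by linarith)) ?_
  have : Tendsto (fun y => Qf w γ f s t y - f t) (𝓝[>] 0) (𝓝 (-f t)) := by
    have h3 : Continuous fun y => Qf w γ f s t y - f t := by fun_prop
    exact (h3.tendsto' 0 _ (by simp [Q_zero hw hD hρ])).mono_left nhdsWithin_le_nhds
  refine this.congr' ?_
  filter_upwards [Ioo_mem_nhdsGT (show 0 < s t by linarith)] with y hy using (hd y hy).deriv.symm

theorem U_right (hρ : 0 < ρ) (ht : 0 < t) :
    HasDerivWithinAt (U0 w γ f s t) (U1 w γ f s t (s t) - 1/2 * γ t) (Iic (s t)) (s t) := by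
  have hl := hD.low t
  have hc := Qx_cont hw hD ht
  have hu : Continuous (U0 w γ f s t) := (U0_cont hw hD).comp (f := fun x : ℝ => (t, x)) (by fun_prop)
  have hd : ∀ y ∈ Ioo 0 (s t), HasDerivAt (U0 w γ f s t) (Qf w γ f s t y - f t) y := fun y hy => by
    rw [← U1_in hD hρ hy.1 hy.2]
    exact (U_reg hw hD ht hy.1.ne' hy.2.ne (by linarith [hy.1])).2.1
  refine hasDerivWithinAt_Iic_of_tendsto_deriv (s := Ioo 0 (s t))
    (fun y hy => (hd y hy).differentiableAt.differentiableWithinAt) hu.continuousWithinAt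
    (Ioo_mem_nhdsLT (by linarith)) ?_
  have : Tendsto (fun y => Qf w γ f s t y - f t) (𝓝[<] (s t)) (𝓝 (U1 w γ f s t (s t) - 1/2 * γ t)) := by
    have h2 := (hc.sub (continuous_const (y := f t))).tendsto (s t)
    rw [U1_s hρ hD, add_sub_cancel_right]
    exact h2.mono_left nhdsWithin_le_nhds
  refine this.congr' ?_
  filter_upwards [Ioo_mem_nhdsLT (show 0 < s t by linarith)] with y hy using (hd y hy).deriv.symm

theorem U_rightout (hρ : 0 < ρ) (ht : 0 < t) :
    HasDerivWithinAt (U0 w γ f s t) (U1 w γ f s t (s t) + 1/2 * γ t) (Ici (s t)) (s t) := by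
  have hl := hD.low t
  have hc := Qx_cont hw hD ht
  have hu : Continuous (U0 w γ f s t) := (U0_cont hw hD).comp (f := fun x : ℝ => (t, x)) (by fun_prop)
  have hd : ∀ y ∈ Ioi (s t), HasDerivAt (U0 w γ f s t) (Qf w γ f s t y - f t + γ t) y := fun y hy => by
    have hy' : s t < y := hy
    rw [← U1_out hD hρ hy]
    exact (U_reg hw hD ht (by linarith) hy'.ne' (by linarith)).2.1
  refine hasDerivWithinAt_Ici_of_tendsto_deriv (s := Ioi (s t))
    (fun y hy => (hd y hy).differentiableAt.differentiableWithinAt) hu.continuousWithinAt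
    self_mem_nhdsWithin ?_
  have : Tendsto (fun y => Qf w γ f s t y - f t + γ t) (𝓝[>] (s t)) (𝓝 (U1 w γ f s t (s t) + 1/2 * γ t)) := by
    have h3 : Continuous fun y => Qf w γ f s t y - f t + γ t := by fun_prop
    exact (h3.tendsto' (s t) _ (by rw [U1_s hρ hD]; ring)).mono_left nhdsWithin_le_nhds
  refine this.congr' ?_
  filter_upwards [self_mem_nhdsWithin] with y hy using (hd y hy).deriv.symm

theorem U_zero (y : ℝ) : U0 w γ f s 0 y = w y := by
  have h : ∀ {f c : ℝ → ℝ} {B : ℝ}, Dens f B → Pot HK f c idt 0 y = 0 := fun {f c B} hf => by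
    have := sl_bound (c := c) hf 0 y
    rw [Real.sqrt_zero, mul_zero] at this
    exact abs_nonpos_iff.1 this
  unfold U0
  rw [ip_zero, h hD.dens, h hD.curve.dens, h hD.curve.dens]; ring

theorem U_bd (T : ℝ) : ∃ K, 0 ≤ K ∧ ∀ t ≤ T, ∀ x, |U0 w γ f s t x| ≤ K := by
  have hB := hD.dens.nonneg
  have hM := hD.curve.dens.nonneg
  have hL := hw.Lnn
  have hσ := hw.pos
  refine ⟨L * σ + 2 * (2 * B * √T) + 2 * M * √T + 2 * M * √T, by positivity, fun t ht x => ?_⟩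
  have hs := Real.sqrt_le_sqrt ht
  have e1 := ip_bd hw t x
  have e2 := sl_bound (c := zt) hD.dens t x
  have e3 := sl_bound (c := s) hD.curve.dens t x
  have e4 := sl_bound (c := ng s) hD.curve.dens t x
  have e5 : 2 * B * √t ≤ 2 * B * √T := by gcongr
  have e6 : 2 * M * √t ≤ 2 * M * √T := by gcongr
  unfold U0
  rw [abs_le] at *
  constructor <;> linarith
end

section
variable {p H : ℝ} {w γ f s g : ℝ → ℝ} {σ L M : ℝ} (hF : FixD p H w γ f s g σ L M)
include hF

theorem FixD.rho : 0 < σ / 2 := half_pos hF.ini.pos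
theorem FixD.spos (t : ℝ) : 0 < s t := hF.rho.trans_le (hF.dat.low t)

/-- exterior vanishing -/
theorem ext_zero {T : ℝ} (hT : 0 ≤ T) (hv : ∀ t ∈ Ioc 0 T, γ t = g t) :
    ∀ t ∈ Icc 0 T, ∀ x, s t ≤ x → U0 w γ f s t x = 0 := by
  have hw := hF.ini
  have hD := hF.dat
  have hρ := hF.rho
  have hM := hD.curve.dens.nonneg
  have hsc := hD.curve.cont
  have hU := U0_cont hw hD
  obtain ⟨K, hK, hUK⟩ := U_bd hw hD T
  let B : ℝ → ℝ → ℝ := fun t x => Real.exp ((M + 3) * t) * (1 + (x - s t) ^ 2 + Real.exp (-(x - s t)))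
  have key : ∀ ς : ℝ, (ς = 1 ∨ ς = -1) → ∀ ε, 0 < ε → ∀ t ∈ Icc 0 T, ∀ x, s t ≤ x →
      ς * U0 w γ f s t x < ε * B t x := by
    intro ς hς ε hε t₁ ht₁ x₁ hx₁
    have hςa : ∀ y, ς * y ≤ |y| := fun y => by
      rcases hς with h | h <;> rw [h]
      · rw [one_mul]; exact le_abs_self y
      · rw [neg_one_mul]; exact neg_le_abs y
    set R := (x₁ - s t₁) + 1 + K / ε with hR
    have hKe : 0 ≤ K / ε := by positivity
    have hR1 : 1 ≤ R := by linarith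
    have hRK : K < ε * (1 + R ^ 2) := by
      have : K = ε * (K / ε) := by field_simp
      have h2 : K / ε ≤ R ^ 2 := by nlinarith
      nlinarith
    have := maxprin (a := 0) (b := T) (l := s) (r := fun t => s t + R)
      (w := fun t x => ς * U0 w γ f s t x - ε * B t x) hsc.continuousOn (by fun_prop)
      (fun t _ => by linarith) (by
        refine Continuous.continuousOn ((hU.const_mul ς).sub (Continuous.const_mul ?_ ε))
        simp only [B]; fun_prop)
      (fun x hx => by
        rw [hF.s0 0 le_rfl] at hx
        simp only [U_zero hw hD, hw.zero x hx.1, mul_zero, zero_sub, neg_lt_zero, B]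
        positivity)
      (fun t ht => Or.inr ⟨ε * Real.exp ((M + 3) * t), by positivity, by
        have h1 := (U_rightout hw hD hρ ht.1).const_mul ς
        have e0 : U1 w γ f s t (s t) + 1/2 * γ t = 0 := by rw [hv t ht, hF.gg t ht.1]; ring
        have h2 : HasDerivAt (fun x => ε * B t x) (ε * (Real.exp ((M + 3) * t) * ((0 + 2 * (s t - s t) ^ 1 * 1) +
            Real.exp (-(s t - s t)) * -1))) (s t) := by
          have h3 : HasDerivAt (fun x => x - s t) 1 (s t) := (hasDerivAt_id _).sub_const _
          exact ((((hasDerivAt_const _ _).add (h3.pow 2)).add h3.neg.exp).const_mul _).const_mul ε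
        refine (h1.sub h2.hasDerivWithinAt).congr_deriv ?_
        rw [e0]; simp⟩)
      (fun t ht => by
        have h1 := (hςa _).trans (hUK t ht.2 (s t + R))
        have h2 : 1 ≤ Real.exp ((M + 3) * t) := Real.one_le_exp (by have := ht.1; positivity)
        simp only [B, add_sub_cancel_left]
        have h3 := Real.exp_pos (-R)
        have h4 : 1 + R ^ 2 ≤ Real.exp ((M + 3) * t) * (1 + R ^ 2 + Real.exp (-R)) := by nlinarith
        nlinarith)
      (fun t ht x hx => by
        have hd := U_D12 hw hD hρ ht.1 (by linarith [hF.spos t, hx.1]) hx.1.ne'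
        have hs := hD.curve.der t ht.1
        set y := x - s t with hy
        have hy0 : 0 < y := by linarith [hx.1]
        have hB : D12 B t x
            (Real.exp ((M + 3) * t) * ((M + 3) * 1) * (1 + (x - s t) ^ 2 + Real.exp (-(x - s t))) +
              Real.exp ((M + 3) * t) * (0 + 2 * (x - s t) ^ 1 * (-γ t) + Real.exp (-(x - s t)) * -(-γ t)))
            (Real.exp ((M + 3) * t) * (2 * 1 + -(Real.exp (-(x - s t)) * -1))) := by
          refine ⟨?_, fun x => Real.exp ((M + 3) * t) * (2 * (x - s t) + -Real.exp (-(x - s t))), ?_, ?_⟩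
          · have h3 : HasDerivAt (fun τ => x - s τ) (-γ t) t := hs.const_sub x
            have h4 : HasDerivAt (fun τ => Real.exp ((M + 3) * τ)) (Real.exp ((M + 3) * t) * ((M + 3) * 1)) t :=
              ((hasDerivAt_id t).const_mul _).exp
            exact h4.mul (((hasDerivAt_const t (1:ℝ)).add (h3.pow 2)).add h3.neg.exp)
          · refine Eventually.of_forall fun x => ?_
            have h3 : HasDerivAt (fun x => x - s t) 1 x := (hasDerivAt_id _).sub_const _
            refine (((((hasDerivAt_const x (1:ℝ)).add (h3.pow 2)).add h3.neg.exp).const_mul _)).congr_deriv ?_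
            simp only [Pi.neg_apply]; ring
          · have h3 : HasDerivAt (fun x => x - s t) 1 x := (hasDerivAt_id _).sub_const _
            exact ((h3.const_mul 2).add h3.neg.exp.neg).const_mul _
        refine ⟨_, _, (hd.const_mul ς).sub (hB.const_mul ε), ?_⟩
        have hg := hD.curve.dens.bdd t
        rw [abs_le] at hg
        rw [← hy]
        have he := Real.exp_pos (-y)
        have hE := Real.exp_pos ((M + 3) * t)
        have h5 : 2 + Real.exp (-y) < (M + 3) * (1 + y ^ 2 + Real.exp (-y)) + (2 * y * (-γ t) + Real.exp (-y) * γ t) := by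
          have a1 : 2 * y * γ t ≤ (1 + y ^ 2) * M := by nlinarith [sq_nonneg (y - 1)]
          have a2 : -(Real.exp (-y) * M) ≤ Real.exp (-y) * γ t := by nlinarith
          nlinarith [sq_nonneg y]
        have h6 := mul_lt_mul_of_pos_left h5 (mul_pos hε hE)
        linarith)
      t₁ ht₁ x₁ ⟨hx₁, by linarith⟩
    simpa using this
  have key2 : ∀ ς : ℝ, (ς = 1 ∨ ς = -1) → ∀ t ∈ Icc 0 T, ∀ x, s t ≤ x → ς * U0 w γ f s t x ≤ 0 := by
    intro ς hς t ht x hx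
    have hBp : 0 < B t x := by simp only [B]; positivity
    refine le_of_forall_pos_le_add fun ε hε => ?_
    have := key ς hς (ε / B t x) (by positivity) t ht x hx
    rw [div_mul_cancel₀ _ hBp.ne'] at this
    linarith
  intro t ht x hx
  have a := key2 1 (Or.inl rfl) t ht x hx
  have b := key2 (-1) (Or.inr rfl) t ht x hx
  linarith

theorem int_nonneg {T : ℝ} (hT : 0 ≤ T) (hp : 1 < p) (hH : 0 ≤ H) (hv : ∀ t ∈ Ioc 0 T, γ t = g t) :
    ∀ t ∈ Icc 0 T, ∀ x ∈ Icc 0 (s t), 0 ≤ U0 w γ f s t x := by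
  have hw := hF.ini
  have hD := hF.dat
  have hρ := hF.rho
  have hsc := hD.curve.cont
  have hU := U0_cont hw hD
  have hz := ext_zero hF hT hv
  intro t₁ ht₁ x₁ hx₁
  refine le_of_forall_pos_le_add fun ε' hε' => ?_
  set ε := ε' * Real.exp (-(2 * t₁ - x₁)) with hε0
  have hε : 0 < ε := by positivity
  have := maxprin (a := 0) (b := T) (l := fun _ => 0) (r := s)
    (w := fun t x => -1 * U0 w γ f s t x - ε * Real.exp (2 * t - x)) continuousOn_const hsc.continuousOn
    (fun t _ => hF.spos t) (by
      refine Continuous.continuousOn ((hU.const_mul _).sub (Continuous.const_mul ?_ ε))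
      fun_prop)
    (fun x hx => by
      have := hw.nonneg x
      simp only [U_zero hw hD]
      have : 0 < ε * Real.exp (2 * 0 - x) := by positivity
      linarith)
    (fun t ht => Or.inr ⟨f t + ε * Real.exp (2 * t), by
        have := (Ftr_bd hp hH (U0 w γ f s t 0)).1
        rw [hF.ff t ht.1]; positivity, by
      have h1 := (U_left hw hD hρ ht.1).const_mul (-1)
      have h2 : HasDerivAt (fun x => ε * Real.exp (2 * t - x)) (ε * (Real.exp (2 * t - 0) * -1)) 0 :=
        (((hasDerivAt_id (0:ℝ)).const_sub (2 * t)).exp).const_mul ε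
      refine (h1.sub h2.hasDerivWithinAt).congr_deriv ?_
      rw [sub_zero]; ring⟩)
    (fun t ht => by
      rw [hz t ⟨ht.1.le, ht.2⟩ _ le_rfl]
      have : 0 < ε * Real.exp (2 * t - s t) := by positivity
      linarith)
    (fun t ht x hx => by
      have hd := U_D12 hw hD hρ ht.1 hx.1 hx.2.ne
      have hB : D12 (fun t x => Real.exp (2 * t - x)) t x (Real.exp (2 * t - x) * (2 * 1))
          (-1 * (Real.exp (2 * t - x) * -1)) :=
        ⟨(((hasDerivAt_id t).const_mul 2).sub_const x).exp, fun x => -1 * Real.exp (2 * t - x),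
          Eventually.of_forall fun x => (((hasDerivAt_id x).const_sub (2 * t)).exp).congr_deriv (by simp),
          (((hasDerivAt_id x).const_sub (2 * t)).exp).const_mul (-1)⟩
      refine ⟨_, _, (hd.const_mul (-1)).sub (hB.const_mul ε), ?_⟩
      have : 0 < ε * Real.exp (2 * t - x) := by positivity
      linarith)
    t₁ ht₁ x₁ hx₁
  have e : ε * Real.exp (2 * t₁ - x₁) = ε' := by
    rw [hε0, mul_assoc, ← Real.exp_add]; simp
  simp only [e] at this
  linarith

theorem gam_nonneg {T : ℝ} (hT : 0 ≤ T) (hp : 1 < p) (hH : 0 ≤ H) (hv : ∀ t ∈ Ioc 0 T, γ t = g t) :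
    ∀ t ∈ Ioc 0 T, HasDerivWithinAt (U0 w γ f s t) (-γ t) (Iic (s t)) (s t) ∧ 0 ≤ γ t := by
  intro t ht
  have hw := hF.ini
  have hD := hF.dat
  have hρ := hF.rho
  have h1 : HasDerivWithinAt (U0 w γ f s t) (-γ t) (Iic (s t)) (s t) :=
    (U_right hw hD hρ ht.1).congr_deriv (by
      have := hF.gg t ht.1
      rw [← hv t ht] at this; linarith)
  refine ⟨h1, ?_⟩
  have := deriv_nonneg_left h1.neg (by
    filter_upwards [Ioo_mem_nhdsLT (hF.spos t)] with y hy
    have ht' : t ∈ Icc 0 T := ⟨ht.1.le, ht.2⟩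
    have a1 := int_nonneg hF hT hp hH hv t ht' y ⟨hy.1.le, hy.2.le⟩
    have a2 := ext_zero hF hT hv t ht' (s t) le_rfl
    simp only [Pi.neg_apply]; linarith)
  linarith

theorem int_le {T M0 : ℝ} (hT : 0 ≤ T) (hp : 1 < p) (hH : 0 ≤ H) (hv : ∀ t ∈ Ioc 0 T, γ t = g t)
    (hM1 : L ≤ M0) (hM2 : H ^ p < M0) :
    ∀ t ∈ Ioc 0 T, γ t ≤ M0 := by
  have hw := hF.ini
  have hD := hF.dat
  have hρ := hF.rho
  have hsc := hD.curve.cont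
  have hU := U0_cont hw hD
  have hz := ext_zero hF hT hv
  have key : ∀ t ∈ Icc 0 T, ∀ x ∈ Icc 0 (s t), U0 w γ f s t x ≤ M0 * (s t - x) := by
    intro t₁ ht₁ x₁ hx₁
    refine le_of_forall_pos_le_add fun ε' hε' => ?_
    have ht1 : 0 < 1 + t₁ := by linarith [ht₁.1]
    set ε := ε' / (1 + t₁) with hε0
    have hε : 0 < ε := by positivity
    have := maxprin (a := 0) (b := T) (l := fun _ => 0) (r := s)
      (w := fun t x => U0 w γ f s t x - (M0 * (s t - x) + ε * (1 + t))) continuousOn_const hsc.continuousOn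
      (fun t _ => hF.spos t) (Continuous.continuousOn (hU.sub (by fun_prop)))
      (fun x hx => by
        simp only [U_zero hw hD]
        have h1 := hw.bd' x hx.1
        rw [hF.s0 0 le_rfl] at *
        rw [max_eq_left (by linarith [hx.2])] at h1
        nlinarith [hx.2])
      (fun t ht => Or.inr ⟨-f t + M0, by
          have := (Ftr_bd hp hH (U0 w γ f s t 0)).2
          rw [hF.ff t ht.1]; linarith, by
        have h1 := (U_left hw hD hρ ht.1)
        have h2 : HasDerivAt (fun x => M0 * (s t - x) + ε * (1 + t)) (M0 * -1) 0 :=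
          (((hasDerivAt_id (0:ℝ)).const_sub (s t)).const_mul M0).add_const _
        refine (h1.sub h2.hasDerivWithinAt).congr_deriv ?_
        ring⟩)
      (fun t ht => by
        simp only [hz t ⟨ht.1.le, ht.2⟩ _ le_rfl]
        have : 0 < ε * (1 + t) := by have := ht.1; positivity
        linarith)
      (fun t ht x hx => by
        have hd := U_D12 hw hD hρ ht.1 hx.1 hx.2.ne
        have hB : D12 (fun t x => M0 * (s t - x) + ε * (1 + t)) t x (M0 * γ t + ε * 1) 0 :=
          ⟨(((hD.curve.der t ht.1).sub_const x).const_mul M0).add (((hasDerivAt_id t).const_add 1).const_mul ε),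
            fun x => M0 * -1,
            Eventually.of_forall fun x => (((hasDerivAt_id x).const_sub (s t)).const_mul M0).add_const _,
            hasDerivAt_const _ _⟩
        refine ⟨_, _, hd.sub hB, ?_⟩
        have h1 := (gam_nonneg hF hT hp hH hv t ht).2
        have h2 : 0 ≤ M0 := hw.Lnn.trans hM1
        have : 0 ≤ M0 * γ t := by positivity
        linarith)
      t₁ ht₁ x₁ hx₁
    have e : ε * (1 + t₁) = ε' := by rw [hε0]; field_simp
    simp only [e] at this
    linarith
  intro t ht
  have h1 := (gam_nonneg hF hT hp hH hv t ht).1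
  have h2 : HasDerivAt (fun x => M0 * (s t - x)) (M0 * -1) (s t) :=
    ((hasDerivAt_id (s t)).const_sub (s t)).const_mul M0
  have := deriv_nonneg_left (h1.sub h2.hasDerivWithinAt) (by
    filter_upwards [Ioo_mem_nhdsLT (hF.spos t)] with y hy
    have ht' : t ∈ Icc 0 T := ⟨ht.1.le, ht.2⟩
    have a1 := key t ht' y ⟨hy.1.le, hy.2.le⟩
    have a2 := hz t ht' (s t) le_rfl
    simp only [Pi.sub_apply, a2, sub_self, mul_zero]
    linarith)
  linarith
end

theorem pot_sqrt {k : ℝ → ℝ → ℝ} {f c : ℝ → ℝ} {B K t x : ℝ} (hf : Dens f B) (hK : 0 ≤ K) (ht : 0 < t)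
    (hk0 : ∀ z r, r ≤ 0 → k z r = 0)
    (hk : ∀ τ, 0 < τ → τ < t → |k (x - c τ) (t - τ)| ≤ K / √(t - τ)) :
    |Pot k f c idt t x| ≤ 2 * B * K * √t := by
  have hB := hf.nonneg
  rw [Pot_rev]
  obtain ⟨i1, i2⟩ := sl_bound_int (B := B * K) t ht.le
  have := norm_integral_le_of_norm_le i1 (f := fun r => f (t - r) * k (x - c (t - r)) r)
    (Eventually.of_forall fun r => by
      have hnn : 0 ≤ indicator (Ioo 0 t) (fun r => B * K * (1 / √r)) r :=
        indicator_nonneg (fun r _ => by positivity) r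
      by_cases h1 : 0 < r
      · by_cases h2 : r < t
        · rw [indicator_of_mem (show r ∈ Ioo 0 t from ⟨h1, h2⟩), norm_mul]
          have := hk (t - r) (by linarith) (by linarith)
          rw [sub_sub_cancel] at this
          calc _ ≤ B * (K / √r) := mul_le_mul (hf.bdd _) this (abs_nonneg _) hB
            _ = _ := by ring
        · rw [hf.zero (t - r) (by linarith)]; simpa using hnn
      · rw [hk0 _ r (not_lt.1 h1)]; simpa using hnn)
  rw [i2] at this
  refine this.trans (by linarith)

section
variable {p H : ℝ} {w γ f s g : ℝ → ℝ} {σ L M : ℝ} (hF : FixD p H w γ f s g σ L M)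
include hF

theorem near_zero : ∃ C, 0 ≤ C ∧ ∀ t, 0 < t → -(C * √t) ≤ g t ∧ g t ≤ 2 * L + C * √t := by
  have hw := hF.ini
  have hD := hF.dat
  have hM := hD.curve.dens.nonneg
  have hB := hD.dens.nonneg
  have hL := hw.Lnn
  have hCK := CK_nonneg
  obtain ⟨C0, hC0, hker⟩ := offker hF.rho
  have hk0 : ∀ z r : ℝ, r ≤ 0 → HK1 z r = 0 := fun z r hr => HK1_of_nonpos hr z
  refine ⟨2 * (L * CK * M + 2 * (2 * H ^ p * C0) + 2 * M * M + 2 * M * C0), by positivity, fun t ht => ?_⟩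
  have hst := Real.sqrt_pos.2 ht
  have e1 := hF.gg t ht
  unfold U1 at e1
  have a1 := ip1_lip hw ht (s t) σ
  have a1' : L * CK * |s t - σ| / √t ≤ L * CK * M * √t := by
    rw [div_le_iff₀ hst, mul_assoc _ (√t), Real.mul_self_sqrt ht.le, mul_assoc _ M t]
    have := hD.curve.lip t 0
    rw [hF.s0 0 le_rfl, sub_zero, abs_of_pos ht] at this
    gcongr
  have a2 := ip1_nonpos hw ht
  have a3 := ip1_bd hw ht σ
  have b1 := pot_sqrt (k := HK1) (c := zt) (x := s t) (K := C0) hD.dens (by linarith) ht hk0 (fun τ h1 h2 =>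
    (hker _ _ (by linarith) (by
      have := hD.low t
      rw [show s t - zt τ = s t by simp [zt], abs_of_pos (hF.spos t)]; exact this)).1)
  have b2 := pot_sqrt (k := HK1) (c := ng s) (x := s t) (K := C0) hD.curve.dens (by linarith) ht hk0 (fun τ h1 h2 =>
    (hker _ _ (by linarith) (by
      have := hD.low t
      have h3 := hF.spos τ
      have h4 := hF.spos t
      rw [show s t - ng s τ = s t + s τ by simp [ng], abs_of_pos (by linarith)]; linarith)).1)
  have b3 := pot_sqrt (k := HK1) (c := s) (x := s t) (K := M) hD.curve.dens hM ht hk0 (fun τ h1 h2 => by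
    have hr : 0 < t - τ := by linarith
    have h3 := hD.curve.lip t τ
    rw [abs_of_pos hr] at h3
    have h4 := HK_le hr (s t - s τ)
    unfold HK1
    rw [abs_mul, abs_div, abs_neg, abs_of_pos (show 0 < 2 * (t - τ) by linarith)]
    calc _ ≤ M * (1 / √(t - τ)) := by
          refine mul_le_mul ?_ h4 (abs_nonneg _) hM
          rw [div_le_iff₀ (by linarith)]
          nlinarith [abs_nonneg (s t - s τ)]
      _ = _ := by ring)
  rw [abs_le] at *
  constructor <;> nlinarith

theorem valid (hp : 1 < p) (hH : 0 ≤ H) (hM1 : 2 * L + H ^ p + 1 ≤ M) :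
    ∀ t, 0 < t → γ t = g t := by
  have hw := hF.ini
  have hD := hF.dat
  have hσ := hw.pos
  have hL := hw.Lnn
  have hHp := Real.rpow_nonneg hH p
  let P : ℝ → Prop := fun t => -(σ / 2 * Real.exp (-t)) < g t ∧ g t < M
  have hP : ∀ t, 0 < t → P t → γ t = g t := by
    intro t ht h
    rw [hF.gam t ht, min_eq_left h.2.le, max_eq_right h.1.le]
  obtain ⟨C, hC, hnz⟩ := near_zero hF
  obtain ⟨t0, ht0, hsm⟩ : ∃ t0, 0 < t0 ∧ ∀ t, 0 < t → t < t0 → P t := by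
    have c1 : Tendsto (fun t => σ / 2 * Real.exp (-t) - C * √t) (𝓝 0) (𝓝 (σ / 2)) :=
      Continuous.tendsto' (by fun_prop) _ _ (by simp)
    have c2 : Tendsto (fun t => C * √t) (𝓝 0) (𝓝 0) :=
      Continuous.tendsto' (by fun_prop) _ _ (by simp)
    have := (c1.eventually (lt_mem_nhds (half_pos hσ))).and (c2.eventually (gt_mem_nhds one_pos))
    obtain ⟨δ, hδ, h⟩ := Metric.eventually_nhds_iff.1 this
    refine ⟨δ, hδ, fun t ht htδ => ?_⟩
    obtain ⟨h1, h2⟩ := h (y := t) (by rw [Real.dist_eq, sub_zero, abs_of_pos ht]; exact htδ)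
    have := hnz t ht
    constructor <;> linarith
  have hval : ∀ t, 0 < t → P t := by
    by_contra hcon
    push Not at hcon
    obtain ⟨b, hb, hPb⟩ := hcon
    have hbt : t0 ≤ b := by by_contra h; exact hPb (hsm b hb (not_le.1 h))
    have hgc : ContinuousOn g (Icc t0 b) := hF.gcont.mono fun x hx => lt_of_lt_of_le ht0 hx.1
    have hcl : IsCompact ({t ∈ Icc t0 b | ¬ P t}) := by
      have e : {t ∈ Icc t0 b | ¬ P t} = (Icc t0 b ∩ (fun t => g t + σ / 2 * Real.exp (-t)) ⁻¹' Iic 0) ∪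
          (Icc t0 b ∩ g ⁻¹' Ici M) := by
        ext t
        simp only [P, mem_ofPred_eq, mem_union, mem_inter_iff, mem_preimage, mem_Iic, mem_Ici]
        constructor
        · rintro ⟨h1, h2⟩
          by_cases h3 : M ≤ g t
          · exact Or.inr ⟨h1, h3⟩
          · left; refine ⟨h1, ?_⟩
            by_contra h4; exact h2 ⟨by linarith, by linarith⟩
        · rintro (⟨h1, h2⟩ | ⟨h1, h2⟩)
          · exact ⟨h1, fun h => by linarith [h.1]⟩
          · exact ⟨h1, fun h => by linarith [h.2]⟩
      rw [e]
      have h1 : IsClosed (Icc t0 b ∩ (fun t => g t + σ / 2 * Real.exp (-t)) ⁻¹' Iic 0) :=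
        ContinuousOn.preimage_isClosed_of_isClosed (by fun_prop) isClosed_Icc isClosed_Iic
      have h2 : IsClosed (Icc t0 b ∩ g ⁻¹' Ici M) := hgc.preimage_isClosed_of_isClosed isClosed_Icc isClosed_Ici
      exact (isCompact_Icc.of_isClosed_subset h1 inter_subset_left).union
        (isCompact_Icc.of_isClosed_subset h2 inter_subset_left)
    obtain ⟨T, ⟨hT1, hT2⟩, hTl⟩ := hcl.exists_isLeast ⟨b, ⟨hbt, le_rfl⟩, hPb⟩
    have hT0 : 0 < T := ht0.trans_le hT1.1
    have hlt : ∀ t, 0 < t → t < T → γ t = g t := by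
      intro t h1 h2
      apply hP t h1
      by_contra h3
      by_cases h4 : t < t0
      · exact h3 (hsm t h1 h4)
      · have := hTl ⟨⟨not_lt.1 h4, h2.le.trans hT1.2⟩, h3⟩
        linarith
    have hTT : γ T = g T := by
      have h1 : Tendsto γ (𝓝[<] T) (𝓝 (γ T)) := (hD.curve.dens.cont T hT0).tendsto.mono_left nhdsWithin_le_nhds
      have h2 : Tendsto g (𝓝[<] T) (𝓝 (g T)) :=
        (hF.gcont.continuousAt (Ioi_mem_nhds hT0)).tendsto.mono_left nhdsWithin_le_nhds
      refine tendsto_nhds_unique h1 (h2.congr' ?_)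
      filter_upwards [Ioo_mem_nhdsLT hT0] with t ht using (hlt t ht.1 ht.2).symm
    have hv : ∀ t ∈ Ioc 0 T, γ t = g t := fun t ht => by
      rcases ht.2.eq_or_lt with h | h
      · rw [h, hTT]
      · exact hlt t ht.1 h
    have r1 := (gam_nonneg hF hT0.le hp hH hv T ⟨hT0, le_rfl⟩).2
    have r2 := int_le (M0 := L + H ^ p + 1/2) hF hT0.le hp hH hv (by linarith) (by linarith) T ⟨hT0, le_rfl⟩
    rw [hTT] at r1 r2
    refine hT2 ⟨lt_of_lt_of_le ?_ r1, by linarith⟩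
    have := Real.exp_pos (-T)
    rw [neg_lt_zero]; positivity
  exact fun t ht => hP t ht (hval t ht)
end

/-- a solution of the problem with truncated flux -/
structure TrSol (p H : ℝ) (w : ℝ → ℝ) (σ : ℝ) (s γ f : ℝ → ℝ) (v v1 v2 : ℝ → ℝ → ℝ) : Prop where
  sc : Continuous s
  spos : ∀ t, 0 < s t
  s0 : s 0 = σ
  sd : ∀ t, 0 < t → HasDerivAt s (γ t) t
  gc : ContinuousOn γ (Ioi 0)
  gn : ∀ t, 0 < t → 0 ≤ γ t
  vc : ContinuousOn (fun q : ℝ × ℝ => v q.1 q.2) {q | q.2 ∈ Icc 0 (s q.1)}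
  vn : ∀ t, 0 ≤ t → ∀ x ∈ Icc 0 (s t), 0 ≤ v t x
  vz : ∀ t, 0 ≤ t → v t (s t) = 0
  v0 : ∀ x ∈ Icc 0 σ, v 0 x = w x
  vl : ∀ t, 0 < t → HasDerivAt (v t) (-f t) 0
  vr : ∀ t, 0 < t → HasDerivAt (v t) (-γ t) (s t)
  ff : ∀ t, 0 < t → f t = Ftr p H (v t 0)
  vx : ∀ t, 0 < t → ∀ x ∈ Ioo 0 (s t), HasDerivAt (v t) (v1 t x) x
  vxx : ∀ t, 0 < t → ∀ x ∈ Ioo 0 (s t), HasDerivAt (v1 t) (v2 t x) x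
  vt : ∀ t, 0 < t → ∀ x ∈ Ioo 0 (s t), HasDerivAt (fun τ => v τ x) (v2 t x) t
  v1c : ∀ t, 0 < t → ∀ x, ContinuousAt (fun q : ℝ × ℝ => v1 q.1 q.2) (t, x)
  v1l : ∀ t, 0 < t → v1 t 0 = -f t
  v1r : ∀ t, 0 < t → v1 t (s t) = -γ t
  v2c : ∀ t, 0 < t → ∀ x ∈ Ioo 0 (s t), ContinuousAt (fun q : ℝ × ℝ => v2 q.1 q.2) (t, x)

theorem trunc_exists {p H : ℝ} {w : ℝ → ℝ} {σ L : ℝ} (hw : IniD w σ L) (hp : 1 < p) (hH : 0 ≤ H) :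
    ∃ s γ f v v1 v2, TrSol p H w σ s γ f v v1 v2 := by
  have hHp := Real.rpow_nonneg hH p
  have hσ := hw.pos
  have hL := hw.Lnn
  set M := σ + 2 * L + H ^ p + 1 with hM
  obtain ⟨γ, f, s, g, hF⟩ := fix_exists (M := M) hw (by linarith) hH hp
  have hD := hF.dat
  have hρ := hF.rho
  have hval := valid hF hp hH (by linarith)
  have hv : ∀ T, ∀ t ∈ Ioc 0 T, γ t = g t := fun T t ht => hval t ht.1
  have hsp := hF.spos
  have hU := U0_cont hw hD
  let v : ℝ → ℝ → ℝ := fun t x => if x < 0 then U0 w γ f s t 0 - f t * x else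
    if s t < x then -γ t * (x - s t) else U0 w γ f s t x
  have ve : ∀ t, ∀ x ∈ Icc 0 (s t), v t x = U0 w γ f s t x := fun t x hx => by
    simp only [v]; rw [if_neg (by linarith [hx.1]), if_neg (by linarith [hx.2])]
  have hz : ∀ t, 0 ≤ t → U0 w γ f s t (s t) = 0 := fun t ht =>
    ext_zero hF ht (hv t) t ⟨ht, le_rfl⟩ _ le_rfl
  have hev : ∀ t x, x ∈ Ioo 0 (s t) → ∀ᶠ q : ℝ × ℝ in 𝓝 (t, x), q.2 ∈ Ioo 0 (s q.1) := by
    intro t x hx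
    have hsc := hD.curve.cont
    have h1 : ContinuousAt (fun q : ℝ × ℝ => s q.1 - q.2) (t, x) := by fun_prop
    have h2 : ContinuousAt (fun q : ℝ × ℝ => q.2) (t, x) := by fun_prop
    filter_upwards [h1.eventually (lt_mem_nhds (show 0 < s t - x by linarith [hx.2])),
      h2.eventually (lt_mem_nhds hx.1)] with q a b using ⟨b, by linarith⟩
  have hevx : ∀ t x, x ∈ Ioo 0 (s t) → v t =ᶠ[𝓝 x] U0 w γ f s t := fun t x hx => by
    filter_upwards [Ioo_mem_nhds hx.1 hx.2] with y hy using ve t y ⟨hy.1.le, hy.2.le⟩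
  refine ⟨s, γ, f, v, fun t x => Qf w γ f s t x - f t, U2 w γ f s, hD.curve.cont, hsp, hF.s0 0 le_rfl,
    hD.curve.der, fun t ht => (hD.curve.dens.cont t ht).continuousWithinAt,
    fun t ht => (gam_nonneg hF ht.le hp hH (hv t) t ⟨ht, le_rfl⟩).2,
    hU.continuousOn.congr fun q hq => ve q.1 q.2 hq,
    fun t ht x hx => by rw [ve t x hx]; exact int_nonneg hF ht hp hH (hv t) t ⟨ht, le_rfl⟩ x hx,
    fun t ht => by rw [ve t _ ⟨(hsp t).le, le_rfl⟩, hz t ht],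
    fun x hx => by rw [ve 0 x (by rwa [hF.s0 0 le_rfl]), U_zero hw hD],
    fun t ht => ?_, fun t ht => ?_, fun t ht => ?_, fun t ht x hx => ?_, fun t ht x hx => ?_, fun t ht x hx => ?_,
    fun t ht x => ?_, fun t ht => ?_, fun t ht => ?_, fun t ht x hx => ?_⟩
  · have h1 : HasDerivWithinAt (v t) (-f t) (Ici 0) 0 := by
      refine (U_left hw hD hρ ht).congr_of_eventuallyEq ?_ (ve t 0 ⟨le_rfl, (hsp t).le⟩)
      filter_upwards [Icc_mem_nhdsGE (hsp t)] with y hy using ve t y hy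
    have h2 : HasDerivWithinAt (v t) (-f t) (Iic 0) 0 := by
      have h3 : HasDerivAt (fun x => U0 w γ f s t 0 - f t * x) (-(f t * 1)) 0 :=
        ((hasDerivAt_id (0:ℝ)).const_mul (f t)).const_sub _
      rw [mul_one] at h3
      refine h3.hasDerivWithinAt.congr (fun y hy => ?_) ?_
      · rcases (show y ≤ 0 from hy).eq_or_lt with h | h
        · rw [h, ve t 0 ⟨le_rfl, (hsp t).le⟩]; simp
        · simp only [v]; rw [if_pos h]
      · rw [ve t 0 ⟨le_rfl, (hsp t).le⟩]; simp
    have := h2.union h1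
    rwa [Iic_union_Ici, hasDerivWithinAt_univ] at this
  · have h1 : HasDerivWithinAt (v t) (-γ t) (Iic (s t)) (s t) := by
      refine (gam_nonneg hF ht.le hp hH (hv t) t ⟨ht, le_rfl⟩).1.congr_of_eventuallyEq ?_ (ve t _ ⟨(hsp t).le, le_rfl⟩)
      filter_upwards [Icc_mem_nhdsLE (hsp t)] with y hy using ve t y hy
    have h2 : HasDerivWithinAt (v t) (-γ t) (Ici (s t)) (s t) := by
      have h3 : HasDerivAt (fun x => -γ t * (x - s t)) (-γ t * 1) (s t) :=
        ((hasDerivAt_id (s t)).sub_const _).const_mul _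
      rw [mul_one] at h3
      have h4 : v t (s t) = -γ t * (s t - s t) := by
        rw [ve t _ ⟨(hsp t).le, le_rfl⟩, hz t ht.le]; simp
      refine h3.hasDerivWithinAt.congr (fun y hy => ?_) h4
      rcases (show s t ≤ y from hy).eq_or_lt with h | h
      · rw [← h, h4]
      · simp only [v]; rw [if_neg (by linarith [hsp t]), if_pos h]
    have := h1.union h2
    rwa [Iic_union_Ici, hasDerivWithinAt_univ] at this
  · rw [ve t 0 ⟨le_rfl, (hsp t).le⟩]; exact hF.ff t ht
  · have := (U_reg hw hD ht hx.1.ne' hx.2.ne (by linarith [hx.1, hsp t])).2.1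
    rw [U1_in hD hρ hx.1 hx.2] at this
    exact this.congr_of_eventuallyEq (hevx t x hx)
  · refine (U_reg hw hD ht hx.1.ne' hx.2.ne (by linarith [hx.1, hsp t])).2.2.1.congr_of_eventuallyEq ?_
    filter_upwards [Ioo_mem_nhds hx.1 hx.2] with y hy using (U1_in hD hρ hy.1 hy.2).symm
  · refine (U_reg hw hD ht hx.1.ne' hx.2.ne (by linarith [hx.1, hsp t])).2.2.2.congr_of_eventuallyEq ?_
    have : Tendsto (fun τ : ℝ => (τ, x)) (𝓝 t) (𝓝 (t, x)) := Continuous.tendsto' (by fun_prop) _ _ rfl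
    filter_upwards [this.eventually (hev t x hx)] with τ hτ using ve τ x ⟨hτ.1.le, hτ.2.le⟩
  · exact (Q_cont hw hD ht x).sub (ContinuousAt.comp (f := fun q : ℝ × ℝ => q.1) (x := (t, x)) (hD.dens.cont t ht) (by fun_prop))
  · simp only [Q_zero hw hD hρ, zero_sub]
  · have h1 := U1_s (w := w) hρ hD t
    have h2 := hF.gg t ht
    rw [← hval t ht] at h2
    linarith
  · exact (U_reg hw hD ht hx.1.ne' hx.2.ne (by linarith [hx.1, hsp t])).1

section
variable {p H : ℝ} {w : ℝ → ℝ} {σ : ℝ} {s γ f : ℝ → ℝ} {v v1 v2 : ℝ → ℝ → ℝ}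
  (h : TrSol p H w σ s γ f v v1 v2)
include h

theorem TrSol.sub (hp : 1 < p) (hH : 0 ≤ H) {a b : ℝ} (ha : 0 ≤ a) : SubSol p a b s v where
  s_cont := h.sc.continuousOn
  s_pos t _ := h.spos t
  v_cont := h.vc.mono fun _ hq => hq.2
  v_nonneg t ht := h.vn t (ha.trans ht.1)
  v_zero t ht := h.vz t (ha.trans ht.1)
  free t ht := ⟨γ t, h.sd t (ha.trans_lt ht.1), (h.vr t (ha.trans_lt ht.1)).hasDerivWithinAt⟩
  flux t ht := by
    have ht0 := ha.trans_lt ht.1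
    refine ⟨-f t, (h.vl t ht0).hasDerivWithinAt, ?_⟩
    rw [neg_neg, h.ff t ht0]
    have := h.vn t ht0.le 0 ⟨le_rfl, (h.spos t).le⟩
    exact Real.rpow_le_rpow (le_max_left _ _) (max_le this (min_le_left _ _)) (by linarith)
  heat t ht x hx := by
    have ht0 := ha.trans_lt ht.1
    refine ⟨v2 t x, h.vt t ht0 x hx, v1 t, ?_, h.vxx t ht0 x hx⟩
    filter_upwards [Ioo_mem_nhds hx.1 hx.2] with y hy using h.vx t ht0 y hy

theorem TrSol.sol {ψ : ℝ → ℝ} (hψ : ∀ x ∈ Icc 0 σ, w x = ψ x) (hv : ∀ t, 0 < t → v t 0 ≤ H) :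
    IsGlobalSol p σ ψ s v := by
  intro T hT
  have hd : ∀ t, 0 < t → ∀ x ∈ Icc 0 (s t), deriv (v t) x = v1 t x := by
    intro t ht x hx
    rcases hx.1.eq_or_lt with h0 | h0
    · rw [← h0, h.v1l t ht, (h.vl t ht).deriv]
    · rcases hx.2.eq_or_lt with h1 | h1
      · rw [h1, h.v1r t ht, (h.vr t ht).deriv]
      · exact (h.vx t ht x ⟨h0, h1⟩).deriv
  have hd2 : ∀ t, 0 < t → ∀ x ∈ Ioo 0 (s t), HasDerivAt (deriv (v t)) (v2 t x) x := by
    intro t ht x hx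
    refine (h.vxx t ht x hx).congr_of_eventuallyEq ?_
    filter_upwards [Ioo_mem_nhds hx.1 hx.2] with y hy using hd t ht y ⟨hy.1.le, hy.2.le⟩
  have hfe : ∀ t, 0 < t → f t = v t 0 ^ p := by
    intro t ht
    have := h.vn t ht.le 0 ⟨le_rfl, (h.spos t).le⟩
    rw [h.ff t ht, Ftr, min_eq_left (hv t ht), max_eq_right this]
  refine
    { T_pos := hT
      s_cont := h.sc.continuousOn
      s_diff := fun t ht => (h.sd t ht.1).differentiableAt
      s_deriv_cont := (h.gc.mono fun t ht => ht.1).congr fun t ht => (h.sd t ht.1).deriv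
      s_pos := fun t _ => h.spos t
      ut_diff := fun t ht x hx => (h.vt t ht.1 x hx).differentiableAt
      ux_diff := fun t ht x hx => (h.vx t ht.1 x hx).differentiableAt
      uxx_diff := fun t ht x hx => (hd2 t ht.1 x hx).differentiableAt
      ut_cont := ?_
      uxx_cont := ?_
      ux_cont := ?_
      u_cont := h.vc.mono fun q hq => hq.2
      u_nonneg := fun t ht => h.vn t ht.1
      heat := fun t ht x hx => by rw [(h.vt t ht.1 x hx).deriv, (hd2 t ht.1 x hx).deriv]
      bc_zero := fun t ht => by rw [(h.vl t ht.1).deriv, neg_neg, hfe t ht.1]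
      bc_free := fun t ht => h.vz t ht.1.le
      stefan := fun t ht => by rw [(h.sd t ht.1).deriv, (h.vr t ht.1).deriv, neg_neg]
      init := fun x hx => by rw [h.v0 x hx, hψ x hx]
      init_s := h.s0 }
  · have : ContinuousOn (fun q : ℝ × ℝ => v2 q.1 q.2) {q : ℝ × ℝ | q.1 ∈ Ioc 0 T ∧ q.2 ∈ Ioo 0 (s q.1)} :=
      fun q hq => (h.v2c q.1 hq.1.1 q.2 hq.2).continuousWithinAt
    exact this.congr fun q hq => (h.vt q.1 hq.1.1 q.2 hq.2).deriv
  · have : ContinuousOn (fun q : ℝ × ℝ => v2 q.1 q.2) {q : ℝ × ℝ | q.1 ∈ Ioc 0 T ∧ q.2 ∈ Ioo 0 (s q.1)} :=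
      fun q hq => (h.v2c q.1 hq.1.1 q.2 hq.2).continuousWithinAt
    exact this.congr fun q hq => (hd2 q.1 hq.1.1 q.2 hq.2).deriv
  · have : ContinuousOn (fun q : ℝ × ℝ => v1 q.1 q.2) {q : ℝ × ℝ | q.1 ∈ Ioc 0 T ∧ q.2 ∈ Icc 0 (s q.1)} :=
      fun q hq => (h.v1c q.1 hq.1.1 q.2).continuousWithinAt
    exact this.congr fun q hq => hd q.1 hq.1.1 q.2 hq.2

theorem TrSol.mono : MonotoneOn s (Ici 0) :=
  monotoneOn_of_hasDerivWithinAt_nonneg (convex_Ici 0) h.sc.continuousOn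
    (fun t ht => (h.sd t (by simpa using ht)).hasDerivWithinAt) (fun t ht => h.gn t (by simpa using ht))
end

structure GS (p s₀ : ℝ) (φ s : ℝ → ℝ) (u u1 u2 : ℝ → ℝ → ℝ) : Prop where
  sc : ContinuousOn s (Ici 0)
  spos : ∀ t, 0 ≤ t → 0 < s t
  sd : ∀ t, 0 < t → HasDerivAt s (deriv s t) t
  uc : ContinuousOn (fun q : ℝ × ℝ => u q.1 q.2) {q | 0 ≤ q.1 ∧ q.2 ∈ Icc 0 (s q.1)}
  un : ∀ t, 0 ≤ t → ∀ x ∈ Icc 0 (s t), 0 ≤ u t x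
  uz : ∀ t, 0 ≤ t → u t (s t) = 0
  ul : ∀ t, 0 < t → HasDerivWithinAt (u t) (-u t 0 ^ p) (Ici 0) 0
  ur : ∀ t, 0 < t → HasDerivWithinAt (u t) (-deriv s t) (Iic (s t)) (s t)
  ux : ∀ t, 0 < t → ∀ x ∈ Ioo 0 (s t), HasDerivAt (u t) (u1 t x) x
  uxx : ∀ t, 0 < t → ∀ x ∈ Ioo 0 (s t), HasDerivAt (u1 t) (u2 t x) x
  ut : ∀ t, 0 < t → ∀ x ∈ Ioo 0 (s t), HasDerivAt (fun τ => u τ x) (u2 t x) t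
  u1c : ∀ t, 0 < t → ∀ x ∈ Ioo 0 (s t), ContinuousAt (fun q : ℝ × ℝ => u1 q.1 q.2) (t, x)
  u2c : ∀ t, 0 < t → ∀ x ∈ Ioo 0 (s t), ContinuousAt (fun q : ℝ × ℝ => u2 q.1 q.2) (t, x)
  u0 : ∀ x ∈ Icc 0 s₀, u 0 x = φ x
  s0 : s 0 = s₀

theorem GS.of {p s₀ : ℝ} {φ s : ℝ → ℝ} {u : ℝ → ℝ → ℝ} (h : IsGlobalSol p s₀ φ s u)
    (hs : 0 < s₀) (hφ : φ s₀ = 0) :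
    GS p s₀ φ s u (fun t => deriv (u t)) (fun t => deriv (deriv (u t))) := by
  have hT : ∀ t : ℝ, 0 ≤ t → t + 1 > 0 := fun t ht => by linarith
  have m0 : ∀ t : ℝ, 0 ≤ t → t ∈ Icc 0 (t+1) := fun t ht => ⟨ht, by linarith⟩
  have m1 : ∀ t : ℝ, 0 < t → t ∈ Ioc 0 (t+1) := fun t ht => ⟨ht, by linarith⟩
  have sc : ContinuousOn s (Ici 0) := by
    intro t ht
    refine ((h (t+1) (hT t ht)).s_cont t (m0 t ht)).mono_of_mem_nhdsWithin ?_
    rw [← Ici_inter_Iic]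
    exact inter_mem_nhdsWithin _ (Iic_mem_nhds (by linarith))
  have uc : ContinuousOn (fun q : ℝ × ℝ => u q.1 q.2) {q | 0 ≤ q.1 ∧ q.2 ∈ Icc 0 (s q.1)} := by
    rintro ⟨t, x⟩ ⟨ht, hx⟩
    refine ((h (t+1) (hT t ht)).u_cont (t, x) ⟨m0 t ht, hx⟩).mono_of_mem_nhdsWithin ?_
    have : {q : ℝ × ℝ | q.1 < t + 1} ∈ 𝓝 (t, x) :=
      (isOpen_lt continuous_fst continuous_const).mem_nhds (by simp)
    filter_upwards [self_mem_nhdsWithin, mem_nhdsWithin_of_mem_nhds this] with q h1 h2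
    exact ⟨⟨h1.1, h2.le⟩, h1.2⟩
  have op : ∀ t, 0 < t → ∀ x ∈ Ioo 0 (s t), {q : ℝ × ℝ | q.1 ∈ Ioc 0 (t+1) ∧ q.2 ∈ Ioo 0 (s q.1)} ∈ 𝓝 (t, x) := by
    intro t ht x hx
    have c1 : ContinuousAt (fun q : ℝ × ℝ => s q.1) (t, x) :=
      ContinuousAt.comp (g := s) (f := Prod.fst) ((sc t ht.le).continuousAt (Ici_mem_nhds ht)) continuousAt_fst
    have e1 : ∀ᶠ q : ℝ × ℝ in 𝓝 (t, x), q.2 < s q.1 := continuousAt_snd.eventually_lt c1 hx.2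
    have e2 : ∀ᶠ q : ℝ × ℝ in 𝓝 (t, x), 0 < q.2 := continuousAt_snd.eventually (lt_mem_nhds hx.1)
    have e3 : ∀ᶠ q : ℝ × ℝ in 𝓝 (t, x), 0 < q.1 := continuousAt_fst.eventually (lt_mem_nhds ht)
    have e4 : ∀ᶠ q : ℝ × ℝ in 𝓝 (t, x), q.1 < t + 1 := continuousAt_fst.eventually (gt_mem_nhds (by simp))
    filter_upwards [e1, e2, e3, e4] with q a b c d using ⟨⟨c, d.le⟩, b, a⟩
  have ud : ∀ t, 0 < t → ∀ x ∈ Ioo 0 (s t), HasDerivAt (u t) (deriv (u t) x) x :=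
    fun t ht x hx => ((h _ (hT t ht.le)).ux_diff t (m1 t ht) x hx).hasDerivAt
  have uct : ∀ t, 0 ≤ t → ContinuousOn (u t) (Icc 0 (s t)) := by
    intro t ht
    exact uc.comp (f := fun x : ℝ => (t, x)) (by fun_prop) (fun x hx => ⟨ht, hx⟩)
  have u1t : ∀ t, 0 < t → ContinuousOn (deriv (u t)) (Icc 0 (s t)) := by
    intro t ht
    exact (h _ (hT t ht.le)).ux_cont.comp (f := fun x : ℝ => (t, x)) (by fun_prop) (fun x hx => ⟨m1 t ht, hx⟩)
  have spos : ∀ t, 0 ≤ t → 0 < s t := fun t ht => (h _ (hT t ht)).s_pos t (m0 t ht)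
  refine ⟨sc, spos, fun t ht => ((h _ (hT t ht.le)).s_diff t (m1 t ht)).hasDerivAt, uc,
    fun t ht => (h _ (hT t ht)).u_nonneg t (m0 t ht), ?_, ?_, ?_, ud, ?_, ?_, ?_, ?_,
    (h 1 one_pos).init, (h 1 one_pos).init_s⟩
  · intro t ht
    rcases ht.eq_or_lt with rfl | ht
    · have := (h 1 one_pos)
      rw [this.init_s, this.init s₀ ⟨hs.le, le_rfl⟩, hφ]
    · exact (h _ (hT t ht.le)).bc_free t (m1 t ht)
  · intro t ht
    have e := (h _ (hT t ht.le)).bc_zero t (m1 t ht)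
    have hst := spos t ht.le
    have e' : -u t 0 ^ p = deriv (u t) 0 := by linarith
    rw [e']
    refine hasDerivWithinAt_Ici_of_tendsto_deriv (s := Ioo 0 (s t))
      (fun y hy => (ud t ht y hy).differentiableAt.differentiableWithinAt)
      ((uct t ht.le 0 ⟨le_rfl, hst.le⟩).mono Ioo_subset_Icc_self) (Ioo_mem_nhdsGT hst) ?_
    have := (u1t t ht 0 ⟨le_rfl, hst.le⟩).mono (Ioo_subset_Icc_self)
    rwa [ContinuousWithinAt, nhdsWithin_Ioo_eq_nhdsGT hst] at this
  · intro t ht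
    have e := (h _ (hT t ht.le)).stefan t (m1 t ht)
    have hst := spos t ht.le
    rw [e, neg_neg]
    refine hasDerivWithinAt_Iic_of_tendsto_deriv (s := Ioo 0 (s t))
      (fun y hy => (ud t ht y hy).differentiableAt.differentiableWithinAt)
      ((uct t ht.le (s t) ⟨hst.le, le_rfl⟩).mono Ioo_subset_Icc_self) (Ioo_mem_nhdsLT hst) ?_
    have := (u1t t ht (s t) ⟨hst.le, le_rfl⟩).mono (Ioo_subset_Icc_self)
    rwa [ContinuousWithinAt, nhdsWithin_Ioo_eq_nhdsLT hst] at this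
  · exact fun t ht x hx => ((h _ (hT t ht.le)).uxx_diff t (m1 t ht) x hx).hasDerivAt
  · intro t ht x hx
    have := ((h _ (hT t ht.le)).ut_diff t (m1 t ht) x hx).hasDerivAt
    rwa [(h _ (hT t ht.le)).heat t (m1 t ht) x hx] at this
  · intro t ht x hx
    refine ((h _ (hT t ht.le)).ux_cont.mono ?_).continuousAt (op t ht x hx)
    exact fun q hq => ⟨hq.1, hq.2.1.le, hq.2.2.le⟩
  · exact fun t ht x hx => (h _ (hT t ht.le)).uxx_cont.continuousAt (op t ht x hx)

section
variable {p s₀ : ℝ} {φ s : ℝ → ℝ} {u u1 u2 : ℝ → ℝ → ℝ} (h : GS p s₀ φ s u u1 u2)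
include h

theorem GS.op {t x : ℝ} (ht : 0 < t) (hx : x ∈ Ioo 0 (s t)) :
    ∀ᶠ q : ℝ × ℝ in 𝓝 (t, x), 0 < q.1 ∧ q.2 ∈ Ioo 0 (s q.1) := by
  have c1 : ContinuousAt (fun q : ℝ × ℝ => s q.1) (t, x) :=
    ContinuousAt.comp (g := s) (f := Prod.fst) (h.sd t ht).continuousAt continuousAt_fst
  have e1 : ∀ᶠ q : ℝ × ℝ in 𝓝 (t, x), q.2 < s q.1 := continuousAt_snd.eventually_lt c1 hx.2
  have e2 : ∀ᶠ q : ℝ × ℝ in 𝓝 (t, x), 0 < q.2 := continuousAt_snd.eventually (lt_mem_nhds hx.1)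
  have e3 : ∀ᶠ q : ℝ × ℝ in 𝓝 (t, x), 0 < q.1 := continuousAt_fst.eventually (lt_mem_nhds ht)
  filter_upwards [e1, e2, e3] with q a b c using ⟨c, b, a⟩

theorem GS.chain {θ y : ℝ → ℝ} {t θ' y' : ℝ} (ht : 0 < θ t) (hx : y t ∈ Ioo 0 (s (θ t)))
    (hθ : HasDerivAt θ θ' t) (hy : HasDerivAt y y' t) :
    HasDerivAt (fun τ => u (θ τ) (y τ)) (u2 (θ t) (y t) * θ' + u1 (θ t) (y t) * y') t := by
  have hop := h.op ht hx
  have key := hasStrictFDerivAt_uncurry_coprod (𝕜 := ℝ) (u := (θ t, y t)) (f := u)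
    (f₁ := fun a b => ContinuousLinearMap.toSpanSingleton ℝ (u2 a b))
    (f₂ := fun a b => ContinuousLinearMap.toSpanSingleton ℝ (u1 a b))
    (by filter_upwards [hop] with q hq using (h.ut q.1 hq.1 q.2 hq.2).hasFDerivAt)
    (by filter_upwards [hop] with q hq using (h.ux q.1 hq.1 q.2 hq.2).hasFDerivAt)
    (by
      have := h.u2c _ ht _ hx
      exact ((ContinuousLinearMap.toSpanSingletonCLE (𝕜 := ℝ) (E := ℝ)).continuous.continuousAt.comp this))
    (by
      have := h.u1c _ ht _ hx
      exact ((ContinuousLinearMap.toSpanSingletonCLE (𝕜 := ℝ) (E := ℝ)).continuous.continuousAt.comp this))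
  have := key.hasFDerivAt.comp_hasDerivAt t (hθ.prodMk hy)
  refine this.congr_deriv ?_
  simp [Function.HasUncurry.uncurry, mul_comm]

theorem GS.sd_nn {t : ℝ} (ht : 0 < t) : 0 ≤ deriv s t := by
  have := deriv_nonneg_left (f := fun x => -u t x) (d := deriv s t) (t := s t)
    (by simpa using (h.ur t ht).fun_neg) (by
    filter_upwards [Ioo_mem_nhdsLT (h.spos t ht.le)] with y hy
    have := h.un t ht.le y ⟨hy.1.le, hy.2.le⟩
    rw [h.uz t ht.le]; linarith)
  exact this

theorem GS.mono : MonotoneOn s (Ici 0) :=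
  monotoneOn_of_hasDerivWithinAt_nonneg (convex_Ici 0) h.sc
    (fun t ht => (h.sd t (by simpa using ht)).hasDerivWithinAt) (fun t ht => h.sd_nn (by simpa using ht))

theorem GS.grad {M : ℝ} (hM : 0 ≤ M) (hφ : ∀ x ∈ Icc 0 s₀, ∀ y ∈ Icc 0 s₀, y ≤ x → φ x - φ y ≤ M * (x - y))
    {t x y : ℝ} (ht : 0 ≤ t) (hy : 0 ≤ y) (hyx : y ≤ x) (hx : x ≤ s t) :
    u t x - u t y ≤ (M + 1) * (x - y) := by
  suffices hs : ∀ ε > 0, u t x - u t y - (M + 1) * (x - y) ≤ ε * (1 + t) by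
    by_contra hc
    push Not at hc
    have := hs ((u t x - u t y - (M + 1) * (x - y)) / (2 * (1 + t))) (div_pos (by linarith) (by linarith))
    rw [div_mul_eq_mul_div, le_div_iff₀ (by linarith)] at this
    nlinarith
  intro ε hε
  by_contra hcon
  push Not at hcon
  set C : Set (ℝ × (ℝ × ℝ)) := {q | 0 ≤ q.1 ∧ q.1 ≤ t ∧ 0 ≤ q.2.2 ∧ q.2.2 ≤ q.2.1 ∧ q.2.1 ≤ s q.1} with hCdef
  have hsc : ContinuousOn s (Icc 0 t) := h.sc.mono Icc_subset_Ici_self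
  have hCc : IsCompact C := by
    have : C = (fun q : (ℝ × ℝ) × ℝ => (q.1.1, (q.1.2, q.2 * q.1.2))) '' ((Reg 0 t (fun _ => 0) s) ×ˢ Icc (0:ℝ) 1) := by
      ext ⟨t', x', y'⟩
      simp only [hCdef, Reg, mem_ofPred_eq, mem_image, mem_prod, Prod.mk.injEq, Prod.exists, mem_Icc]
      constructor
      · rintro ⟨a, b, c, d, e⟩
        refine ⟨t', x', y' / x', ⟨⟨⟨a, b⟩, c.trans d, e⟩, div_nonneg c (c.trans d), div_le_one_of_le₀ d (c.trans d)⟩, rfl, rfl, ?_⟩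
        rcases (c.trans d).eq_or_lt with h0 | h0
        · rw [← h0] at d ⊢; simp; linarith
        · field_simp
      · rintro ⟨a, b, k, ⟨⟨⟨h1, h2⟩, h3, h4⟩, h5, h6⟩, rfl, rfl, rfl⟩
        exact ⟨h1, h2, mul_nonneg h5 h3, mul_le_of_le_one_left h3 h6, h4⟩
    rw [this]
    exact ((isCompact_Reg continuousOn_const hsc (fun τ hτ => (h.spos τ hτ.1).le)).prod isCompact_Icc).image
      (by fun_prop)
  have hwc : ContinuousOn (fun q : ℝ × (ℝ × ℝ) => u q.1 q.2.1 - u q.1 q.2.2 - (M + 1) * (q.2.1 - q.2.2) - ε * (1 + q.1)) C := by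
    have c1 : ContinuousOn (fun q : ℝ × (ℝ × ℝ) => u q.1 q.2.1) C :=
      h.uc.comp (f := fun q : ℝ × (ℝ × ℝ) => (q.1, q.2.1)) (by fun_prop)
        (fun q hq => ⟨hq.1, hq.2.2.1.trans hq.2.2.2.1, hq.2.2.2.2⟩)
    have c2 : ContinuousOn (fun q : ℝ × (ℝ × ℝ) => u q.1 q.2.2) C :=
      h.uc.comp (f := fun q : ℝ × (ℝ × ℝ) => (q.1, q.2.2)) (by fun_prop)
        (fun q hq => ⟨hq.1, hq.2.2.1, hq.2.2.2.1.trans hq.2.2.2.2⟩)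
    exact ((c1.sub c2).sub (Continuous.continuousOn (by fun_prop))).sub (Continuous.continuousOn (by fun_prop))
  obtain ⟨⟨a, x1, y1⟩, ⟨ha, hat, hy1, hyx1, hx1⟩, hge, hpast, hmax⟩ := first_touch hCc hwc
    ⟨(t, x, y), ⟨ht, le_rfl, hy, hyx, hx⟩, by dsimp only; linarith⟩
  simp only at ha hat hy1 hyx1 hx1 hge hpast hmax
  have hε1 : 0 < ε * (1 + a) := by positivity
  have hlt : y1 < x1 := by
    rcases hyx1.eq_or_lt with h1 | h1
    · rw [h1] at hge; linarith
    · exact h1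
  have ha0 : 0 < a := by
    rcases ha.eq_or_lt with h1 | h1
    · subst h1
      rw [h.s0] at hx1
      rw [h.u0 x1 ⟨hy1.trans hyx1, hx1⟩, h.u0 y1 ⟨hy1, hyx1.trans hx1⟩] at hge
      have := hφ x1 ⟨hy1.trans hyx1, hx1⟩ y1 ⟨hy1, hyx1.trans hx1⟩ hyx1
      linarith
    · exact h1
  have hxs : x1 < s a := by
    rcases hx1.eq_or_lt with h1 | h1
    · rw [h1, h.uz a ha] at hge
      have := h.un a ha y1 ⟨hy1, hyx1.trans hx1⟩
      nlinarith
    · exact h1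
  rcases hy1.eq_or_lt with h0 | h0
  · subst h0
    have d1 : HasDerivWithinAt (fun y => u a x1 - u a y - (M+1) * (x1 - y)) (u a 0 ^ p + (M+1)) (Ici 0) 0 := by
      have := ((h.ul a ha0).const_sub (u a x1)).sub
        ((((hasDerivAt_id (0:ℝ)).const_sub x1).const_mul (M+1)).hasDerivWithinAt (s := Ici 0))
      exact this.congr_deriv (by ring)
    have := deriv_nonpos_right d1 (by
      filter_upwards [Ioo_mem_nhdsGT hlt] with y hy
      have := hmax (a, x1, y) ⟨ha, hat, hy.1.le, hy.2.le, hx1⟩ rfl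
      dsimp only at this
      linarith)
    have := Real.rpow_nonneg (h.un a ha 0 ⟨le_rfl, (h.spos a ha).le⟩) p
    linarith
  · have mx : x1 ∈ Ioo 0 (s a) := ⟨h0.trans hlt, hxs⟩
    have my : y1 ∈ Ioo 0 (s a) := ⟨h0, hlt.trans hxs⟩
    have k1 := deriv_nonneg_left (((((h.ut a ha0 x1 mx).sub (h.ut a ha0 y1 my)).sub_const ((M+1)*(x1-y1))).sub
      ((((hasDerivAt_id a).const_add 1).const_mul ε))).hasDerivWithinAt) (by
      filter_upwards [Reg_past (l := fun _ => 0) continuousOn_const hsc ⟨ha0, hat⟩ mx, self_mem_nhdsWithin] with τ h1 h2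
      have h3 := hpast (τ, x1, y1) ⟨h1.1.1, h1.1.2, hy1, hyx1, h1.2.2⟩ h2
      simp only [Pi.sub_apply, id_eq] at h3 ⊢
      linarith)
    have k2 := second_deriv_test (f := fun x => u a x - (M+1) * x) (g := fun x => u1 a x - (M+1))
      (x := x1) (b := u2 a x1) (by
        filter_upwards [Ioo_mem_nhds mx.1 mx.2] with z hz
        exact ((h.ux a ha0 z hz).sub ((hasDerivAt_id z).const_mul (M+1))).congr_deriv (by ring))
      ((h.uxx a ha0 x1 mx).sub_const _) (by
        filter_upwards [Ioo_mem_nhds hlt hxs] with z hz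
        have := hmax (a, z, y1) ⟨ha, hat, hy1, hz.1.le, hz.2.le⟩ rfl
        dsimp only at this
        linarith)
    have k3 := second_deriv_test (f := fun x => -u a x + (M+1) * x) (g := fun x => -u1 a x + (M+1))
      (x := y1) (b := -u2 a y1) (by
        filter_upwards [Ioo_mem_nhds my.1 my.2] with z hz
        exact ((h.ux a ha0 z hz).neg.add ((hasDerivAt_id z).const_mul (M+1))).congr_deriv (by ring))
      ((h.uxx a ha0 y1 my).neg.add_const _) (by
        filter_upwards [Ioo_mem_nhds h0 hlt] with z hz
        have := hmax (a, x1, z) ⟨ha, hat, hz.1.le, hz.2.le, hx1⟩ rfl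
        dsimp only at this
        linarith)
    linarith

theorem GS.u1_le {M : ℝ} (hM : 0 ≤ M) (hφ : ∀ x ∈ Icc 0 s₀, ∀ y ∈ Icc 0 s₀, y ≤ x → φ x - φ y ≤ M * (x - y))
    {t x : ℝ} (ht : 0 < t) (hx : x ∈ Ioo 0 (s t)) : u1 t x ≤ M + 1 := by
  have d : HasDerivWithinAt (fun z => u t z - (M+1) * z) (u1 t x - (M+1)) (Ici x) x :=
    (((h.ux t ht x hx).sub ((hasDerivAt_id x).const_mul (M+1))).congr_deriv (by ring)).hasDerivWithinAt
  have := deriv_nonpos_right d (by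
    filter_upwards [Ioo_mem_nhdsGT hx.2] with z hz
    have := h.grad hM hφ ht.le hx.1.le hz.1.le hz.2.le
    linarith)
  linarith
end

set_option linter.unusedSectionVars false
set_option linter.unusedVariables false

theorem rpow_tan {p a b : ℝ} (hp : 1 < p) (ha : 0 ≤ a) (hab : a ≤ b) :
    b ^ p ≤ a ^ p + p * b ^ (p - 1) * (b - a) := by
  rcases (ha.trans hab).eq_or_lt with h0 | h0
  · have : a = 0 := by linarith
    rw [← h0, this]; simp
  · have k := one_add_mul_self_le_rpow_one_add (s := a / b - 1) (by linarith [div_nonneg ha h0.le]) hp.le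
    rw [add_sub_cancel, Real.div_rpow ha h0.le, le_div_iff₀ (by positivity)] at k
    have e : b ^ p = b ^ (p - 1) * b := by
      rw [← Real.rpow_add_one h0.ne']; simp
    have e2 : (1 + p * (a / b - 1)) * b ^ p = b ^ p - p * b ^ (p-1) * (b - a) := by
      rw [e]; field_simp; ring
    linarith

theorem xexp_le {x : ℝ} (hx : 0 ≤ x) : x * exp (-x) / 2 ≤ 3/16 * (1 - exp (-x)) + exp (-x) / 2 := by
  have h1 := Real.quadratic_le_exp_of_nonneg hx
  have h2 : exp (-x) * exp x = 1 := by rw [← Real.exp_add]; simp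
  have h3 := exp_pos (-x)
  have h4 : 8 * x ≤ 3 * exp x + 5 := by nlinarith [sq_nonneg (x - 5/3)]
  have := mul_le_mul_of_nonneg_left h4 h3.le
  nlinarith

theorem heat_alg {N r z : ℝ} (hN : 0 < N) (hr : 0 < r) (hz : 0 ≤ z) {n e : ℝ} (hn : n = N + 2 * r)
    (he : e = exp (-(n * z))) :
    0 < (r^2/4 + N * n) * (1 - e) - r^3 * z * e + n^2 * e / 2 - N^2/16 - (r^2/4 + N*n)/16 := by
  have hn0 : 0 < n := by rw [hn]; positivity
  have hrn : 2 * r ≤ n := by linarith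
  have hNn : N ≤ n := by linarith
  have he0 : 0 < e := by rw [he]; exact exp_pos _
  have he1 : e ≤ 1 := by rw [he]; exact Real.exp_le_one_iff.2 (by nlinarith)
  have k := xexp_le (x := n * z) (by positivity)
  rw [← he] at k
  have k1 : r^3 * z * e ≤ r^2 * (n * z * e / 2) := by
    have : 0 ≤ r^2 * z * e := by positivity
    nlinarith
  have k2 := mul_le_mul_of_nonneg_left k (sq_nonneg r)
  have r4 : r^2 ≤ n^2/4 := by nlinarith
  have k3 : r^2 * (e/2) ≤ n^2 * e / 8 := by nlinarith
  have k4 : N^2 ≤ N * n * (1 - e) + n^2 * e := by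
    have a1 : N^2 ≤ N*n := by nlinarith
    have a2 : N*n*e ≤ n^2*e := by
      have : N*n ≤ n^2 := by nlinarith
      exact mul_le_mul_of_nonneg_right this he0.le
    nlinarith
  have k5 : r^2 ≤ r^2 * (1-e) + n^2*e/4 := by nlinarith
  have k6 : N*n ≤ N*n*(1-e) + n^2*e := by
    have a2 : N*n*e ≤ n^2*e := by
      have : N*n ≤ n^2 := by nlinarith
      exact mul_le_mul_of_nonneg_right this he0.le
    nlinarith
  have p1 : 0 ≤ r^2*(1-e) := mul_nonneg (sq_nonneg _) (by linarith)
  have p2 : 0 ≤ N*n*(1-e) := mul_nonneg (by positivity) (by linarith)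
  have p3 : 0 < n^2*e := by positivity
  linarith

structure Bar (N c T : ℝ) (r ε l l' θ : ℝ → ℝ) : Prop where
  N1 : 1 ≤ N
  rp : ∀ t ∈ Icc 0 T, 0 < r t
  rd : ∀ t ∈ Ioc 0 T, HasDerivAt r (-(r t)^3/2) t
  rc : ContinuousOn r (Icc 0 T)
  ep : ∀ t ∈ Icc 0 T, 0 < ε t
  eh : ∀ t ∈ Icc 0 T, ε t ≤ 1/2
  ed : ∀ t ∈ Ioc 0 T, HasDerivAt ε (((r t)^2/4 + N * (N + 2 * r t)) * ε t) t
  ec : ContinuousOn ε (Icc 0 T)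
  ce : ∀ t ∈ Icc 0 T, c * ε t ≤ 1
  c0 : 0 < c
  l1 : ∀ t ∈ Icc 0 T, 1 ≤ l t
  l2 : ∀ t ∈ Icc 0 T, (l t)^2 = 1 + c * ε t
  lc : ContinuousOn l (Icc 0 T)
  ld : ∀ t ∈ Ioc 0 T, HasDerivAt l (l' t) t
  ll : ∀ t ∈ Ioc 0 T, 2 * l t * l' t = c * (((r t)^2/4 + N * (N + 2 * r t)) * ε t)
  θ0 : θ 0 = 0
  θc : ContinuousOn θ (Icc 0 T)
  θd : ∀ t ∈ Ioc 0 T, HasDerivAt θ (1 / (l t)^2) t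
  θl : ∀ t ∈ Icc 0 T, t / 2 ≤ θ t
  θr : ∀ t ∈ Icc 0 T, θ t ≤ t

def VV (s : ℝ → ℝ) (u : ℝ → ℝ → ℝ) (N : ℝ) (r ε l θ : ℝ → ℝ) (t x : ℝ) : ℝ :=
  u (θ t) (x / l t) + ε t * (1 - exp (-((N + 2 * r t) * (s (θ t) - x / l t)))
    + exp (-(N * (x / l t))) - exp (-(N * s (θ t))))

section
variable {p s₀ : ℝ} {φ s : ℝ → ℝ} {u u1 u2 : ℝ → ℝ → ℝ} (h : GS p s₀ φ s u u1 u2)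
variable {N c T : ℝ} {r ε l l' θ : ℝ → ℝ} (B : Bar N c T r ε l l' θ)
include h B

theorem VV_cont : ContinuousOn (fun q : ℝ × ℝ => VV s u N r ε l θ q.1 q.2)
    (Reg 0 T (fun _ => 0) (fun t => l t * s (θ t))) := by
  set R := Reg 0 T (fun _ => 0) (fun t => l t * s (θ t))
  have f1 : ∀ g : ℝ → ℝ, ContinuousOn g (Icc 0 T) → ContinuousOn (fun q : ℝ × ℝ => g q.1) R :=
    fun g hg => hg.comp continuous_fst.continuousOn (fun q hq => hq.1)
  have cl := f1 l B.lc
  have cθ := f1 θ B.θc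
  have ce := f1 ε B.ec
  have cr := f1 r B.rc
  have cs : ContinuousOn (fun q : ℝ × ℝ => s (θ q.1)) R := h.sc.comp cθ (fun q hq => by
    have := B.θl _ hq.1; have := hq.1.1; simp only [mem_Ici]; linarith)
  have cy : ContinuousOn (fun q : ℝ × ℝ => q.2 / l q.1) R := continuousOn_snd.div cl
    (fun q hq => by have := B.l1 _ hq.1; positivity)
  have cu : ContinuousOn (fun q : ℝ × ℝ => u (θ q.1) (q.2 / l q.1)) R :=
    h.uc.comp (f := fun q : ℝ × ℝ => (θ q.1, q.2 / l q.1)) (cθ.prodMk cy) (fun q hq => by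
      have h1 := B.θl _ hq.1
      have h2 := hq.1.1
      have h3 := B.l1 _ hq.1
      refine ⟨by simp only; linarith, div_nonneg hq.2.1 (by linarith), ?_⟩
      simp only
      rw [div_le_iff₀ (by linarith), mul_comm]; exact hq.2.2)
  have k1 := (((continuousOn_const (c := N)).add ((continuousOn_const (c := 2)).mul cr)).mul (cs.sub cy)).neg.rexp
  have k2 := ((continuousOn_const (c := N)).mul cy).neg.rexp
  have k3 := ((continuousOn_const (c := N)).mul cs).neg.rexp
  exact cu.add (ce.mul ((((continuousOn_const (c := 1)).sub k1).add k2).sub k3))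

theorem VV_x {t x : ℝ} (ht : t ∈ Icc 0 T) {A : Set ℝ} {d : ℝ} 
    (hd : HasDerivWithinAt (fun x => u (θ t) (x / l t)) d A x) :
    HasDerivWithinAt (VV s u N r ε l θ t)
      (d + ε t * (-(N + 2 * r t) / l t * exp (-((N + 2 * r t) * (s (θ t) - x / l t)))
      - N / l t * exp (-(N * (x / l t))))) A x := by
  have hy : HasDerivAt (fun x : ℝ => x / l t) (1 / l t) x := (hasDerivAt_id x).div_const _
  have e1 := ((((hy.const_sub (s (θ t))).const_mul (N + 2 * r t))).fun_neg.exp).const_sub 1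
  have e2 := ((hy.const_mul N).fun_neg).exp
  have := hd.add ((((e1.add e2).sub_const (exp (-(N * s (θ t))))).const_mul (ε t)).hasDerivWithinAt (s := A))
  exact this.congr_deriv (by ring)

theorem VV_pos {t x : ℝ} (ht : t ∈ Icc 0 T) (hx : x ∈ Ico 0 (l t * s (θ t))) :
    0 < VV s u N r ε l θ t x := by
  have hl := B.l1 t ht
  have hN := B.N1
  have hr := B.rp t ht
  have hy0 : 0 ≤ x / l t := div_nonneg hx.1 (by linarith)
  have hy1 : x / l t < s (θ t) := by rw [div_lt_iff₀ (by linarith), mul_comm]; exact hx.2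
  have hu := h.un (θ t) (by linarith [B.θl t ht, ht.1]) _ ⟨hy0, hy1.le⟩
  have e1 : exp (-((N + 2 * r t) * (s (θ t) - x / l t))) < 1 := by
    rw [Real.exp_lt_one_iff, neg_lt_zero]; exact mul_pos (by linarith) (by linarith)
  have e2 : exp (-(N * s (θ t))) ≤ exp (-(N * (x / l t))) := by
    rw [Real.exp_le_exp]; nlinarith
  have := mul_pos (B.ep t ht) (show 0 < 1 - exp (-((N + 2 * r t) * (s (θ t) - x / l t)))
    + exp (-(N * (x / l t))) - exp (-(N * s (θ t))) by linarith)
  unfold VV; linarith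

theorem VV_le {t x : ℝ} (ht : t ∈ Icc 0 T) (hx : x ∈ Icc 0 (l t * s (θ t))) :
    VV s u N r ε l θ t x ≤ u (θ t) (x / l t) + 2 * ε t := by
  have hl := B.l1 t ht
  have hN := B.N1
  have hy0 : 0 ≤ x / l t := div_nonneg hx.1 (by linarith)
  have e2 : exp (-(N * (x / l t))) ≤ 1 := by
    rw [Real.exp_le_one_iff, neg_nonpos]; positivity
  have := mul_le_mul_of_nonneg_left (show 1 - exp (-((N + 2 * r t) * (s (θ t) - x / l t)))
    + exp (-(N * (x / l t))) - exp (-(N * s (θ t))) ≤ 2 by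
      linarith [exp_pos (-((N + 2 * r t) * (s (θ t) - x / l t))), exp_pos (-(N * s (θ t)))]) (B.ep t ht).le
  unfold VV; linarith

theorem VV_zero {t : ℝ} (ht : t ∈ Icc 0 T) : VV s u N r ε l θ t (l t * s (θ t)) = 0 := by
  have hl := B.l1 t ht
  have : l t * s (θ t) / l t = s (θ t) := by field_simp
  rw [VV, this, h.uz _ (by linarith [B.θl t ht, ht.1])]
  simp

theorem VV_free (hs0 : 0 < s₀) (hc : c = 4 / (N * s₀)) {t : ℝ} (ht : t ∈ Ioc 0 T) : ∃ Sd Vd,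
    HasDerivWithinAt (fun t => l t * s (θ t)) Sd (Iic t) t ∧
      HasDerivWithinAt (VV s u N r ε l θ t) Vd (Iic (l t * s (θ t))) (l t * s (θ t)) ∧ -Vd < Sd := by
  have ht' : t ∈ Icc 0 T := ⟨ht.1.le, ht.2⟩
  have hl := B.l1 t ht'
  have hl0 : 0 < l t := by linarith
  have hθ : 0 < θ t := by linarith [B.θl t ht', ht.1]
  have hN := B.N1
  have hr := B.rp t ht'
  have e0 : l t * s (θ t) / l t = s (θ t) := by field_simp
  have hsd := (h.sd (θ t) hθ)
  have d1 := (B.ld t ht).mul (hsd.comp t (B.θd t ht))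
  have hur := h.ur (θ t) hθ
  have d2 : HasDerivWithinAt (fun x => u (θ t) (x / l t)) (-deriv s (θ t) * (1 / l t))
      (Iic (l t * s (θ t))) (l t * s (θ t)) := by
    rw [← e0] at hur
    have hy : HasDerivWithinAt (fun x : ℝ => x / l t) (1 / l t) (Iic (l t * s (θ t))) (l t * s (θ t)) :=
      ((hasDerivAt_id _).div_const _).hasDerivWithinAt
    rw [e0] at hur
    refine HasDerivWithinAt.comp_of_eq (h₂ := u (θ t)) (h := fun x => x / l t) (l t * s (θ t)) (y := s (θ t)) hur hy ?_ e0.symm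
    · intro x hx
      simp only [mem_Iic] at hx ⊢
      rw [div_le_iff₀ hl0, mul_comm]; exact hx
  refine ⟨_, _, d1.hasDerivWithinAt, VV_x h B ht' d2, ?_⟩
  rw [e0]
  simp only [sub_self, mul_zero, neg_zero, exp_zero, mul_one, Function.comp_apply]
  have hst := h.spos (θ t) hθ.le
  have hmono : s₀ ≤ s (θ t) := by
    rw [← h.s0]; exact h.mono (by simp) hθ.le hθ.le
  have hε := B.ep t ht'
  have he : exp (-(N * s (θ t))) < 1 := by rw [Real.exp_lt_one_iff]; nlinarith
  have hll := B.ll t ht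
  set n := N + 2 * r t
  set K := (r t)^2/4 + N * n
  have key : ε t * (n + N * exp (-(N * s (θ t)))) < l t * l' t * s (θ t) := by
    have a1 : l t * l' t = c * K * ε t / 2 := by linarith
    have a2 : 2 * n ≤ c * K * s₀ / 2 := by
      have : c * (N * n) * s₀ / 2 = 2 * n := by rw [hc]; field_simp; ring
      have : 0 ≤ c * (r t^2/4) * s₀ / 2 := by have := B.c0; positivity
      simp only [K]; linarith
    have a3 : N * exp (-(N * s (θ t))) < n := by simp only [n]; nlinarith
    have hK : 0 < c * K * ε t / 2 := by have := B.c0; positivity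
    rw [a1]
    calc ε t * (n + N * exp (-(N * s (θ t)))) < ε t * (2 * n) := by
          apply mul_lt_mul_of_pos_left _ hε; linarith
      _ ≤ ε t * (c * K * s₀ / 2) := by gcongr
      _ = c * K * ε t / 2 * s₀ := by ring
      _ ≤ _ := by gcongr
  have k2 : l' t * s (θ t) - ε t * (n + N * exp (-(N * s (θ t)))) / l t > 0 := by
    have : 0 < (l t * l' t * s (θ t) - ε t * (n + N * exp (-(N * s (θ t))))) / l t := div_pos (by linarith) hl0
    calc _ = (l t * l' t * s (θ t) - ε t * (n + N * exp (-(N * s (θ t))))) / l t := by field_simp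
      _ > 0 := this
  have e3 : l t * (deriv s (θ t) * (1 / l t ^ 2)) = deriv s (θ t) * (1 / l t) := by field_simp
  rw [e3]
  have e4 : ε t * (-n / l t - N / l t * exp (-(N * s (θ t)))) = - (ε t * (n + N * exp (-(N * s (θ t)))) / l t) := by
    field_simp; ring
  rw [e4]
  linarith

theorem VV_flux (hp : 1 < p) (hs0 : 0 < s₀) (hc : c = 4 / (N * s₀)) {H : ℝ} {t : ℝ} (ht : t ∈ Ioc 0 T)
    (hH : u (θ t) 0 + 1 ≤ H) (hNH : 2 * p * H ^ (p-1) + 2 * H ^ p / s₀ < N) :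
    ∃ d, HasDerivWithinAt (VV s u N r ε l θ t) d (Ici 0) 0 ∧ VV s u N r ε l θ t 0 ^ p < -d := by
  have ht' : t ∈ Icc 0 T := ⟨ht.1.le, ht.2⟩
  have hl := B.l1 t ht'
  have hl0 : 0 < l t := by linarith
  have hθ : 0 < θ t := by linarith [B.θl t ht', ht.1]
  have hN := B.N1
  have hr := B.rp t ht'
  have hε := B.ep t ht'
  have hst := h.spos (θ t) hθ.le
  have d2 : HasDerivWithinAt (fun x => u (θ t) (x / l t)) (-u (θ t) 0 ^ p * (1 / l t)) (Ici 0) 0 := by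
    have hy : HasDerivWithinAt (fun x : ℝ => x / l t) (1 / l t) (Ici 0) 0 :=
      ((hasDerivAt_id _).div_const _).hasDerivWithinAt
    refine HasDerivWithinAt.comp_of_eq (h₂ := u (θ t)) (h := fun x => x / l t) 0 (y := 0) (h.ul _ hθ) hy ?_ (by simp)
    intro x hx
    exact div_nonneg hx hl0.le
  refine ⟨_, VV_x h B ht' d2, ?_⟩
  have hle := VV_le h B ht' (x := 0) ⟨le_rfl, by positivity⟩
  have hpos := VV_pos h B ht' (x := 0) ⟨le_rfl, by positivity⟩
  simp only [zero_div, mul_zero, neg_zero, exp_zero, sub_zero, mul_one] at hle ⊢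
  have hu := h.un (θ t) hθ.le 0 ⟨le_rfl, hst.le⟩
  set a := u (θ t) 0
  have heh := B.eh t ht'
  have b1 : VV s u N r ε l θ t 0 ^ p ≤ (a + 2 * ε t) ^ p := Real.rpow_le_rpow hpos.le hle (by linarith)
  have b2 := rpow_tan hp hu (show a ≤ a + 2 * ε t by linarith)
  have b3 : (a + 2 * ε t) ^ (p-1) ≤ H ^ (p-1) := Real.rpow_le_rpow (by linarith) (by linarith) (by linarith)
  have b4 : (a + 2 * ε t) ^ p ≤ H ^ p := Real.rpow_le_rpow (by linarith) (by linarith) (by linarith)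
  have hH0 : 0 ≤ H := by linarith
  have b5 : l t - 1 ≤ 2 * ε t / s₀ := by
    have q1 := B.l2 t ht'
    have q2 : l t - 1 ≤ c * ε t / 2 := by nlinarith
    have q3 : c * ε t / 2 ≤ 2 * ε t / s₀ := by
      rw [hc, div_mul_eq_mul_div, div_div, div_le_div_iff₀ (by positivity) hs0]
      nlinarith [mul_pos hε hs0]
    linarith
  have b6 : l t * (a + 2 * ε t) ^ p < a ^ p + ε t * N := by
    have q1 : p * (a + 2 * ε t) ^ (p-1) * (a + 2 * ε t - a) ≤ p * H ^ (p-1) * (2 * ε t) := by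
      rw [add_sub_cancel_left]; gcongr
    have q2 : (l t - 1) * (a + 2 * ε t) ^ p ≤ 2 * ε t / s₀ * H ^ p := by
      apply mul_le_mul b5 b4 (by positivity) (by positivity)
    have q3 := mul_lt_mul_of_pos_left hNH hε
    have q4 : ε t * (2 * p * H ^ (p-1) + 2 * H ^ p / s₀) = p * H ^ (p-1) * (2 * ε t) + 2 * ε t / s₀ * H ^ p := by ring
    linarith
  have b7 : (a + 2 * ε t) ^ p < (a ^ p + ε t * N) / l t := by rw [lt_div_iff₀ hl0]; linarith
  have b8 : 0 < ε t * ((N + 2 * r t) / l t * exp (-((N + 2 * r t) * s (θ t)))) := by positivity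
  have b9 : (a ^ p + ε t * N) / l t = a ^ p * (1 / l t) + ε t * (N / l t) := by field_simp
  have b10 : -(-a ^ p * (1 / l t) + ε t * (-(N + 2 * r t) / l t * exp (-((N + 2 * r t) * s (θ t))) - N / l t)) =
     a ^ p * (1 / l t) + ε t * (N / l t) + ε t * ((N + 2 * r t) / l t * exp (-((N + 2 * r t) * s (θ t)))) := by ring
  rw [b10]; linarith

set_option maxHeartbeats 800000 in
theorem VV_heat (hs0 : 0 < s₀) (hc : c = 4 / (N * s₀)) {M smax : ℝ} (hM : 0 ≤ M)
    (hφ : ∀ x ∈ Icc 0 s₀, ∀ y ∈ Icc 0 s₀, y ≤ x → φ x - φ y ≤ M * (x - y))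
    (hsm : ∀ t, 0 ≤ t → s t ≤ smax) (hN2 : 32 * smax * (M + 1) / s₀ ≤ N) (hN3 : exp (-(N * s₀)) ≤ 1/16)
    {t x : ℝ} (ht : t ∈ Ioc 0 T) (hx : x ∈ Ioo 0 (l t * s (θ t))) :
    ∃ vt vxx, D12 (VV s u N r ε l θ) t x vt vxx ∧ vxx < vt := by
  have ht' : t ∈ Icc 0 T := ⟨ht.1.le, ht.2⟩
  have hl := B.l1 t ht'
  have hl0 : 0 < l t := by linarith
  have hθ : 0 < θ t := by linarith [B.θl t ht', ht.1]
  have hN := B.N1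
  have hr := B.rp t ht'
  have hε := B.ep t ht'
  have hst := h.spos (θ t) hθ.le
  have hy : x / l t ∈ Ioo 0 (s (θ t)) :=
    ⟨div_pos hx.1 hl0, by rw [div_lt_iff₀ hl0, mul_comm]; exact hx.2⟩
  have hyd : HasDerivAt (fun τ => x / l τ) (-(x / l t * l' t / l t)) t := by
    have := (hasDerivAt_const t x).div (B.ld t ht) hl0.ne'
    refine this.congr_deriv ?_
    field_simp; ring
  have hsθ := (h.sd (θ t) hθ).comp t (B.θd t ht)
  have dn : HasDerivAt (fun τ => N + 2 * r τ) (-(r t)^3) t :=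
    (((B.rd t ht).const_mul 2).const_add N).congr_deriv (by ring)
  have t1 := h.chain hθ hy (B.θd t ht) hyd
  have e1 := ((dn.mul (hsθ.sub hyd)).fun_neg.exp).const_sub 1
  have e2 := ((hyd.const_mul N).fun_neg).exp
  have e3 := ((hsθ.const_mul N).fun_neg).exp
  have tt := t1.add ((B.ed t ht).mul ((e1.add e2).sub e3))
  have yx : ∀ z : ℝ, HasDerivAt (fun x : ℝ => x / l t) (1 / l t) z := fun z => (hasDerivAt_id z).div_const _
  have x1 : ∀ᶠ z in 𝓝 x, HasDerivAt (VV s u N r ε l θ t) (u1 (θ t) (z / l t) * (1 / l t) +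
      ε t * (-(N + 2 * r t) / l t * exp (-((N + 2 * r t) * (s (θ t) - z / l t)))
      - N / l t * exp (-(N * (z / l t))))) z := by
    filter_upwards [Ioo_mem_nhds hx.1 hx.2] with z hz
    have hz' : z / l t ∈ Ioo 0 (s (θ t)) :=
      ⟨div_pos hz.1 hl0, by rw [div_lt_iff₀ hl0, mul_comm]; exact hz.2⟩
    have := HasDerivAt.comp z (h.ux (θ t) hθ _ hz') (yx z)
    have k := VV_x h B ht' (A := univ) (x := z) this.hasDerivWithinAt
    rwa [hasDerivWithinAt_univ] at k
  have xx1 := (HasDerivAt.comp x (h.uxx (θ t) hθ _ hy) (yx x)).mul_const (1 / l t)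
  have xx2 := ((((yx x).const_sub (s (θ t))).const_mul (N + 2 * r t)).fun_neg.exp).const_mul (-(N + 2 * r t) / l t)
  have xx3 := (((yx x).const_mul N).fun_neg.exp).const_mul (N / l t)
  have xx := xx1.add ((xx2.sub xx3).const_mul (ε t))
  refine ⟨_, _, ⟨tt, _, x1, xx⟩, ?_⟩
  simp only [Pi.sub_apply, Pi.add_apply, Pi.mul_apply, Function.comp_apply]
  have hz : 0 ≤ s (θ t) - x / l t := by linarith [hy.2]
  have hu1 := h.u1_le hM hφ hθ hy
  have hsd := h.sd_nn hθ
  have hmono : s₀ ≤ s (θ t) := by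
    rw [← h.s0]; exact h.mono (by simp) hθ.le hθ.le
  have halg := heat_alg (N := N) (r := r t) (by linarith) hr hz rfl rfl
  have hll := B.ll t ht
  have hl2 := B.l2 t ht'
  have hce := B.ce t ht'
  have hsm' := hsm _ hθ.le
  have hD : exp (-(N * s (θ t))) ≤ 1/16 := le_trans (Real.exp_le_exp.2 (neg_le_neg (mul_le_mul_of_nonneg_left hmono (by linarith)))) hN3
  have hED : exp (-(N * s (θ t))) ≤ exp (-(N * (x / l t))) := Real.exp_le_exp.2 (neg_le_neg (mul_le_mul_of_nonneg_left hy.2.le (by linarith)))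
  have hD0 := exp_pos (-(N * s (θ t)))
  set y := x / l t with hydef
  set z := s (θ t) - y with hzdef
  set n := N + 2 * r t with hndef
  set e := exp (-(n * z)) with hedef
  set E := exp (-(N * y)) with hEdef
  set D := exp (-(N * s (θ t))) with hDdef
  set K := (r t)^2/4 + N * n with hKdef
  set s' := deriv s (θ t)
  have he0 : 0 < e := exp_pos _
  have hn0 : 0 < n := by simp only [hndef]; linarith
  have hK0 : 0 < K := by simp only [hKdef]; positivity
  have hKN : N^2 ≤ K := by simp only [hKdef, hndef]; linarith [sq_nonneg (r t), mul_pos (show 0 < N by linarith) hr]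
  have hlp : 0 ≤ l' t := by
    have : 0 ≤ 2 * l t * l' t := by rw [hll]; have := B.c0; positivity
    exact (mul_nonneg_iff_of_pos_left (by linarith)).1 this
  -- loss
  set q := y * l' t / l t with hqdef
  have hq0 : 0 ≤ q := by have := hy.1; positivity
  have hq : q * (M + 1) ≤ ε t * (K / 16) := by
    have a1 : q ≤ smax * (c * (K * ε t) / 2) := by
      have : l' t ≤ c * (K * ε t) / 2 := by linarith [le_mul_of_one_le_left hlp hl]
      have h2 : q ≤ y * l' t := by
        simp only [hqdef]; exact div_le_self (mul_nonneg hy.1.le hlp) hl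
      have h3 : y * l' t ≤ smax * (c * (K * ε t) / 2) := mul_le_mul (by linarith [hy.2]) this hlp (by linarith [hy.1, hy.2])
      linarith
    have a2 : smax * (c * (K * ε t) / 2) * (M + 1) = ε t * K * (2 * smax * (M+1) / s₀ / N) := by
      rw [hc]; field_simp; ring
    have a3 : 2 * smax * (M+1) / s₀ / N ≤ 1 / 16 := by
      rw [div_le_div_iff₀ (by linarith) (by norm_num)]
      have : 32 * smax * (M + 1) / s₀ = 2 * smax * (M+1) / s₀ * 16 := by ring
      linarith
    calc q * (M + 1) ≤ smax * (c * (K * ε t) / 2) * (M + 1) := mul_le_mul_of_nonneg_right a1 (by linarith)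
      _ = ε t * K * (2 * smax * (M+1) / s₀ / N) := a2
      _ ≤ ε t * K * (1/16) := by gcongr
      _ = _ := by ring
  have hq' : u1 (θ t) y * q ≤ ε t * (K / 16) := by
    have := mul_le_mul_of_nonneg_right hu1 hq0
    linarith
  -- main bracket
  have hL : 1 / 2 ≤ 1 / (l t)^2 := one_div_le_one_div_of_le (by positivity) (by linarith)
  have hL1 : 1 / (l t)^2 ≤ 1 := by rw [div_le_one (by positivity)]; exact one_le_pow₀ hl
  set L := 1 / (l t)^2 with hLdef
  have hs'L : 0 ≤ s' * L := mul_nonneg hsd (by linarith)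
  have b1 : N^2 * (E - D) ≤ K * (E - D) := mul_le_mul_of_nonneg_right hKN (by linarith)
  have b2 : N^2 * E * L ≤ N^2 * E := mul_le_of_le_one_right (by positivity) hL1
  have b3 : n^2 * e / 2 ≤ n^2 * e * L := by
    have := mul_le_mul_of_nonneg_left hL (show 0 ≤ n^2*e by positivity)
    linarith
  have b4 : N^2 * D ≤ N^2 * (1/16) := mul_le_mul_of_nonneg_left hD (by positivity)
  have b5 : 0 ≤ e * n * (s' * L + q) := by positivity
  have b6 : 0 ≤ N * q * E := by positivity
  have b7 : 0 ≤ N * (s' * L) * D := by positivity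
  have b8 : 0 < K * (1 - e + E - D) - r t^3 * z * e + e * n * (s' * L + q) + N * q * E + N * (s' * L) * D
      + n^2 * e * L - N^2 * E * L - K / 16 := by linarith
  have b9 := mul_pos hε b8
  have c1 : 1 / l t * (1 / l t) = L := by rw [hLdef]; field_simp
  have c2 : -n / l t * (1 / l t) = -n * L := by rw [hLdef]; field_simp
  have c3 : N / l t * (1 / l t) = N * L := by rw [hLdef]; field_simp
  have L1 : u2 (θ t) y * (1 / l t) * (1 / l t) +
      ε t * (-n / l t * (e * -(n * -(1 / l t))) - N / l t * (E * -(N * (1 / l t))))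
      = u2 (θ t) y * L + ε t * (-(n^2 * e * L) + N^2 * E * L) := by
    rw [mul_assoc, c1]
    have : -n / l t * (e * -(n * -(1 / l t))) = (-n / l t * (1 / l t)) * (n * e) := by ring
    rw [this, c2]
    have : N / l t * (E * -(N * (1 / l t))) = -(N / l t * (1 / l t)) * (N * E) := by ring
    rw [this, c3]; ring
  refine lt_of_eq_of_lt L1 ?_
  linarith
end

theorem bar_exists {N s₀ T τ : ℝ} (hN : 1 ≤ N) (hs0 : 0 < s₀) (hT : 0 < T) (hτ : 0 < τ) :
    ∃ d r ε l l' θ, 0 < d ∧ 4 * d / s₀ ≤ 1 ∧ Bar N (4 / (N * s₀)) T r ε l l' θ ∧ (∀ t ∈ Icc 0 T, ε t ≤ τ) ∧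
      ε 0 = N * d ∧ r 0 = 1 / d := by
  set c := 4 / (N * s₀) with hc
  have hc0 : 0 < c := by positivity
  set A := exp (log (T+1) / 4 + N^2 * T + 4 * N * √(T+1)) with hA
  have hA0 : 0 < A := exp_pos _
  set τ' := min τ (min (1/2) (1/c)) with hτ'
  have hτ0 : 0 < τ' := lt_min hτ (lt_min (by norm_num) (by positivity))
  set g := min 1 (τ' / (N * A)) with hg
  have hg0 : 0 < g := lt_min one_pos (by positivity)
  have hg1 : g ≤ 1 := min_le_left _ _
  have hgτ : N * A * g ≤ τ' := by
    have : g ≤ τ' / (N * A) := min_le_right _ _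
    rw [le_div_iff₀ (by positivity)] at this
    linarith
  set d := g^2 with hd
  have hd0 : 0 < d := by positivity
  have hd1 : d ≤ 1 := pow_le_one₀ hg0.le hg1
  have hQ : ∀ t : ℝ, 0 ≤ t → 0 < t + d^2 := fun t ht => by positivity
  set r : ℝ → ℝ := fun t => (√(t + d^2))⁻¹ with hr
  set ε : ℝ → ℝ := fun t => N * d * exp ((log (t + d^2) - log (d^2)) / 4 + N^2 * t + 4 * N * (√(t + d^2) - d)) with hε
  have hε0 : ∀ t, 0 < ε t := fun t => by simp only [hε]; positivity
  have hεle : ∀ t ∈ Icc 0 T, ε t ≤ τ' := by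
    intro t ht
    refine le_trans ?_ hgτ
    have e1 : log (t + d^2) ≤ log (T + 1) := by
      apply Real.log_le_log (hQ t ht.1)
      have : d^2 ≤ 1 := pow_le_one₀ hd0.le hd1
      linarith [ht.2]
    have e2 : log (d^2) = 4 * log g := by
      rw [hd, ← pow_mul, Real.log_pow]; norm_num
    have e3 : √(t + d^2) ≤ √(T+1) := by
      apply Real.sqrt_le_sqrt
      have : d^2 ≤ 1 := pow_le_one₀ hd0.le hd1
      linarith [ht.2]
    have e4 : N^2 * t ≤ N^2 * T := by have := ht.2; gcongr
    have e5 : 4 * N * (√(t + d^2) - d) ≤ 4 * N * √(T+1) := by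
      apply mul_le_mul_of_nonneg_left _ (by positivity); linarith
    have e6 : exp ((log (t + d^2) - log (d^2)) / 4 + N^2 * t + 4 * N * (√(t + d^2) - d)) ≤ A / g := by
      have : A / g = exp (log (T+1) / 4 + N^2 * T + 4 * N * √(T+1) - log g) := by
        rw [Real.exp_sub, Real.exp_log hg0]
      rw [this]
      apply Real.exp_le_exp.2
      rw [e2]; linarith
    calc ε t ≤ N * d * (A / g) := by simp only [hε]; gcongr
      _ = N * A * g := by rw [hd]; field_simp
  have hsd : ∀ t : ℝ, 0 ≤ t → HasDerivAt (fun t => √(t + d^2)) (r t / 2) t := by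
    intro t ht
    have := ((hasDerivAt_id t).add_const (d^2)).sqrt (hQ t ht).ne'
    refine this.congr_deriv ?_
    simp only [hr, id]; field_simp
  have hrd : ∀ t : ℝ, 0 ≤ t → HasDerivAt r (-(r t)^3/2) t := by
    intro t ht
    have h0 : √(t + d^2) ≠ 0 := (Real.sqrt_pos.2 (hQ t ht)).ne'
    have := (hsd t ht).inv h0
    refine this.congr_deriv ?_
    simp only [hr]; field_simp
  have hεd : ∀ t : ℝ, 0 ≤ t → HasDerivAt ε (((r t)^2/4 + N * (N + 2 * r t)) * ε t) t := by
    intro t ht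
    have l1 := ((hasDerivAt_id t).add_const (d^2)).log (hQ t ht).ne'
    have l2 := (((l1.sub_const (log (d^2))).div_const 4).add ((hasDerivAt_id t).const_mul (N^2))).add
      (((hsd t ht).sub_const d).const_mul (4 * N))
    have := l2.exp.const_mul (N * d)
    refine this.congr_deriv ?_
    have hr2 : (r t)^2 = 1 / (t + d^2) := by
      simp only [hr]; rw [inv_pow, Real.sq_sqrt (hQ t ht).le, one_div]
    rw [hr2]
    simp only [hε, id, Pi.add_apply]; ring
  set l : ℝ → ℝ := fun t => √(1 + c * ε t) with hl
  have h1c : ∀ t, 0 < 1 + c * ε t := fun t => by have := hε0 t; positivity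
  have hl0 : ∀ t, 0 < l t := fun t => Real.sqrt_pos.2 (h1c t)
  set l' : ℝ → ℝ := fun t => c * (((r t)^2/4 + N * (N + 2 * r t)) * ε t) / (2 * l t) with hl'
  have hld : ∀ t : ℝ, 0 ≤ t → HasDerivAt l (l' t) t := by
    intro t ht
    exact (((hεd t ht).const_mul c).const_add 1).sqrt (h1c t).ne'
  have hl2 : ∀ t, (l t)^2 = 1 + c * ε t := fun t => Real.sq_sqrt (h1c t).le
  have hlc : ContinuousOn l (Ici 0) := fun t ht => (hld t ht).continuousAt.continuousWithinAt
  set f : ℝ → ℝ := fun t => 1 / (l (max t 0))^2 with hf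
  have hfc : Continuous f := by
    have : Continuous fun t : ℝ => l (max t 0) :=
      hlc.comp_continuous (by fun_prop) (fun t => mem_Ici.2 (le_max_right _ _))
    exact continuous_const.div (this.pow 2) (fun t => by have := hl0 (max t 0); positivity)
  set θ : ℝ → ℝ := fun t => ∫ τ in (0:ℝ)..t, f τ with hθ
  have hθd : ∀ t, HasDerivAt θ (f t) t := fun t =>
    intervalIntegral.integral_hasDerivAt_right (hfc.intervalIntegrable _ _) (hfc.stronglyMeasurableAtFilter _ _) hfc.continuousAt
  have hce : ∀ t ∈ Icc 0 T, c * ε t ≤ 1 := by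
    intro t ht
    have h1 := hεle t ht
    have h2 : τ' ≤ 1 / c := (min_le_right _ _).trans (min_le_right _ _)
    have : ε t ≤ 1 / c := h1.trans h2
    rw [le_div_iff₀ hc0] at this; linarith
  have hfb : ∀ t ∈ Icc 0 T, 1/2 ≤ f t ∧ f t ≤ 1 := by
    intro t ht
    have h1 := hce t ht
    have h2 := mul_pos hc0 (hε0 t)
    simp only [hf]
    rw [max_eq_left ht.1, hl2]
    exact ⟨one_div_le_one_div_of_le (by linarith) (by linarith), by rw [div_le_one (by linarith)]; linarith⟩
  have hε00 : ε 0 = N * d := by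
    simp only [hε]; simp [Real.sqrt_sq hd0.le]
  refine ⟨d, r, ε, l, l', θ, hd0, ?_, ⟨hN, fun t ht => inv_pos.2 (Real.sqrt_pos.2 (hQ t ht.1)), fun t ht => hrd t ht.1.le,
    fun t ht => (hrd t ht.1).continuousAt.continuousWithinAt, fun t _ => hε0 t,
    fun t ht => (hεle t ht).trans ((min_le_right _ _).trans (min_le_left _ _)), fun t ht => hεd t ht.1.le,
    fun t ht => (hεd t ht.1).continuousAt.continuousWithinAt, hce, hc0, ?_, fun t _ => hl2 t,
    hlc.mono Icc_subset_Ici_self, fun t ht => hld t ht.1.le, ?_, ?_, fun t _ => (hθd t).continuousAt.continuousWithinAt,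
    ?_, ?_, ?_⟩, fun t ht => (hεle t ht).trans (min_le_left _ _), hε00, ?_⟩
  · have := hce 0 ⟨le_rfl, hT.le⟩
    rw [hε00, hc] at this
    calc 4 * d / s₀ = 4 / (N * s₀) * (N * d) := by field_simp
      _ ≤ 1 := this
  · intro t _
    rw [hl, Real.one_le_sqrt]; linarith [mul_pos hc0 (hε0 t)]
  · intro t _
    have := hl0 t
    simp only [hl']; field_simp
  · simp [hθ]
  · intro t ht
    have := hθd t
    simp only [hf] at this
    rwa [max_eq_left ht.1.le] at this
  · intro t ht
    have := intervalIntegral.integral_mono_on (a := 0) (b := t) (μ := volume) ht.1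
      (f := fun _ => (1/2 : ℝ)) (g := f) (by simp) (hfc.intervalIntegrable _ _)
      (fun x hx => (hfb x ⟨hx.1, hx.2.trans ht.2⟩).1)
    simp at this
    simp only [hθ]; linarith
  · intro t ht
    have := intervalIntegral.integral_mono_on (a := 0) (b := t) (μ := volume) ht.1
      (g := fun _ => (1 : ℝ)) (f := f) (hfc.intervalIntegrable _ _) (by simp)
      (fun x hx => (hfb x ⟨hx.1, hx.2.trans ht.2⟩).2)
    simpa using this
  · simp [hr, Real.sqrt_sq hd0.le]

theorem phase1 {p s₀ : ℝ} {φ s : ℝ → ℝ} {u u1 u2 : ℝ → ℝ → ℝ} (h : GS p s₀ φ s u u1 u2) (hp : 1 < p)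
    (hs0 : 0 < s₀) {M smax : ℝ} (hM : 0 ≤ M)
    (hφ : ∀ x ∈ Icc 0 s₀, ∀ y ∈ Icc 0 s₀, y ≤ x → φ x - φ y ≤ M * (x - y))
    (hsm : ∀ t, 0 ≤ t → s t ≤ smax) {T H κ : ℝ} (hT : 0 < T) (hκ : 0 < κ)
    (hH : ∀ t ∈ Icc 0 T, u t 0 + 1 ≤ H) :
    ∃ η > 0, ∀ σ v, SubSol p 0 T σ v → σ 0 < s₀ + η →
      (∀ x ∈ Icc 0 (σ 0), v 0 x < extZero s₀ φ x + η) → ∀ t ∈ Icc 0 T, σ t < 2 * smax ∧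
      ∀ x ∈ Icc 0 (σ t), ∃ θ y, t / 2 ≤ θ ∧ θ ≤ t ∧ y ∈ Icc 0 (s θ) ∧ v t x < u θ y + κ := by
  have hsm0 : 0 < smax := (h.spos 0 le_rfl).trans_le (hsm 0 le_rfl)
  have hH1 : 0 < H := by
    have := hH 0 ⟨le_rfl, hT.le⟩
    have := h.un 0 le_rfl 0 ⟨le_rfl, (h.spos 0 le_rfl).le⟩
    linarith
  obtain ⟨N, hN⟩ : ∃ N, N = 1 + 32 * smax * (M + 1) / s₀ + (2 * p * H ^ (p-1) + 2 * H ^ p / s₀) + 4 * M + 16 / s₀ := ⟨_, rfl⟩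
  have q1 : 0 < 32 * smax * (M + 1) / s₀ := by positivity
  have q2 : 0 < 2 * p * H ^ (p-1) + 2 * H ^ p / s₀ := by positivity
  have q3 : 0 < 16 / s₀ := by positivity
  have hN1 : 1 ≤ N := by linarith
  have hN3 : exp (-(N * s₀)) ≤ 1/16 := by
    have : 16 ≤ N * s₀ := by
      have : 16 / s₀ ≤ N := by linarith
      rwa [div_le_iff₀ hs0] at this
    rw [Real.exp_neg, ← one_div]
    exact one_div_le_one_div_of_le (by norm_num) (by linarith [Real.add_one_le_exp (N * s₀)])
  obtain ⟨d, r, ε, l, l', θ, hd, hd1, B, hτ, hε0, hr0⟩ := bar_exists hN1 hs0 hT (show 0 < κ / 2 by positivity)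
  refine ⟨d / 3, by positivity, ?_⟩
  intro σ v hv hσ hψ
  have h0 : (0:ℝ) ∈ Icc 0 T := ⟨le_rfl, hT.le⟩
  have hθ0 : ∀ t ∈ Icc 0 T, 0 ≤ θ t := fun t ht => by linarith [B.θl t ht, ht.1]
  have hll : ∀ t ∈ Icc 0 T, l t ≤ 2 := fun t ht => by
    have := B.l2 t ht; have := B.ce t ht; have := B.l1 t ht; nlinarith
  have hl01 := B.l1 0 h0
  have hl02 := hll 0 h0
  have hl0 : (l 0)^2 = 1 + 4 * d / s₀ := by
    rw [B.l2 0 h0, hε0]; field_simp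
  have a1 : (l 0 - 1) * (l 0 + 1) * s₀ = 4 * d := by
    have : (l 0 - 1) * (l 0 + 1) = 4 * d / s₀ := by linarith
    rw [this]; field_simp
  have a2 : 4 * d / 3 ≤ s₀ * (l 0 - 1) := by
    have : 0 ≤ (l 0 - 1) * s₀ * (2 - l 0) := mul_nonneg (mul_nonneg (by linarith) hs0.le) (by linarith)
    nlinarith
  have a3 : s₀ * (l 0 - 1) ≤ 2 * d := by
    have : 0 ≤ (l 0 - 1) * s₀ * (l 0 - 1) := mul_nonneg (mul_nonneg (by linarith) hs0.le) (by linarith)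
    nlinarith
  have hS0 : l 0 * s (θ 0) = s₀ * (l 0 - 1) + s₀ := by rw [B.θ0, h.s0]; ring
  have key := compare hv (S := fun t => l t * s (θ t)) (V := VV s u N r ε l θ)
    (B.lc.mul (h.sc.comp B.θc hθ0))
    (fun t ht => mul_pos (by linarith [B.l1 t ht]) (h.spos _ (hθ0 t ht))) (VV_cont h B)
    (fun t ht x hx => VV_pos h B ht hx) (fun t ht => VV_zero h B ht)
    (fun t ht => VV_free h B hs0 rfl ht)
    (fun t ht => VV_flux h B hp hs0 rfl ht (hH (θ t) ⟨hθ0 t ⟨ht.1.le, ht.2⟩, (B.θr t ⟨ht.1.le, ht.2⟩).trans ht.2⟩)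
      (by linarith))
    (fun t ht x hx => VV_heat h B hs0 rfl hM hφ hsm (by linarith) hN3 ht hx)
    (by simp only [hS0]; linarith) (by
      intro x hx
      refine (hψ x hx).trans ?_
      have hxσ : x < s₀ + d / 3 := by linarith [hx.2]
      have hy0 : 0 ≤ x / l 0 := div_nonneg hx.1 (by linarith)
      have hyx : x / l 0 ≤ x := div_le_self hx.1 hl01
      have hz : d / 2 ≤ s₀ - x / l 0 := by
        rw [le_sub_comm, div_le_iff₀ (by linarith)]
        nlinarith
      have hys : x / l 0 ≤ s₀ := by linarith
      have e1 : exp (-((N + 2 * r 0) * (s₀ - x / l 0))) ≤ 1/2 := by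
        have : 1 ≤ (N + 2 * r 0) * (s₀ - x / l 0) := by
          calc (1:ℝ) = 2 * r 0 * (d / 2) := by rw [hr0]; field_simp
            _ ≤ (N + 2 * r 0) * (s₀ - x / l 0) := by
              have := B.rp 0 h0
              apply mul_le_mul (by linarith) hz (by positivity) (by positivity)
        rw [Real.exp_neg, ← one_div]
        exact one_div_le_one_div_of_le (by norm_num) (by linarith [Real.add_one_le_exp ((N + 2 * r 0) * (s₀ - x / l 0))])
      have e2 : exp (-(N * s₀)) ≤ exp (-(N * (x / l 0))) :=
        Real.exp_le_exp.2 (neg_le_neg (mul_le_mul_of_nonneg_left hys (by linarith)))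
      have e3 : extZero s₀ φ x ≤ φ (x / l 0) + M * (2 * d) := by
        have hnn : 0 ≤ φ (x / l 0) := by
          rw [← h.u0 _ ⟨hy0, hys⟩]; exact h.un 0 le_rfl _ ⟨hy0, by rwa [h.s0]⟩
        unfold extZero
        split_ifs with hxs
        · have k := hφ x hxs (x / l 0) ⟨hy0, hys⟩ hyx
          have k2 : x - x / l 0 ≤ 2 * d := by
            have : x - x / l 0 = x / l 0 * (l 0 - 1) := by field_simp
            rw [this]
            exact le_trans (mul_le_mul_of_nonneg_right hys (by linarith)) a3
          have := mul_le_mul_of_nonneg_left k2 hM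
          linarith
        · positivity
      have e4 : VV s u N r ε l θ 0 x ≥ φ (x / l 0) + N * d * (1/2) := by
        simp only [VV, B.θ0, h.s0, hε0, h.u0 _ ⟨hy0, hys⟩]
        have := mul_le_mul_of_nonneg_left (show 1/2 ≤ 1 - exp (-((N + 2 * r 0) * (s₀ - x / l 0)))
          + exp (-(N * (x / l 0))) - exp (-(N * s₀)) by linarith) (show 0 ≤ N * d by positivity)
        linarith
      have e5 : (1 + 4 * M) * d ≤ N * d := mul_le_mul_of_nonneg_right (by linarith) hd.le
      linarith)
  intro t ht
  obtain ⟨k1, k2⟩ := key t ht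
  have hl1 := B.l1 t ht
  refine ⟨?_, fun x hx => ⟨θ t, x / l t, B.θl t ht, B.θr t ht, ⟨div_nonneg hx.1 (by linarith), ?_⟩, ?_⟩⟩
  · have := hsm (θ t) (hθ0 t ht)
    have := hll t ht
    have : l t * s (θ t) ≤ 2 * smax := mul_le_mul this (by assumption) (h.spos _ (hθ0 t ht)).le (by norm_num)
    linarith
  · rw [div_le_iff₀ (by linarith), mul_comm]; linarith [hx.2]
  · have := VV_le h B ht (x := x) ⟨hx.1, by linarith [hx.2]⟩
    have := k2 x hx
    have := hτ t ht
    linarith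

theorem phase2 {p R E β T1 : ℝ} {σ : ℝ → ℝ} {v : ℝ → ℝ → ℝ} (hp : 1 < p) (hR : 1 ≤ R)
    (hβ : β = 1 / (2 * (R+1)^2)) (hE0 : 0 < E) (hE1 : E ≤ β * R / 4) (hE2 : 2 * (2 * E) ^ (p-1) < 1 / (R+1))
    (hv : ∀ b, SubSol p T1 b σ v) (h1 : σ T1 ≤ R - 1) (h2 : ∀ x ∈ Icc 0 (σ T1), v T1 x < E / R)
    {t : ℝ} (ht : T1 ≤ t) : σ t < R + 1 ∧ ∀ x ∈ Icc 0 (σ t), v t x < 2 * E * exp (-β * (t - T1)) := by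
  have hβ0 : 0 < β := by rw [hβ]; positivity
  set q : ℝ → ℝ := fun t => exp (-β * (t - T1)) with hq
  have hq0 : ∀ t, 0 < q t := fun t => exp_pos _
  have hq1 : ∀ t, T1 ≤ t → q t ≤ 1 := fun t ht => Real.exp_le_one_iff.2 (by nlinarith)
  have hqd : ∀ t, HasDerivAt q (-β * q t) t := fun t =>
    ((((hasDerivAt_id t).sub_const T1).const_mul (-β)).exp).congr_deriv (by simp [hq]; ring)
  set S : ℝ → ℝ := fun t => R + 1 - q t with hS
  have hSd : ∀ t, HasDerivAt S (β * q t) t := fun t => ((hqd t).const_sub (R+1)).congr_deriv (by ring)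
  have hSR : ∀ t, T1 ≤ t → R ≤ S t := fun t ht => by simp only [hS]; linarith [hq1 t ht]
  have hSR' : ∀ t, S t < R + 1 := fun t => by simp only [hS]; linarith [hq0 t]
  have hS0 : ∀ t, T1 ≤ t → 0 < S t := fun t ht => by linarith [hSR t ht]
  set V : ℝ → ℝ → ℝ := fun t x => E * q t * (2 - x / S t - (x / S t)^2) with hV
  have hVx : ∀ t x, HasDerivAt (V t) (E * q t * (-(1 / S t) - 2 * (x / S t) * (1 / S t))) x := by
    intro t x
    have hy : HasDerivAt (fun x : ℝ => x / S t) (1 / S t) x := (hasDerivAt_id x).div_const _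
    have := (((hy.const_sub 2).sub (hy.pow 2)).const_mul (E * q t))
    exact this.congr_deriv (by norm_num)
  have hVx2 : ∀ t x, HasDerivAt (fun x => E * q t * (-(1 / S t) - 2 * (x / S t) * (1 / S t)))
      (E * q t * (-2 * (1 / S t)^2)) x := by
    intro t x
    have hy : HasDerivAt (fun x : ℝ => x / S t) (1 / S t) x := (hasDerivAt_id x).div_const _
    exact ((((hy.const_mul 2).mul_const (1 / S t)).const_sub (-(1 / S t))).const_mul (E * q t)).congr_deriv (by ring)
  have hSc : Continuous S := continuous_iff_continuousAt.2 fun t => (hSd t).continuousAt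
  have hqc : Continuous q := continuous_iff_continuousAt.2 fun t => (hqd t).continuousAt
  have key := compare (hv t) (S := S) (V := V) hSc.continuousOn (fun τ hτ => hS0 τ hτ.1) (by
      have cy : ContinuousOn (fun z : ℝ × ℝ => z.2 / S z.1) (Reg T1 t (fun _ => 0) S) :=
        continuousOn_snd.div (hSc.comp continuous_fst).continuousOn (fun z hz => (hS0 z.1 hz.1.1).ne')
      exact (continuousOn_const.mul (hqc.comp continuous_fst).continuousOn).mul
        ((continuousOn_const.sub cy).sub (cy.pow 2)))
    (by
      intro τ hτ x hx
      have hs := hS0 τ hτ.1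
      have y0 : 0 ≤ x / S τ := div_nonneg hx.1 hs.le
      have y1 : x / S τ < 1 := (div_lt_one hs).2 hx.2
      apply mul_pos (mul_pos hE0 (hq0 τ))
      nlinarith)
    (by
      intro τ hτ
      have hs := hS0 τ hτ.1
      simp only [hV, div_self hs.ne']; ring)
    (by
      intro τ hτ
      have hs := hS0 τ hτ.1.le
      refine ⟨_, _, (hSd τ).hasDerivWithinAt, (hVx τ _).hasDerivWithinAt, ?_⟩
      rw [div_self hs.ne']
      have e : -(E * q τ * (-(1 / S τ) - 2 * 1 * (1 / S τ))) = 3 * E / S τ * q τ := by ring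
      rw [e]
      apply mul_lt_mul_of_pos_right _ (hq0 τ)
      rw [div_lt_iff₀ hs]
      have := mul_le_mul_of_nonneg_left (hSR τ hτ.1.le) hβ0.le
      linarith)
    (by
      intro τ hτ
      have hs := hS0 τ hτ.1.le
      refine ⟨_, (hVx τ _).hasDerivWithinAt, ?_⟩
      have e : V τ 0 = 2 * E * q τ := by simp [hV]; ring
      rw [e]
      have hqq := hq0 τ
      have hpos : 0 < 2 * E * q τ := by positivity
      have e2 : (2 * E * q τ) ^ p = (2 * E * q τ) ^ (p-1) * (2 * E * q τ) := by
        rw [← Real.rpow_add_one hpos.ne']; simp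
      have e3 : (2 * E * q τ) ^ (p-1) ≤ (2 * E) ^ (p-1) :=
        Real.rpow_le_rpow hpos.le (mul_le_of_le_one_right (by positivity) (hq1 τ hτ.1.le)) (by linarith)
      have e4 : 1 / (R + 1) ≤ 1 / S τ := one_div_le_one_div_of_le hs (hSR' τ).le
      rw [e2]
      have e5 : -(E * q τ * (-(1 / S τ) - 2 * (0 / S τ) * (1 / S τ))) = 1 / S τ * (E * q τ) := by simp; ring
      rw [e5]
      have : (2 * E * q τ) ^ (p-1) * (2 * E * q τ) = 2 * (2 * E * q τ) ^ (p-1) * (E * q τ) := by ring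
      rw [this]
      apply mul_lt_mul_of_pos_right _ (by positivity)
      linarith)
    (by
      intro τ hτ x hx
      have hs := hS0 τ hτ.1.le
      have hqq := hq0 τ
      have hy : HasDerivAt (fun τ : ℝ => x / S τ) (-(x / S τ * (β * q τ) / S τ)) τ := by
        refine ((hasDerivAt_const τ x).div (hSd τ) hs.ne').congr_deriv ?_
        field_simp; ring
      have tt := (((hqd τ).const_mul E).mul ((hy.const_sub 2).sub (hy.pow 2)))
      refine ⟨_, _, ⟨tt, _, Eventually.of_forall (hVx τ), hVx2 τ x⟩, ?_⟩
      have y0 : 0 ≤ x / S τ := div_nonneg hx.1.le hs.le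
      simp only [Pi.sub_apply, Pi.pow_apply]
      have e1 : β * 4 ≤ 2 * (1 / S τ)^2 := by
        have : (1 / (R+1))^2 ≤ (1 / S τ)^2 := by
          apply pow_le_pow_left₀ (by positivity)
          exact one_div_le_one_div_of_le hs (hSR' τ).le
        have : β * 4 = 2 * (1 / (R+1))^2 := by rw [hβ]; field_simp; norm_num
        linarith
      set y := x / S τ
      have e2 : 0 ≤ E * q τ * (y * (β * q τ) / S τ * (1 + 2 * y)) := by positivity
      have e3 : E * q τ * (-2 * (1 / S τ)^2) ≤ E * q τ * (-(β * 4)) := by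
        apply mul_le_mul_of_nonneg_left _ (by positivity); linarith
      have e4 : 0 < E * q τ * β := by positivity
      have e5 : 0 ≤ E * q τ * β * (y + y^2) := by positivity
      refine lt_of_le_of_lt e3 ?_
      norm_num
      nlinarith)
    (by
      have := hSR T1 le_rfl
      linarith)
    (by
      intro x hx
      have eq : q T1 = 1 := by simp [hq]
      have eS : S T1 = R := by simp [hS, eq]
      simp only [hV, eq, eS]
      refine (h2 x hx).trans ?_
      have hR0 : 0 < R := by linarith
      have y0 : 0 ≤ x / R := div_nonneg hx.1 hR0.le
      have y1 : x / R ≤ 1 - 1 / R := by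
        rw [div_le_iff₀ hR0, sub_mul, one_div, inv_mul_cancel₀ hR0.ne']
        linarith [hx.2]
      have i0 : 0 < 1 / R := by positivity
      rw [mul_one, div_eq_mul_one_div]
      apply mul_lt_mul_of_pos_left _ hE0
      nlinarith) t ⟨ht, le_rfl⟩
  refine ⟨key.1.trans (hSR' t), fun x hx => (key.2 x hx).trans_le ?_⟩
  have y0 : 0 ≤ x / S t := div_nonneg hx.1 (hS0 t ht).le
  have := mul_le_mul_of_nonneg_left (show 2 - x / S t - (x / S t)^2 ≤ 2 by nlinarith) (mul_pos hE0 (hq0 t)).le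
  simp only [hV]; linarith

theorem memW.bd {a : ℝ} {f : ℝ → ℝ} (h : memW a f) : ∃ B, ∀ x, |extZero a f x| ≤ B := by
  obtain ⟨ha, ⟨K, hK⟩, -, -, -⟩ := h
  obtain ⟨B, hB⟩ := isCompact_Icc.exists_bound_of_continuousOn hK.continuousOn
  refine ⟨B, fun x => ?_⟩
  unfold extZero
  split_ifs with hx
  · exact hB x hx
  · simpa using (abs_nonneg _).trans (hB 0 ⟨le_rfl, ha.le⟩)

theorem ext_close {a b η : ℝ} {f g : ℝ → ℝ} (hf : memW a f) (hg : memW b g)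
    (h : |b - a| + sSup ((fun x => |extZero b g x - extZero a f x|) '' Ici 0) < η) :
    b < a + η ∧ ∀ x ∈ Icc 0 b, g x < extZero a f x + η := by
  obtain ⟨A, hA⟩ := hf.bd
  obtain ⟨B, hB⟩ := hg.bd
  have hb : BddAbove ((fun x => |extZero b g x - extZero a f x|) '' Ici 0) := by
    refine ⟨B + A, ?_⟩
    rintro _ ⟨x, -, rfl⟩
    exact (abs_sub _ _).trans (add_le_add (hB x) (hA x))
  have hle : ∀ x, 0 ≤ x → |extZero b g x - extZero a f x| ≤
      sSup ((fun x => |extZero b g x - extZero a f x|) '' Ici 0) := fun x hx =>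
    le_csSup hb ⟨x, hx, rfl⟩
  have h0 := (abs_nonneg _).trans (hle 0 le_rfl)
  have h1 := abs_nonneg (b - a)
  have h2 := le_abs_self (b - a)
  refine ⟨by linarith, fun x hx => ?_⟩
  have h3 := (le_abs_self _).trans (hle x hx.1)
  have h4 : extZero b g x = g x := if_pos hx
  linarith

theorem memW.ini {σ : ℝ} {ψ : ℝ → ℝ} (h : memW σ ψ) : ∃ L, IniD (fun x => ψ (min |x| σ)) σ L := by
  obtain ⟨ha, ⟨K, hK⟩, -, hn, hz⟩ := h
  have hm : ∀ x : ℝ, min |x| σ ∈ Icc 0 σ := fun x => ⟨le_min (abs_nonneg x) ha.le, min_le_right _ _⟩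
  refine ⟨K, ha, K.2, fun a b => ?_, fun x => by simp, fun x => hn _ (hm x), fun x hx => ?_⟩
  · have h1 := hK.dist_le_mul _ (hm a) _ (hm b)
    rw [Real.dist_eq, Real.dist_eq] at h1
    refine h1.trans (mul_le_mul_of_nonneg_left ?_ K.2)
    exact (abs_min_sub_min_le_max _ _ _ _).trans (by simpa using abs_abs_sub_abs_le a b)
  · rw [min_eq_right (hx.trans (le_abs_self x)), hz]

theorem GS.le_sup {p s₀ : ℝ} {φ s : ℝ → ℝ} {u u1 u2 : ℝ → ℝ → ℝ} (h : GS p s₀ φ s u u1 u2)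
    {t y c : ℝ} (ht : 0 ≤ t) (hc : supNorm s u t ≤ c) (hy : y ∈ Icc 0 (s t)) : u t y ≤ c := by
  have hcont : ContinuousOn (u t) (Icc 0 (s t)) := by
    refine ContinuousOn.comp (g := fun q : ℝ × ℝ => u q.1 q.2) (f := fun x : ℝ => (t, x)) h.uc
      (by fun_prop) fun x hx => ⟨ht, hx⟩
  have hb : BddAbove (u t '' Ioo 0 (s t)) :=
    (isCompact_Icc.bddAbove_image hcont).mono (image_mono Ioo_subset_Icc_self)
  have hcl : closure (Ioo 0 (s t)) = Icc 0 (s t) := closure_Ioo (h.spos t ht).ne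
  refine le_on_closure (f := u t) (g := fun _ => c) (s := Ioo 0 (s t)) (fun x hx => ?_)
    (by rw [hcl]; exact hcont) continuousOn_const (by rw [hcl]; exact hy)
  exact (le_csSup hb ⟨x, hx, rfl⟩).trans hc

theorem exists_E {p a b : ℝ} (hp : 1 < p) (ha : 0 < a) (hb : 0 < b) :
    ∃ E, 0 < E ∧ E ≤ a ∧ 2 * (2 * E) ^ (p-1) < b := by
  have hc : Tendsto (fun E : ℝ => 2 * (2 * E) ^ (p-1)) (𝓝[>] 0) (𝓝 0) := by
    have : ContinuousAt (fun E : ℝ => 2 * (2 * E) ^ (p-1)) 0 := by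
      refine continuousAt_const.mul (ContinuousAt.rpow_const (by fun_prop) (Or.inr (by linarith)))
    have h2 := this.tendsto
    simp only [mul_zero, Real.zero_rpow (by linarith : p - 1 ≠ 0)] at h2
    exact h2.mono_left nhdsWithin_le_nhds
  have h1 := hc.eventually (gt_mem_nhds hb)
  have h2 : ∀ᶠ E : ℝ in 𝓝[>] 0, E ≤ a := nhdsWithin_le_nhds (Iic_mem_nhds ha)
  obtain ⟨E, hE⟩ := (h1.and (h2.and self_mem_nhdsWithin)).exists
  exact ⟨E, hE.2.2, hE.2.1, hE.1⟩

/-- Proposition 4.5: stability of global-in-time solutions with exponential decay. -/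
theorem stmt_19 (p : ℝ) (hp : 1 < p) (s₀ : ℝ) (φ : ℝ → ℝ) (hW : memW s₀ φ)
    (s : ℝ → ℝ) (u : ℝ → ℝ → ℝ) (hsol : IsGlobalSol p s₀ φ s u)
    (hconv : ∃ L : ℝ, Tendsto s atTop (𝓝 L))
    (hdecay : ∃ α : ℝ, 0 < α ∧
      (fun t => supNorm s u t) =O[atTop] fun t => Real.exp (-α * t)) :
    ∃ η : ℝ, 0 < η ∧ ∀ (σ₀ : ℝ) (ψ : ℝ → ℝ), memW σ₀ ψ →
      |σ₀ - s₀| + sSup ((fun x => |extZero σ₀ ψ x - extZero s₀ φ x|) '' Ici 0) < η →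
      ∃ σ v, IsGlobalSol p σ₀ ψ σ v ∧
        (∃ L : ℝ, Tendsto σ atTop (𝓝 L)) ∧
        ∃ β : ℝ, 0 < β ∧
          (fun t => supNorm σ v t) =O[atTop] fun t => Real.exp (-β * t) := by
  obtain ⟨hs0, ⟨K, hK⟩, -, hφn, hφ0⟩ := id hW
  have h := GS.of hsol hs0 hφ0
  obtain ⟨smax, hL⟩ := hconv
  have hsm : ∀ t, 0 ≤ t → s t ≤ smax := fun t ht =>
    ge_of_tendsto hL ((eventually_ge_atTop t).mono fun τ hτ => h.mono ht (ht.trans hτ) hτ)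
  have hsm0 : 0 < smax := (h.spos 0 le_rfl).trans_le (hsm 0 le_rfl)
  have hφ : ∀ x ∈ Icc 0 s₀, ∀ y ∈ Icc 0 s₀, y ≤ x → φ x - φ y ≤ (K : ℝ) * (x - y) := by
    intro x hx y hy hxy
    have h1 := hK.dist_le_mul _ hx _ hy
    rw [Real.dist_eq, Real.dist_eq, abs_of_nonneg (sub_nonneg.2 hxy)] at h1
    exact (le_abs_self _).trans h1
  obtain ⟨R, hRd⟩ : ∃ R, R = 2 * smax + 1 := ⟨_, rfl⟩
  have hR : 1 ≤ R := by linarith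
  obtain ⟨β, hβ⟩ : ∃ β, β = 1 / (2 * (R+1)^2) := ⟨_, rfl⟩
  have hβ0 : 0 < β := by rw [hβ]; positivity
  obtain ⟨E, hE0, hE1, hE2⟩ := exists_E hp (show 0 < β * R / 4 by positivity)
    (show 0 < 1 / (R+1) by positivity)
  have hER : 0 < E / (4 * R) := by positivity
  obtain ⟨α, hα, hO⟩ := hdecay
  have hexp : Tendsto (fun t : ℝ => Real.exp (-α * t)) atTop (𝓝 0) :=
    Real.tendsto_exp_atBot.comp (tendsto_id.const_mul_atTop_of_neg (by linarith))
  have hsup := (hO.trans_tendsto hexp).eventually (gt_mem_nhds hER)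
  obtain ⟨T0, hT0⟩ := eventually_atTop.1 hsup
  obtain ⟨T1, hT1d⟩ : ∃ T1, T1 = 2 * max T0 1 := ⟨_, rfl⟩
  have hT1 : 0 < T1 := by have := le_max_right T0 1; linarith
  have hT1' : T0 ≤ T1 / 2 := by have := le_max_left T0 1; linarith
  have hu : ∀ θ, T1 / 2 ≤ θ → ∀ y ∈ Icc 0 (s θ), u θ y ≤ E / (4 * R) := fun θ hθ y hy =>
    h.le_sup (by linarith) (hT0 θ (hT1'.trans hθ)).le hy
  have hcomp := isCompact_Reg (a := 0) (b := T1) (l := fun _ => 0) (r := s) continuousOn_const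
    (h.sc.mono fun t ht => ht.1) (fun t ht => (h.spos t ht.1).le)
  obtain ⟨B, hB⟩ := hcomp.exists_bound_of_continuousOn (h.uc.mono fun q hq => ⟨hq.1.1, hq.2⟩)
  have hB' : ∀ θ ∈ Icc 0 T1, ∀ y ∈ Icc 0 (s θ), u θ y ≤ B := fun θ hθ y hy =>
    (le_abs_self _).trans (hB (θ, y) ⟨hθ, hy⟩)
  obtain ⟨κ, hκd⟩ : ∃ κ, κ = min 1 (E / (4 * R)) := ⟨_, rfl⟩
  have hκ : 0 < κ := by rw [hκd]; positivity
  have hκ1 : κ ≤ 1 := hκd ▸ min_le_left _ _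
  have hκ2 : κ ≤ E / (4 * R) := hκd ▸ min_le_right _ _
  have hB0 : 0 ≤ B := (h.un 0 le_rfl 0 ⟨le_rfl, (h.spos 0 le_rfl).le⟩).trans
    (hB' 0 ⟨le_rfl, hT1.le⟩ 0 ⟨le_rfl, (h.spos 0 le_rfl).le⟩)
  obtain ⟨H, hHd⟩ : ∃ H, H = B + 1 + 2 * E := ⟨_, rfl⟩
  have hH : 0 ≤ H := by linarith
  obtain ⟨η, hη, hP1⟩ := phase1 h hp hs0 (M := K) (smax := smax) K.2 hφ hsm hT1 hκ (H := H)
    (fun t ht => by have := hB' t ht 0 ⟨le_rfl, (h.spos t ht.1).le⟩; linarith)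
  refine ⟨η, hη, fun σ₀ ψ hψ hclose => ?_⟩
  obtain ⟨hc1, hc2⟩ := ext_close hW hψ hclose
  obtain ⟨L', hI⟩ := hψ.ini
  obtain ⟨σ, γ, f, v, v1, v2, hT⟩ := trunc_exists hI hp hH
  have hwψ : ∀ x ∈ Icc 0 σ₀, (fun x => ψ (min |x| σ₀)) x = ψ x := fun x hx => by
    simp only
    rw [abs_of_nonneg hx.1, min_eq_left hx.2]
  have hA := hP1 σ v (hT.sub hp hH le_rfl) (by rw [hT.s0]; exact hc1) (fun x hx => by
    rw [hT.s0] at hx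
    rw [(hT.v0 x hx).trans (hwψ x hx)]; exact hc2 x hx)
  have hA1 := hA T1 ⟨hT1.le, le_rfl⟩
  have hP2 := fun t (ht : T1 ≤ t) => phase2 (σ := σ) (v := v) hp hR hβ hE0 hE1 hE2
    (fun b => hT.sub hp hH hT1.le) (by linarith [hA1.1]) (fun x hx => by
      obtain ⟨θ, y, hθ, -, hy, hlt⟩ := hA1.2 x hx
      have := hu θ hθ y hy
      have he : E / R = 4 * (E / (4 * R)) := by field_simp
      linarith) ht
  have hvH : ∀ t, 0 < t → v t 0 ≤ H := by
    intro t ht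
    rcases le_total t T1 with h1 | h1
    · obtain ⟨θ, y, hθ, hθ', hy, hlt⟩ := (hA t ⟨ht.le, h1⟩).2 0 ⟨le_rfl, (hT.spos t).le⟩
      have := hB' θ ⟨by linarith, hθ'.trans h1⟩ y hy
      linarith
    · have h2 := (hP2 t h1).2 0 ⟨le_rfl, (hT.spos t).le⟩
      have h3 : exp (-β * (t - T1)) ≤ 1 := Real.exp_le_one_iff.2 (by
        have := mul_nonneg hβ0.le (sub_nonneg.2 h1); linarith)
      have h4 := mul_le_mul_of_nonneg_left h3 (by linarith : 0 ≤ 2 * E)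
      linarith
  refine ⟨σ, v, hT.sol hwψ hvH, ?_, β, hβ0, ?_⟩
  · have hmono : Monotone (fun t => σ (max t 0)) := fun a b hab =>
      hT.mono (show (0:ℝ) ≤ _ from le_max_right _ _) (show (0:ℝ) ≤ _ from le_max_right _ _)
        (max_le_max hab le_rfl)
    have hbdd : BddAbove (range fun t => σ (max t 0)) := by
      refine ⟨R + 1, ?_⟩
      rintro _ ⟨t, rfl⟩
      exact (hT.mono (a := max t 0) (b := max (max t 0) T1) (show (0:ℝ) ≤ _ from le_max_right _ _)
        (show (0:ℝ) ≤ _ from (le_max_right t 0).trans (le_max_left _ _)) (le_max_left _ _)).trans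
        (hP2 _ (le_max_right _ _)).1.le
    refine ⟨_, (tendsto_atTop_ciSup hmono hbdd).congr' ?_⟩
    filter_upwards [eventually_ge_atTop 0] with t ht
    rw [max_eq_left ht]
  · refine Asymptotics.IsBigO.of_bound (2 * E * exp (β * T1)) ?_
    filter_upwards [eventually_ge_atTop T1] with t ht
    have ht0 : 0 ≤ t := hT1.le.trans ht
    have h0 : 0 ≤ supNorm σ v t := by
      apply Real.sSup_nonneg
      rintro _ ⟨x, hx, rfl⟩
      exact hT.vn t ht0 x (Ioo_subset_Icc_self hx)
    rw [Real.norm_of_nonneg h0, Real.norm_of_nonneg (exp_pos _).le, mul_assoc, ← Real.exp_add]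
    have he : β * T1 + -β * t = -β * (t - T1) := by ring
    rw [he]
    refine csSup_le ((nonempty_Ioo.2 (hT.spos t)).image _) ?_
    rintro _ ⟨x, hx, rfl⟩
    exact ((hP2 t ht).2 x (Ioo_subset_Icc_self hx)).le
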